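/- Let d ≥ 2, γ > 0 and p > p_c. There exists β > 0 such that for every c > 0, Q-almost surely on the event {|C| = +∞}, for all sufficiently large n (the rank depending on ω and c): for every connected subset A of C_n one has |∂_{C^g} A| / f_c(|A|) ≥ β. -/

import Mathlib

open MeasureTheory
open scoped ENNReal

namespace Perco

/-- Vertices of the lattice `Z^d`. -/
abbrev Zd (d : ℕ) := Fin d → ℤ

/-- A percolation configuration: each (unordered) edge of the lattice is open or closed.
(Only the values on nearest-neighbour pairs matter.) -/
abbrev Config (d : ℕ) := Sym2 (Zd d) → Bool

/-- Lattice adjacency: `(x,y) ∈ E^d`. -/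
def latAdj {d : ℕ} (x y : Zd d) : Prop := (∑ i, |x i - y i|) = 1

/-- Open adjacency in the configuration `ω`. -/
def openAdj {d : ℕ} (ω : Config d) (x y : Zd d) : Prop :=
  latAdj x y ∧ ω s(x, y) = true

/-- `C`: the open cluster of the origin. -/
def cluster {d : ℕ} (ω : Config d) : Set (Zd d) :=
  {y | Relation.ReflTransGen (openAdj ω) 0 y}

/-- `Q` is the product measure making the edge states i.i.d. Bernoulli(p). -/
def IsBernoulli {d : ℕ} (p : ℝ) (Q : Measure (Config d)) : Prop :=
  IsProbabilityMeasure Q ∧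
    ∀ (s : Finset (Sym2 (Zd d))) (f : Sym2 (Zd d) → Bool),
      Q {ω : Config d | ∀ e ∈ s, ω e = f e} =
        ∏ e ∈ s, (if f e then ENNReal.ofReal p else ENNReal.ofReal (1 - p))

/-- The critical probability `p_c`. -/
noncomputable def pc (d : ℕ) : ℝ :=
  sSup {p : ℝ | 0 ≤ p ∧ p ≤ 1 ∧
    ∀ Q : Measure (Config d), IsBernoulli p Q → Q {ω | (cluster ω).Infinite} = 0}

/-- The box `B_n = [-n,n]^d`. -/
def box (d n : ℕ) : Set (Zd d) := {x | ∀ i, |x i| ≤ (n : ℤ)}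

/-- `C_n`: the connected component of `0` in `C ∩ B_n`. -/
def clusterN {d : ℕ} (ω : Config d) (n : ℕ) : Set (Zd d) :=
  {y | Relation.ReflTransGen
    (fun a b => openAdj ω a b ∧ a ∈ box d n ∧ b ∈ box d n) 0 y}

/-- `A` is connected in the open subgraph. -/
def ConnOpen {d : ℕ} (ω : Config d) (A : Set (Zd d)) : Prop :=
  ∀ x ∈ A, ∀ y ∈ A,
    Relation.ReflTransGen (fun a b => openAdj ω a b ∧ a ∈ A ∧ b ∈ A) x y

/-- `A` is connected in the lattice. -/
def ConnLat {d : ℕ} (A : Set (Zd d)) : Prop :=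
  ∀ x ∈ A, ∀ y ∈ A,
    Relation.ReflTransGen (fun a b => latAdj a b ∧ a ∈ A ∧ b ∈ A) x y

/-- The boundary `∂_{C^g} A` = open lattice edges from `A` to its complement. -/
def bdry {d : ℕ} (ω : Config d) (A : Set (Zd d)) : Set (Zd d × Zd d) :=
  {e | openAdj ω e.1 e.2 ∧ e.1 ∈ A ∧ e.2 ∉ A}

/-- The profile `f_c` (at scale `n`, exponent `γ`). -/
noncomputable def fcut (d : ℕ) (γ c : ℝ) (n : ℕ) (x : ℝ) : ℝ :=
  if x < c * (n : ℝ) ^ γ then 1 else x ^ (1 - 1 / (d : ℝ))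

/-- `ν(x)`: number of open neighbours of `x`. -/
noncomputable def nu {d : ℕ} (ω : Config d) (x : Zd d) : ℕ :=
  Set.ncard {y | openAdj ω x y}

-- Transition kernel of the simple random walk on the open subgraph.
open Classical in
noncomputable def step {d : ℕ} (ω : Config d) (x y : Zd d) : ℝ :=
  if openAdj ω x y then ((nu ω x : ℝ))⁻¹ else 0

/-- Weight of a path of length `n`. -/
noncomputable def pathW {d n : ℕ} (ω : Config d) (γ : Fin (n + 1) → Zd d) : ℝ :=
  ∏ i : Fin n, step ω (γ i.castSucc) (γ i.succ)

/-- `N_n`: number of distinct sites visited by the path. -/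
noncomputable def visits {d n : ℕ} (γ : Fin (n + 1) → Zd d) : ℕ :=
  (Set.range γ).ncard

/-- `P_0^ω(E)`, the probability of a path event for the walk started at 0. -/
noncomputable def PWalk {d : ℕ} (ω : Config d) (n : ℕ)
    (E : (Fin (n + 1) → Zd d) → Prop) : ℝ :=
  ∑' γ : Fin (n + 1) → Zd d,
    Set.indicator {γ | γ 0 = 0 ∧ E γ} (fun γ => pathW ω γ) γ

/-- `E_0^ω(α^{N_n})`. -/
noncomputable def LaplaceN {d : ℕ} (ω : Config d) (α : ℝ) (n : ℕ) : ℝ :=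
  ∑' γ : Fin (n + 1) → Zd d,
    Set.indicator {γ | γ 0 = 0} (fun γ => pathW ω γ * α ^ visits γ) γ

/-- `E_0^ω(α^{N_n} 1_{X_n = 0})`. -/
noncomputable def LaplaceNReturn {d : ℕ} (ω : Config d) (α : ℝ) (n : ℕ) : ℝ :=
  ∑' γ : Fin (n + 1) → Zd d,
    Set.indicator {γ | γ 0 = 0 ∧ γ (Fin.last n) = 0}
      (fun γ => pathW ω γ * α ^ visits γ) γ

/-- Vertices of the wreath product `C^g ≀ Z/2Z` (lamplighter states). -/
abbrev Lamp (d : ℕ) := Zd d × (Zd d →₀ ZMod 2)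

/-- Flip a lamp configuration at one point. -/
noncomputable def flipAt {σ : Type*} (f : σ →₀ ZMod 2) (x : σ) : σ →₀ ZMod 2 :=
  f + Finsupp.single x 1

/-- Transition kernel of the lamplighter walk `Z` with parameter `α`. -/
noncomputable def ptilde {d : ℕ} (ω : Config d) (α : ℝ) (u v : Lamp d) : ℝ :=
  Set.indicator
    {q : Lamp d × Lamp d | ∀ x, x ≠ q.1.1 → x ≠ q.2.1 → q.1.2 x = q.2.2 x}
    (fun q => (if q.2.2 q.1.1 = 0 then α else 1 - α) *
      (if q.2.2 q.2.1 = 0 then α else 1 - α) * step ω q.1.1 q.2.1) (u, v)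

/-- `P̃_o^ω(Z_n = o)`: return probability of the lamplighter walk. -/
noncomputable def ZReturn {d : ℕ} (ω : Config d) (α : ℝ) (n : ℕ) : ℝ :=
  ∑' γ : Fin (n + 1) → Lamp d,
    Set.indicator {γ | γ 0 = (0, 0) ∧ γ (Fin.last n) = (0, 0)}
      (fun γ => ∏ i : Fin n, ptilde ω α (γ i.castSucc) (γ i.succ)) γ

/-- Vertex set of the wreath product over a vertex set `V` of the base. -/
def wVert {d : ℕ} (V : Set (Zd d)) : Set (Lamp d) :=
  {u | u.1 ∈ V ∧ ↑u.2.support ⊆ V}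

/-- Adjacency in the wreath product `C^g ≀ Z/2Z`. -/
def wAdj {d : ℕ} (ω : Config d) (u v : Lamp d) : Prop :=
  (u.1 = v.1 ∧ (∀ x, x ≠ u.1 → u.2 x = v.2 x) ∧ u.2 u.1 ≠ v.2 u.1) ∨
    (u.2 = v.2 ∧ openAdj ω u.1 v.1)

/-- Boundary of `U` in the wreath product `C^g ≀ Z/2Z`. -/
def wBdry {d : ℕ} (ω : Config d) (U : Set (Lamp d)) : Set (Lamp d × Lamp d) :=
  {e | e.1 ∈ U ∧ e.2 ∈ wVert (cluster ω) \ U ∧ wAdj ω e.1 e.2}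

/-- Følner function `Fol_{C_n^g}^{C^g}` (with value `⊤` when no set qualifies). -/
noncomputable def FolC {d : ℕ} (ω : Config d) (n : ℕ) (k : ℝ) : ℝ≥0∞ :=
  sInf {m : ℝ≥0∞ | ∃ A : Set (Zd d), A ⊆ clusterN ω n ∧ A.Nonempty ∧
    ((bdry ω A).ncard : ℝ) / (A.ncard : ℝ) ≤ 1 / k ∧ m = (A.ncard : ℝ≥0∞)}

/-- Følner function `Fol_{C_n^g ≀ Z/2Z}^{C^g ≀ Z/2Z}`. -/
noncomputable def FolW {d : ℕ} (ω : Config d) (n : ℕ) (k : ℝ) : ℝ≥0∞ :=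
  sInf {m : ℝ≥0∞ | ∃ U : Set (Lamp d), U ⊆ wVert (clusterN ω n) ∧ U.Nonempty ∧
    ((wBdry ω U).ncard : ℝ) / (U.ncard : ℝ) ≤ 1 / k ∧ m = (U.ncard : ℝ≥0∞)}

/-- Degree of a configuration `f` in the graph `K_U`. -/
noncomputable def Kdeg {d : ℕ} (U : Set (Lamp d)) (f : Zd d →₀ ZMod 2) : ℕ :=
  Set.ncard {g : Zd d →₀ ZMod 2 | ∃ x : Zd d, (x, f) ∈ U ∧ (x, g) ∈ U ∧ g = flipAt f x}

/-- A point `u = (x,f)` of `U` is bad if `(x, f̄_x) ∉ U`. -/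
def badPt {d : ℕ} (U : Set (Lamp d)) (u : Lamp d) : Prop :=
  (u.1, flipAt u.2 u.1) ∉ U

/-- `D(0,x) ≤ r`: the chemical distance from the origin to `x` is at most `r`. -/
def chemLE {d : ℕ} (ω : Config d) (x : Zd d) (r : ℕ) : Prop :=
  ∃ m ≤ r, ∃ γ : ℕ → Zd d, γ 0 = 0 ∧ γ m = x ∧ ∀ i < m, openAdj ω (γ i) (γ (i + 1))

/-- `B_r(C)`: chemical ball of radius `r` around the origin. -/
def chemBall {d : ℕ} (ω : Config d) (r : ℕ) : Set (Zd d) := {x | chemLE ω x r}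

/-- Lattice connected component of `x` inside a vertex set `V`. -/
def latCompIn {d : ℕ} (V : Set (Zd d)) (x : Zd d) : Set (Zd d) :=
  {y | Relation.ReflTransGen (fun a b => latAdj a b ∧ a ∈ V ∧ b ∈ V) x y}

/-- Open connected component of `x` inside a vertex set `V`. -/
def openCompIn {d : ℕ} (ω : Config d) (V : Set (Zd d)) (x : Zd d) : Set (Zd d) :=
  {y | Relation.ReflTransGen (fun a b => openAdj ω a b ∧ a ∈ V ∧ b ∈ V) x y}

/-- `L_n`: a connected component of the open subgraph inside `B_n` of maximal cardinality. -/
def IsLargestComp {d : ℕ} (ω : Config d) (n : ℕ) (L : Set (Zd d)) : Prop :=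
  (∃ x ∈ box d n, L = openCompIn ω (box d n) x) ∧
    ∀ y ∈ box d n, (openCompIn ω (box d n) y).ncard ≤ L.ncard

/-- `\bar L`: the connected component of `L` in the full open subgraph. -/
def closureOf {d : ℕ} (ω : Config d) (L : Set (Zd d)) : Set (Zd d) :=
  {y | ∃ x ∈ L, Relation.ReflTransGen (openAdj ω) x y}

/-- The boundary `∂_{\bar L_n^g} A`. -/
def bdryBar {d : ℕ} (ω : Config d) (n : ℕ) (L A : Set (Zd d)) : Set (Zd d × Zd d) :=
  {e | openAdj ω e.1 e.2 ∧ e.1 ∈ A ∩ closureOf ω L ∧ e.2 ∈ box d (n + 1) \ A}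

/-- `n(A)`: number of connected components of `B_n − L` containing a component of `A`. -/
noncomputable def nComp {d : ℕ} (n : ℕ) (L A : Set (Zd d)) : ℕ :=
  Set.ncard {P : Set (Zd d) |
    (∃ x ∈ box d n \ L, P = latCompIn (box d n \ L) x) ∧
    ∃ x ∈ A, latCompIn A x ⊆ P}

/-- The killed kernel `P^{B_r(C)}` acting on functions. -/
noncomputable def Pball {d : ℕ} (ω : Config d) (r : ℕ) (f : Zd d → ℝ) : Zd d → ℝ :=
  Set.indicator (chemBall ω r) (fun x =>
    ∑' y : Zd d, Set.indicator (chemBall ω r) (fun y => step ω x y * f y) y)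

/-- The Dirichlet form `ξ(f,f) = ((Id − P^{B_r(C)}) 1_{B_r(C)} f | f)_ν`. -/
noncomputable def dirichletForm {d : ℕ} (ω : Config d) (r : ℕ) (f : Zd d → ℝ) : ℝ :=
  ∑' x : Zd d, (nu ω x : ℝ) * f x *
    (Set.indicator (chemBall ω r) f x - Pball ω r (Set.indicator (chemBall ω r) f) x)

/-- `‖f‖²_{l²(ν)}`. -/
noncomputable def normSq {d : ℕ} (ω : Config d) (f : Zd d → ℝ) : ℝ :=
  ∑' x : Zd d, (nu ω x : ℝ) * f x ^ 2

/-- `λ_1(B_r(C))`: smallest Dirichlet eigenvalue of the killed walk. -/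
noncomputable def lambda1 {d : ℕ} (ω : Config d) (r : ℕ) : ℝ :=
  sInf {t : ℝ | ∃ f : Zd d → ℝ, f ≠ 0 ∧ Function.support f ⊆ chemBall ω r ∧
    t = dirichletForm ω r f / normSq ω f}

open ProbabilityTheory

section Bernoulli
variable {I : Type*}

/-- The product measure on `I → Bool` with marginals `q i`. -/
noncomputable def bern (q : I → unitInterval) : Measure (I → Bool) :=
  Measure.infinitePi fun i => bernoulliMeasure true false (q i)

instance (q : I → unitInterval) : IsProbabilityMeasure (bern q) := by
  unfold bern; infer_instance

/-- The event `E` is determined by the coordinates in `S`. -/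
def Dep (S : Set I) (E : Set (I → Bool)) : Prop :=
  ∀ ω ω' : I → Bool, (∀ i ∈ S, ω i = ω' i) → ω ∈ E → ω' ∈ E

lemma Dep.mono {S T : Set I} {E : Set (I → Bool)} (h : Dep S E) (hST : S ⊆ T) : Dep T E :=
  fun ω ω' hω => h ω ω' fun i hi => hω i (hST hi)

lemma Dep.iff {S : Set I} {E : Set (I → Bool)} (h : Dep S E) {ω ω' : I → Bool}
    (hω : ∀ i ∈ S, ω i = ω' i) : ω ∈ E ↔ ω' ∈ E :=
  ⟨h ω ω' hω, h ω' ω fun i hi => (hω i hi).symm⟩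

lemma Dep.of_iff {S : Set I} {E : Set (I → Bool)}
    (h : ∀ ω ω' : I → Bool, (∀ i ∈ S, ω i = ω' i) → (ω ∈ E ↔ ω' ∈ E)) : Dep S E :=
  fun ω ω' hω => (h ω ω' hω).1

lemma Dep.compl {S : Set I} {E : Set (I → Bool)} (h : Dep S E) : Dep S Eᶜ :=
  fun _ _ hω hE hE' => hE ((h.iff hω).2 hE')

lemma Dep.inter {S : Set I} {E F : Set (I → Bool)} (h : Dep S E) (h' : Dep S F) :
    Dep S (E ∩ F) :=
  fun ω ω' hω hE => ⟨h ω ω' hω hE.1, h' ω ω' hω hE.2⟩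

lemma Dep.eq_preimage {S : Set I} {E : Set (I → Bool)} (h : Dep S E) :
    E = S.domRestrict ⁻¹' (S.domRestrict '' E) := by
  ext ω
  constructor
  · exact fun hω => ⟨ω, hω, rfl⟩
  · rintro ⟨ω', hω', he⟩
    exact h ω' ω (fun i hi => congrFun he ⟨i, hi⟩) hω'

lemma Dep.measurableSet {S : Set I} {E : Set (I → Bool)} (h : Dep S E) (hS : S.Finite) :
    MeasurableSet E := by
  have := hS.to_subtype
  rw [h.eq_preimage]
  exact (Set.toFinite _).measurableSet.preimage (by unfold Set.domRestrict; fun_prop)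

lemma bern_indep (q : I → unitInterval) {S T : Set I} (hS : S.Finite) (hT : T.Finite)
    (hST : Disjoint S T) {E F : Set (I → Bool)} (hE : Dep S E) (hF : Dep T F) :
    (bern q).real (E ∩ F) = (bern q).real E * (bern q).real F := by
  have h := iIndepFun_infinitePi (P := fun i => bernoulliMeasure true false (q i))
    (X := fun _ b => b) (fun _ => measurable_id)
  have h2 := h.indepFun_finset hS.toFinset hT.toFinset (by simpa using hST)
    (fun i => by fun_prop)
  have hE' : Dep (hS.toFinset : Set I) E := by simpa using hE
  have hF' : Dep (hT.toFinset : Set I) F := by simpa using hF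
  have h3 := h2.measure_inter_preimage_eq_mul _ _
    (Set.toFinite ((hS.toFinset : Set I).domRestrict '' E)).measurableSet
    (Set.toFinite ((hT.toFinset : Set I).domRestrict '' F)).measurableSet
  have e1 := hE'.eq_preimage
  have e2 := hF'.eq_preimage
  unfold bern
  simp only [measureReal_def, ← ENNReal.toReal_mul]
  congr 1
  conv_lhs => rw [e1, e2]
  conv_rhs => rw [e1, e2]
  exact h3

lemma bern_map (q : I → unitInterval) {J : Type*} {f : J → I} (hf : Function.Injective f) :
    (bern q).map (fun ω j => ω (f j)) = bern (fun j => q (f j)) :=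
  Measure.map_infinitePi_infinitePi_of_inj hf

lemma bern_reindex (q : I → unitInterval) {J : Type*} {f : J → I} (hf : Function.Injective f)
    {E : Set (J → Bool)} (hE : MeasurableSet E) :
    (bern q).real {ω | (fun j => ω (f j)) ∈ E} = (bern (fun j => q (f j))).real E := by
  rw [← bern_map q hf, measureReal_def, measureReal_def, Measure.map_apply (by fun_prop) hE]
  rfl

lemma bern_cyl (q : I → unitInterval) (s : Finset I) (f : I → Bool) :
    (bern q) {ω | ∀ i ∈ s, ω i = f i} =
      ∏ i ∈ s, (if f i then ENNReal.ofReal (q i) else ENNReal.ofReal (1 - q i)) := by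
  have : {ω : I → Bool | ∀ i ∈ s, ω i = f i} = (s : Set I).pi fun i => {f i} := by
    ext ω; simp
  rw [this, bern, Measure.infinitePi_pi _ (by simp)]
  refine Finset.prod_congr rfl fun i _ => ?_
  rw [bernoulliMeasure_apply _ (by simp)]
  cases h : f i <;> simp [ENNReal.ofReal] <;> apply NNReal.eq <;>
    simp [Real.toNNReal_of_nonneg, (q i).2.1, (q i).2.2]

lemma bern_cyl_real (q : I → unitInterval) (s : Finset I) (f : I → Bool) :
    (bern q).real {ω | ∀ i ∈ s, ω i = f i} = ∏ i ∈ s, (if f i then (q i : ℝ) else 1 - q i) := by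
  rw [measureReal_def, bern_cyl, ENNReal.toReal_prod]
  refine Finset.prod_congr rfl fun i _ => ?_
  have h1 := (q i).2.1
  have h2 := (q i).2.2
  split_ifs <;> rw [ENNReal.toReal_ofReal] <;> linarith

lemma bern_unique (q : I → unitInterval) (Q : Measure (I → Bool)) [IsProbabilityMeasure Q]
    (h : ∀ (s : Finset I) (f : I → Bool), Q {ω | ∀ i ∈ s, ω i = f i} =
      ∏ i ∈ s, (if f i then ENNReal.ofReal (q i) else ENNReal.ofReal (1 - q i))) :
    Q = bern q := by
  classical
  unfold bern
  apply Measure.eq_infinitePi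
  intro s t ht
  rw [← Measure.infinitePi_pi (fun i => bernoulliMeasure true false (q i)) (fun i _ => ht i)]
  change _ = bern q _
  -- both sides are finite sums over cylinders
  have key : (s : Set I).pi t = ⋃ f ∈ (Finset.univ : Finset (s → Bool)).filter
      (fun f => ∀ i : s, f i ∈ t i),
      {ω : I → Bool | ∀ i ∈ s, ω i = (fun j => if h : j ∈ s then f ⟨j, h⟩ else false) i} := by
    ext ω
    simp only [Set.mem_pi, Finset.mem_coe, Finset.mem_filter, Finset.mem_univ, true_and,
      Set.mem_iUnion, Set.mem_ofPred_eq, exists_prop]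
    constructor
    · intro hω
      exact ⟨fun i => ω i, fun i => hω i i.2, fun i hi => by simp [hi]⟩
    · rintro ⟨f, hf, hω⟩ i hi
      rw [hω i hi]; simpa [hi] using hf ⟨i, hi⟩
  have hd : (((Finset.univ : Finset (s → Bool)).filter
      (fun f => ∀ i : s, f i ∈ t i) : Finset (s → Bool)) : Set (s → Bool)).PairwiseDisjoint
      (fun f => {ω : I → Bool | ∀ i ∈ s, ω i =
        (fun j => if h : j ∈ s then f ⟨j, h⟩ else false) i}) := by
    intro f _ g _ hfg
    rw [Function.onFun, Set.disjoint_left]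
    intro ω h1 h2
    apply hfg
    ext i
    have a := h1 i i.2
    have b := h2 i i.2
    simp only [i.2, dif_pos] at a b
    rw [← a, ← b]
  have hm : ∀ f : s → Bool, MeasurableSet {ω : I → Bool | ∀ i ∈ s, ω i =
        (fun j => if h : j ∈ s then f ⟨j, h⟩ else false) i} := by
    intro f
    apply Dep.measurableSet (S := (s : Set I)) _ s.finite_toSet
    intro ω ω' hω hE i hi
    rw [← hω i hi]; exact hE i hi
  rw [key, measure_biUnion_finset hd (fun f _ => hm f), measure_biUnion_finset hd (fun f _ => hm f)]
  refine Finset.sum_congr rfl fun f _ => ?_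
  rw [h, bern_cyl]

lemma Dep.congr_left {S : Set I} {E F : Set (I → Bool)} (h : Dep S E) (hEF : E = F) : Dep S F :=
  hEF ▸ h

/-- Conditioning on an exploration `X` whose outcome `o` is determined by the coordinates `S o`. -/
lemma bern_explore_eq (q : I → unitInterval) {α : Type*} {X : (I → Bool) → α}
    (hfin : (Set.range X).Finite) {S T : α → Set I}
    (hS : ∀ o ∈ Set.range X, (S o).Finite) (hT : ∀ o ∈ Set.range X, (T o).Finite)
    (hST : ∀ o ∈ Set.range X, Disjoint (S o) (T o))
    (hX : ∀ o ∈ Set.range X, Dep (S o) {ω | X ω = o})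
    {F : α → Set (I → Bool)} (hF : ∀ o ∈ Set.range X, Dep (T o) (F o)) (G : Set α) :
    (bern q).real ({ω | X ω ∈ G} ∩ {ω | ω ∈ F (X ω)}) =
      ∑ o ∈ (hfin.inter_of_left G).toFinset,
        (bern q).real {ω | X ω = o} * (bern q).real (F o) := by
  have key : {ω | X ω ∈ G} ∩ {ω | ω ∈ F (X ω)} =
      ⋃ o ∈ (hfin.inter_of_left G).toFinset, ({ω | X ω = o} ∩ F o) := by
    ext ω
    simp only [Set.mem_inter_iff, Set.mem_ofPred_eq, Set.Finite.mem_toFinset, Set.mem_iUnion,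
      Set.mem_range, exists_prop]
    constructor
    · rintro ⟨h1, h2⟩
      exact ⟨X ω, ⟨⟨ω, rfl⟩, h1⟩, rfl, h2⟩
    · rintro ⟨o, ⟨_, h1⟩, rfl, h2⟩
      exact ⟨h1, h2⟩
  rw [key, measureReal_biUnion_finset]
  · refine Finset.sum_congr rfl fun o ho => ?_
    have ho' : o ∈ Set.range X := ((Set.Finite.mem_toFinset _).1 ho).1
    exact bern_indep q (hS o ho') (hT o ho') (hST o ho') (hX o ho') (hF o ho')
  · intro o _ o' _ hoo
    rw [Function.onFun, Set.disjoint_left]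
    rintro ω ⟨h1, _⟩ ⟨h2, _⟩
    exact hoo (h1.symm.trans h2)
  · intro o ho
    have ho' : o ∈ Set.range X := ((Set.Finite.mem_toFinset _).1 ho).1
    exact ((hX o ho').measurableSet (hS o ho')).inter ((hF o ho').measurableSet (hT o ho'))

lemma bern_explore_sum (q : I → unitInterval) {α : Type*} {X : (I → Bool) → α}
    (hfin : (Set.range X).Finite) {S : α → Set I}
    (hS : ∀ o ∈ Set.range X, (S o).Finite)
    (hX : ∀ o ∈ Set.range X, Dep (S o) {ω | X ω = o}) (G : Set α) :
    (bern q).real {ω | X ω ∈ G} =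
      ∑ o ∈ (hfin.inter_of_left G).toFinset, (bern q).real {ω | X ω = o} := by
  have h := bern_explore_eq q hfin (S := S) (T := fun _ => ∅) hS (fun _ _ => Set.finite_empty)
    (fun _ _ => by simp) hX (F := fun _ => Set.univ) (fun _ _ => fun _ _ _ _ => trivial) G
  simpa using h

lemma bern_explore_ge (q : I → unitInterval) {α : Type*} {X : (I → Bool) → α}
    (hfin : (Set.range X).Finite) {S T : α → Set I}
    (hS : ∀ o ∈ Set.range X, (S o).Finite) (hT : ∀ o ∈ Set.range X, (T o).Finite)
    (hST : ∀ o ∈ Set.range X, Disjoint (S o) (T o))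
    (hX : ∀ o ∈ Set.range X, Dep (S o) {ω | X ω = o})
    {F : α → Set (I → Bool)} (hF : ∀ o ∈ Set.range X, Dep (T o) (F o)) (G : Set α)
    (a : ℝ) (ha : ∀ o ∈ Set.range X, o ∈ G → a ≤ (bern q).real (F o)) :
    a * (bern q).real {ω | X ω ∈ G} ≤
      (bern q).real ({ω | X ω ∈ G} ∩ {ω | ω ∈ F (X ω)}) := by
  rw [bern_explore_eq q hfin hS hT hST hX hF, bern_explore_sum q hfin hS hX, Finset.mul_sum]
  refine Finset.sum_le_sum fun o ho => ?_
  obtain ⟨h1, h2⟩ := (Set.Finite.mem_toFinset _).1 ho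
  rw [mul_comm]
  exact mul_le_mul_of_nonneg_left (ha o h1 h2) measureReal_nonneg

lemma bern_explore_le (q : I → unitInterval) {α : Type*} {X : (I → Bool) → α}
    (hfin : (Set.range X).Finite) {S T : α → Set I}
    (hS : ∀ o ∈ Set.range X, (S o).Finite) (hT : ∀ o ∈ Set.range X, (T o).Finite)
    (hST : ∀ o ∈ Set.range X, Disjoint (S o) (T o))
    (hX : ∀ o ∈ Set.range X, Dep (S o) {ω | X ω = o})
    {F : α → Set (I → Bool)} (hF : ∀ o ∈ Set.range X, Dep (T o) (F o)) (G : Set α)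
    (a : ℝ) (ha : ∀ o ∈ Set.range X, o ∈ G → (bern q).real (F o) ≤ a) :
    (bern q).real ({ω | X ω ∈ G} ∩ {ω | ω ∈ F (X ω)}) ≤
      a * (bern q).real {ω | X ω ∈ G} := by
  rw [bern_explore_eq q hfin hS hT hST hX hF, bern_explore_sum q hfin hS hX, Finset.mul_sum]
  refine Finset.sum_le_sum fun o ho => ?_
  obtain ⟨h1, h2⟩ := (Set.Finite.mem_toFinset _).1 ho
  rw [mul_comm a]
  exact mul_le_mul_of_nonneg_left (ha o h1 h2) measureReal_nonneg

/-- The event `E` is increasing. -/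
def Inc (E : Set (I → Bool)) : Prop := ∀ ω ω' : I → Bool, (∀ i, ω i = true → ω' i = true) →
  ω ∈ E → ω' ∈ E

open Classical in
lemma bern_real_eq_sum (q : I → unitInterval) (S : Finset I) {E : Set (I → Bool)}
    (hE : Dep (S : Set I) E) : (bern q).real E =
      ∑ x : S → Bool, (∏ i : S, (if x i then (q i : ℝ) else 1 - q i)) *
        (if (fun j => if h : j ∈ S then x ⟨j, h⟩ else false) ∈ E then 1 else 0) := by
  have hX : ∀ x : S → Bool, Dep (S : Set I) {ω : I → Bool | (fun i : S => ω i) = x} := by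
    intro x ω ω' hω h
    ext i
    rw [← hω i i.2]; exact congrFun h i
  have h := bern_explore_sum q (X := fun (ω : I → Bool) (i : S) => ω i) (Set.toFinite _)
    (S := fun _ => (S : Set I)) (fun _ _ => S.finite_toSet) (fun o _ => hX o)
    {x | (fun j => if h : j ∈ S then x ⟨j, h⟩ else false) ∈ E}
  have e : {ω : I → Bool | (fun i : S => ω i) ∈
      {x : S → Bool | (fun j => if h : j ∈ S then x ⟨j, h⟩ else false) ∈ E}} = E := by
    ext ω
    refine hE.iff fun i hi => ?_
    have : i ∈ S := hi
    simp [this]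
  rw [e] at h
  have r : Set.range (fun (ω : I → Bool) (i : S) => ω i) = Set.univ := by
    rw [Set.range_eq_univ]
    intro x
    refine ⟨fun j => if h : j ∈ S then x ⟨j, h⟩ else false, ?_⟩
    ext i; simp
  rw [h]
  simp only [mul_ite, mul_one, mul_zero, ← Finset.sum_filter]
  refine Finset.sum_congr ?_ fun x _ => ?_
  · ext x
    simp [-Set.mem_range, r]
  · have e2 : {ω : I → Bool | (fun i : S => ω i) = x} =
        {ω | ∀ i ∈ S, ω i = (fun j => if h : j ∈ S then x ⟨j, h⟩ else false) i} := by
      ext ω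
      simp only [Set.mem_ofPred_eq, funext_iff]
      constructor
      · intro h i hi; simpa [hi] using h ⟨i, hi⟩
      · intro h i; simpa using h i i.2
    rw [e2, bern_cyl_real, ← Finset.prod_coe_sort]
    refine Finset.prod_congr rfl fun i _ => ?_
    simp

lemma ite_mul_ite_le {P R T : Prop} {_ : Decidable P} {_ : Decidable R} {_ : Decidable T}
    (h : P → R → T) :
    (if P then (1 : ℝ) else 0) * (if R then 1 else 0) ≤ if T then 1 else 0 := by
  split_ifs with h1 h2 h3
  · norm_num
  · exact absurd (h h1 h2) h3
  all_goals norm_num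

lemma harris (q : I → unitInterval) {S : Set I} (hS : S.Finite) {E F : Set (I → Bool)}
    (hE : Dep S E) (hF : Dep S F) (hE' : Inc E) (hF' : Inc F) :
    (bern q).real E * (bern q).real F ≤ (bern q).real (E ∩ F) := by
  classical
  obtain ⟨S, rfl⟩ : ∃ S' : Finset I, S = S' := ⟨hS.toFinset, by simp⟩
  have hmono : ∀ {E : Set (I → Bool)}, Inc E → Monotone fun x : S → Bool =>
      (if (fun j => if h : j ∈ S then x ⟨j, h⟩ else false) ∈ E then (1 : ℝ) else 0) := by
    intro E hE x y hxy
    have : (fun j => if h : j ∈ S then x ⟨j, h⟩ else false) ∈ E →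
        (fun j => if h : j ∈ S then y ⟨j, h⟩ else false) ∈ E := by
      refine hE _ _ fun j hj => ?_
      by_cases h : j ∈ S
      · simp only [h, dif_pos] at hj ⊢
        exact hxy ⟨j, h⟩ hj
      · simp [h] at hj
    dsimp only
    split_ifs with h1 h2
    · exact le_rfl
    · exact absurd (this h1) h2
    · norm_num
    · norm_num
  have hw : ∀ (i : I) (b : Bool), 0 ≤ (if b then (q i : ℝ) else 1 - q i) := by
    intro i b
    have h1 := (q i).2.1
    have h2 := (q i).2.2
    split_ifs <;> linarith
  have := fkg (α := S → Bool)
    (fun x => if (fun j => if h : j ∈ S then x ⟨j, h⟩ else false) ∈ E then (1 : ℝ) else 0)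
    (fun x => if (fun j => if h : j ∈ S then x ⟨j, h⟩ else false) ∈ F then (1 : ℝ) else 0)
    (fun x => ∏ i : S, (if x i then (q i : ℝ) else 1 - q i))
    (fun x => Finset.prod_nonneg fun i _ => hw i _)
    (fun x => by dsimp; split_ifs <;> norm_num) (fun x => by dsimp; split_ifs <;> norm_num)
    (hmono hE') (hmono hF')
    (fun a b => by
      rw [← Finset.prod_mul_distrib, ← Finset.prod_mul_distrib]
      refine (Finset.prod_congr rfl fun i _ => ?_).le
      have hb : ∀ (r : ℝ) (x y : Bool), ((if x then r else 1 - r) * if y then r else 1 - r) =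
          (if x ⊓ y then r else 1 - r) * if x ⊔ y then r else 1 - r := by
        intro r x y
        cases x <;> cases y <;> simp [mul_comm]
      exact hb _ _ _)
  have h1 := bern_real_eq_sum q S (E := Set.univ) (fun _ _ _ _ => trivial)
  simp only [Set.mem_univ, if_true, mul_one, probReal_univ] at h1
  rw [← h1, one_mul] at this
  rw [bern_real_eq_sum q S hE, bern_real_eq_sum q S hF, bern_real_eq_sum q S (hE.inter hF)]
  refine this.trans (Finset.sum_le_sum fun x _ => ?_)
  refine mul_le_mul_of_nonneg_left ?_ (Finset.prod_nonneg fun i _ => hw i _)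
  exact ite_mul_ite_le fun h1 h2 => ⟨h1, h2⟩

lemma Inc.inter {E F : Set (I → Bool)} (hE : Inc E) (hF : Inc F) : Inc (E ∩ F) :=
  fun ω ω' h hω => ⟨hE ω ω' h hω.1, hF ω ω' h hω.2⟩

/-- Harris' inequality for decreasing events. -/
lemma harris_prod_compl (q : I → unitInterval) {S : Set I} (hS : S.Finite) {κ : Type*}
    (K : Finset κ) {E : κ → Set (I → Bool)} (hE : ∀ k ∈ K, Dep S (E k))
    (hE' : ∀ k ∈ K, Inc (E k)) :
    ∏ k ∈ K, (bern q).real (E k)ᶜ ≤ (bern q).real (⋂ k ∈ K, (E k)ᶜ) := by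
  classical
  induction K using Finset.induction_on with
  | empty => simp
  | insert a K ha ih =>
    have ih := ih (fun k hk => hE k (Finset.mem_insert_of_mem hk))
      (fun k hk => hE' k (Finset.mem_insert_of_mem hk))
    have ha1 := hE a (Finset.mem_insert_self _ _)
    have ha2 := hE' a (Finset.mem_insert_self _ _)
    rw [Finset.prod_insert ha, Finset.set_biInter_insert]
    refine (mul_le_mul_of_nonneg_left ih measureReal_nonneg).trans ?_
    -- `F` is the (increasing) union of the other events
    set F : Set (I → Bool) := ⋃ k ∈ K, E k with hFdef
    have hFc : (⋂ k ∈ K, (E k)ᶜ) = Fᶜ := by simp [hFdef]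
    have hF : Dep S F := by
      intro ω ω' h hω
      simp only [hFdef, Set.mem_iUnion] at hω ⊢
      obtain ⟨k, hk, hω⟩ := hω
      exact ⟨k, hk, hE k (Finset.mem_insert_of_mem hk) ω ω' h hω⟩
    have hF' : Inc F := by
      intro ω ω' h hω
      simp only [hFdef, Set.mem_iUnion] at hω ⊢
      obtain ⟨k, hk, hω⟩ := hω
      exact ⟨k, hk, hE' k (Finset.mem_insert_of_mem hk) ω ω' h hω⟩
    rw [hFc]
    have m1 := ha1.measurableSet hS
    have m2 := hF.measurableSet hS
    have := harris q hS ha1 hF ha2 hF'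
    clear_value F
    have hu := measureReal_union_add_inter (μ := bern q) (s := E a) m2
    rw [← Set.compl_union, probReal_compl_eq_one_sub m1, probReal_compl_eq_one_sub m2,
      probReal_compl_eq_one_sub (m1.union m2)]
    nlinarith

end Bernoulli

section Lattice
variable {d : ℕ}

lemma latAdj_comm {x y : Zd d} : latAdj x y ↔ latAdj y x := by
  unfold latAdj
  simp only [abs_sub_comm]

lemma latAdj.symm {x y : Zd d} (h : latAdj x y) : latAdj y x := latAdj_comm.1 h

lemma latAdj_of {x y : Zd d} (i : Fin d) (hi : |x i - y i| = 1) (h : ∀ j, j ≠ i → x j = y j) :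
    latAdj x y := by
  unfold latAdj
  rw [Finset.sum_eq_single i, hi]
  · intro j _ hj; simp [h j hj]
  · simp

lemma latAdj.exists {x y : Zd d} (h : latAdj x y) :
    ∃ i, |x i - y i| = 1 ∧ ∀ j, j ≠ i → x j = y j := by
  unfold latAdj at h
  have hne : ∃ i, x i ≠ y i := by
    by_contra hc
    push Not at hc
    simp [hc] at h
  obtain ⟨i, hi⟩ := hne
  have h0 : 1 ≤ |x i - y i| := Int.one_le_abs (sub_ne_zero.2 hi)
  rw [← Finset.add_sum_erase _ _ (Finset.mem_univ i)] at h
  have h1 : 0 ≤ ∑ j ∈ Finset.univ.erase i, |x j - y j| :=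
    Finset.sum_nonneg fun _ _ => abs_nonneg _
  have h2 : ∑ j ∈ Finset.univ.erase i, |x j - y j| = 0 := by omega
  refine ⟨i, by omega, fun j hj => ?_⟩
  have := (Finset.sum_eq_zero_iff_of_nonneg fun j _ => abs_nonneg _).1 h2 j (by simp [hj])
  have := abs_eq_zero.1 this
  omega

lemma latAdj_iff {x y : Zd d} :
    latAdj x y ↔ ∃ i, ∃ σ : ℤ, (σ = 1 ∨ σ = -1) ∧ y = Function.update x i (x i + σ) := by
  constructor
  · intro h
    obtain ⟨i, hi, hj⟩ := h.exists
    refine ⟨i, y i - x i, ?_, ?_⟩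
    · rcases abs_eq (by norm_num : (0:ℤ) ≤ 1) |>.1 hi with h | h <;> omega
    · ext j
      by_cases h : j = i
      · subst h; simp
      · simp [h, hj j h]
  · rintro ⟨i, σ, hσ, rfl⟩
    refine latAdj_of i ?_ fun j hj => by simp [hj]
    rcases hσ with rfl | rfl <;> simp

lemma latAdj.abs_le {x y : Zd d} (h : latAdj x y) (i : Fin d) : |x i - y i| ≤ 1 := by
  obtain ⟨j, h1, h2⟩ := h.exists
  by_cases hij : i = j
  · subst hij; omega
  · simp [h2 i hij]

lemma latAdj.bound {x y : Zd d} (h : latAdj x y) (i : Fin d) :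
    x i ≤ y i + 1 ∧ y i ≤ x i + 1 := by
  have := _root_.abs_le.1 (h.abs_le i)
  omega

lemma latAdj_add {x y b : Zd d} : latAdj (x + b) (y + b) ↔ latAdj x y := by
  simp [latAdj]

/-- The pairs contained in `S`. -/
def edgesIn (S : Set (Zd d)) : Set (Sym2 (Zd d)) := {e | ∀ x ∈ e, x ∈ S}

@[simp] lemma mk_mem_edgesIn {S : Set (Zd d)} {a b : Zd d} :
    s(a, b) ∈ edgesIn S ↔ a ∈ S ∧ b ∈ S := by
  simp [edgesIn]

lemma edgesIn_mono {S T : Set (Zd d)} (h : S ⊆ T) : edgesIn S ⊆ edgesIn T :=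
  fun _ he x hx => h (he x hx)

lemma edgesIn_finite {S : Set (Zd d)} (hS : S.Finite) : (edgesIn S).Finite := by
  refine ((hS.prod hS).image (fun p : Zd d × Zd d => s(p.1, p.2))).subset ?_
  intro e he
  induction e using Sym2.ind with
  | _ a b =>
    rw [mk_mem_edgesIn] at he
    exact ⟨(a, b), he, rfl⟩

lemma edgesIn_disjoint {S T : Set (Zd d)} (h : Disjoint S T) :
    Disjoint (edgesIn S) (edgesIn T) := by
  rw [Set.disjoint_left] at h ⊢
  intro e he he'
  induction e using Sym2.ind with
  | _ a b => exact h (mk_mem_edgesIn.1 he).1 (mk_mem_edgesIn.1 he').1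

/-- Connection through lattice edges belonging to `O`. -/
def con (O : Set (Sym2 (Zd d))) : Zd d → Zd d → Prop :=
  Relation.ReflTransGen fun a b => latAdj a b ∧ s(a, b) ∈ O

lemma con.refl {O : Set (Sym2 (Zd d))} {x : Zd d} : con O x x := Relation.ReflTransGen.refl

lemma con.trans {O : Set (Sym2 (Zd d))} {x y z : Zd d} (h : con O x y) (h' : con O y z) :
    con O x z := Relation.ReflTransGen.trans h h'

lemma con.symm {O : Set (Sym2 (Zd d))} {x y : Zd d} (h : con O x y) : con O y x := by
  induction h with
  | refl => exact .refl
  | tail _ h ih => exact .trans (.single ⟨h.1.symm, by rw [Sym2.eq_swap]; exact h.2⟩) ih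

lemma con.mono {O O' : Set (Sym2 (Zd d))} (hO : O ⊆ O') {x y : Zd d} (h : con O x y) :
    con O' x y := by
  induction h with
  | refl => exact .refl
  | tail _ h ih => exact .tail ih ⟨h.1, hO h.2⟩

lemma con.tail {O : Set (Sym2 (Zd d))} {x y z : Zd d} (h0 : con O x y) (h : latAdj y z)
    (h' : s(y, z) ∈ O) : con O x z := Relation.ReflTransGen.tail h0 ⟨h, h'⟩

lemma con.head {O : Set (Sym2 (Zd d))} {x y z : Zd d} (h : latAdj x y) (h' : s(x, y) ∈ O)
    (h0 : con O y z) : con O x z := Relation.ReflTransGen.head ⟨h, h'⟩ h0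

lemma con.closed {O : Set (Sym2 (Zd d))} {S : Set (Zd d)}
    (hS : ∀ a b, latAdj a b → s(a, b) ∈ O → a ∈ S → b ∈ S)
    {x y : Zd d} (h : con O x y) (hx : x ∈ S) : y ∈ S := by
  induction h with
  | refl => exact hx
  | tail _ h ih => exact hS _ _ h.1 h.2 ih

lemma con.mem {O : Set (Sym2 (Zd d))} {S : Set (Zd d)} (hO : O ⊆ edgesIn S) {x y : Zd d}
    (h : con O x y) (hx : x ∈ S) : y ∈ S :=
  h.closed (fun _ _ _ h' _ => (mk_mem_edgesIn.1 (hO h')).2) hx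

/-- Every vertex of a path that starts in a vertex set closed under its steps stays there. -/
lemma con.restrict {O : Set (Sym2 (Zd d))} {S : Set (Zd d)}
    (hS : ∀ a b, latAdj a b → s(a, b) ∈ O → a ∈ S → b ∈ S)
    {x y : Zd d} (h : con O x y) (hx : x ∈ S) : con (O ∩ edgesIn S) x y := by
  induction h with
  | refl => exact .refl
  | tail h0 h ih =>
    have := con.closed hS h0 hx
    exact ih.tail h.1 ⟨h.2, mk_mem_edgesIn.2 ⟨this, hS _ _ h.1 h.2 this⟩⟩

lemma con.last_exit {O : Set (Sym2 (Zd d))} {R : Set (Zd d)} {x y : Zd d} (h : con O x y)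
    (hx : x ∈ R) (hy : y ∉ R) :
    ∃ u ∈ R, ∃ v, v ∉ R ∧ latAdj u v ∧ s(u, v) ∈ O ∧ con O x u ∧ con (O ∩ edgesIn Rᶜ) v y := by
  have key : (x ∉ R ∧ con (O ∩ edgesIn Rᶜ) x y) ∨ ∃ u ∈ R, ∃ v, v ∉ R ∧ latAdj u v ∧
      s(u, v) ∈ O ∧ con O x u ∧ con (O ∩ edgesIn Rᶜ) v y := by
    clear hx
    induction h using Relation.ReflTransGen.head_induction_on with
    | refl => exact .inl ⟨hy, .refl⟩
    | head h _ ih =>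
      rename_i a c _
      rcases ih with ⟨hc, ih⟩ | ⟨u, hu, v, hv, h1, h2, h3, h4⟩
      · by_cases ha : a ∈ R
        · exact .inr ⟨a, ha, c, hc, h.1, h.2, .refl, ih⟩
        · exact .inl ⟨ha, .head h.1 ⟨h.2, mk_mem_edgesIn.2 ⟨ha, hc⟩⟩ ih⟩
      · exact .inr ⟨u, hu, v, hv, h1, h2, .head h.1 h.2 h3, h4⟩
  exact key.resolve_left fun h => h.1 hx

lemma con.first_exit {O : Set (Sym2 (Zd d))} {R : Set (Zd d)} {x y : Zd d} (h : con O x y)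
    (hx : x ∈ R) (hy : y ∉ R) :
    ∃ u ∈ R, ∃ v, v ∉ R ∧ latAdj u v ∧ s(u, v) ∈ O ∧ con (O ∩ edgesIn R) x u ∧ con O v y := by
  obtain ⟨v, hv, u, hu, h1, h2, h3, h4⟩ := h.symm.last_exit (R := Rᶜ) hy (by simpa using hx)
  refine ⟨u, by simpa using hu, v, hv, h1.symm, by rwa [Sym2.eq_swap], ?_, h3.symm⟩
  simpa using h4.symm

/-- The box of radius `r` around `b`. -/
def bx (b : Zd d) (r : ℤ) : Set (Zd d) := {x | ∀ i, b i - r ≤ x i ∧ x i ≤ b i + r}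

lemma mem_bx {b x : Zd d} {r : ℤ} : x ∈ bx b r ↔ ∀ i, b i - r ≤ x i ∧ x i ≤ b i + r := Iff.rfl

lemma bx_eq_Icc (b : Zd d) (r : ℤ) : bx b r = Set.Icc (fun i => b i - r) (fun i => b i + r) := by
  ext x
  simp only [mem_bx, Set.mem_Icc, Pi.le_def]
  exact ⟨fun h => ⟨fun i => (h i).1, fun i => (h i).2⟩, fun h i => ⟨h.1 i, h.2 i⟩⟩

lemma bx_finite (b : Zd d) (r : ℤ) : (bx b r).Finite := by
  rw [bx_eq_Icc]; exact Set.finite_Icc _ _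

lemma bx_mono (b : Zd d) {r s : ℤ} (h : r ≤ s) : bx b r ⊆ bx b s := by
  intro x hx i
  have := hx i
  omega

lemma bx_subset {b b' : Zd d} {r s : ℤ} (h : ∀ i, b' i - s ≤ b i - r ∧ b i + r ≤ b' i + s) :
    bx b r ⊆ bx b' s := by
  intro x hx i
  have := hx i
  have := h i
  omega

lemma self_mem_bx (b : Zd d) {r : ℤ} (h : 0 ≤ r) : b ∈ bx b r := fun i => by omega

/-- The sphere of radius `r` around `b`. -/
def sph (b : Zd d) (r : ℤ) : Set (Zd d) := {x | x ∈ bx b r ∧ ∃ i, x i = b i + r ∨ x i = b i - r}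

lemma sph_subset (b : Zd d) (r : ℤ) : sph b r ⊆ bx b r := fun _ h => h.1

lemma exit_mem_sph {b u v : Zd d} {r : ℤ} (hu : u ∈ bx b r) (hv : v ∉ bx b r)
    (h : latAdj u v) : u ∈ sph b r ∧ v ∈ sph b (r + 1) := by
  have hv' : ∃ i, ¬ (b i - r ≤ v i ∧ v i ≤ b i + r) := by
    by_contra hc; push Not at hc; exact hv hc
  obtain ⟨i, hi⟩ := hv'
  have h1 := h.bound i
  have h2 := hu i
  refine ⟨⟨hu, i, by omega⟩, ⟨fun j => ?_, i, by omega⟩⟩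
  have := h.bound j
  have := hu j
  omega

lemma con.hits_sph {O : Set (Sym2 (Zd d))} {b x y : Zd d} {r : ℤ} (h : con O x y)
    (hx : x ∈ bx b r) (hy : y ∉ bx b r) :
    ∃ u ∈ sph b r, con (O ∩ edgesIn (bx b r)) x u := by
  obtain ⟨u, hu, v, hv, h1, _, h3, _⟩ := h.first_exit hx hy
  exact ⟨u, (exit_mem_sph hu hv h1).1, h3⟩

lemma con.hits_sph_of_mem {O : Set (Sym2 (Zd d))} {b x y : Zd d} {r s : ℤ} (h : con O x y)
    (hx : x ∈ bx b r) (hy : y ∈ sph b s) (hrs : r ≤ s) :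
    ∃ u ∈ sph b r, con (O ∩ edgesIn (bx b r)) x u := by
  by_cases hyr : y ∈ bx b r
  · obtain ⟨hy1, i, hi⟩ := hy
    have := hyr i
    by_cases hc : ∃ z, con O x z ∧ z ∉ bx b r
    · obtain ⟨z, hz, hz'⟩ := hc
      exact hz.hits_sph hx hz'
    · push Not at hc
      refine ⟨y, ⟨hyr, i, by omega⟩, ?_⟩
      have h' : con (O ∩ edgesIn {z | con O x z}) x y :=
        h.restrict (S := {z | con O x z})
          (fun a c hac hO (ha : con O x a) => con.tail ha hac hO) con.refl
      exact h'.mono (Set.inter_subset_inter_right _ (edgesIn_mono fun z hz => hc z hz))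
  · exact h.hits_sph hx hyr

/-- Connectedness of a box through the edges inside it. -/
lemma bx_con {b x : Zd d} {r : ℤ} {O : Set (Sym2 (Zd d))} (hO : ∀ u v, latAdj u v → u ∈ bx b r →
    v ∈ bx b r → s(u, v) ∈ O) (hx : x ∈ bx b r) : con O b x := by
  classical
  have key : ∀ n : ℕ, ∀ x ∈ bx b r, (∑ i, (x i - b i).natAbs) = n → con O b x := by
    intro n
    induction n with
    | zero =>
      intro x _ h
      have : x = b := by
        ext i
        have := (Finset.sum_eq_zero_iff).1 h i (Finset.mem_univ i)
        omega
      rw [this]; exact .refl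
    | succ n ih =>
      intro x hx h
      have : ∃ i, (x i - b i) ≠ 0 := by
        by_contra hc
        push Not at hc
        simp [hc] at h
      obtain ⟨i, hi⟩ := this
      set y := Function.update x i (x i - (x i - b i).sign) with hy
      have hsg : ((x i - b i).sign = 1 ∧ 0 < x i - b i) ∨
          ((x i - b i).sign = -1 ∧ x i - b i < 0) := by
        rcases lt_or_gt_of_ne hi with h | h
        · exact .inr ⟨Int.sign_eq_neg_one_of_neg h, h⟩
        · exact .inl ⟨Int.sign_eq_one_of_pos h, h⟩
      have hyx : latAdj y x := by
        refine latAdj_of i ?_ fun j hj => by simp [hy, hj]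
        simp only [hy, Function.update_self]
        rcases hsg with h | h <;> rw [h.1] <;> simp
      have hyb : y ∈ bx b r := by
        intro j
        by_cases hj : j = i
        · subst hj
          have := hx j
          simp only [hy, Function.update_self]
          rcases hsg with h | h <;> rw [h.1] <;> omega
        · simpa [hy, hj] using hx j
      refine (ih y hyb ?_).tail hyx (hO _ _ hyx hyb hx)
      rw [← Finset.add_sum_erase _ _ (Finset.mem_univ i)] at h ⊢
      have e : ∑ j ∈ Finset.univ.erase i, (y j - b j).natAbs =
          ∑ j ∈ Finset.univ.erase i, (x j - b j).natAbs := by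
        refine Finset.sum_congr rfl fun j hj => ?_
        rw [hy, Function.update_of_ne (Finset.ne_of_mem_erase hj)]
      rw [e]
      have : (y i - b i).natAbs + 1 = (x i - b i).natAbs := by
        simp only [hy, Function.update_self]
        rcases hsg with h | h <;> rw [h.1] <;> omega
      omega
  exact key _ x hx rfl

end Lattice

section Hits
variable {d : ℕ}

/-- The set of open edges. -/
def op (ω : Config d) : Set (Sym2 (Zd d)) := {e | ω e = true}

lemma op_inter_congr {ω ω' : Config d} {S : Set (Sym2 (Zd d))} (h : ∀ e ∈ S, ω e = ω' e) :
    op ω ∩ S = op ω' ∩ S := by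
  ext e
  simp only [Set.mem_inter_iff, op, Set.mem_ofPred_eq]
  constructor <;> rintro ⟨h1, h2⟩ <;> refine ⟨?_, h2⟩
  · rw [← h e h2]; exact h1
  · rw [h e h2]; exact h1

lemma dep_op (S : Set (Sym2 (Zd d))) (P : Set (Sym2 (Zd d)) → Prop) :
    Dep S {ω : Config d | P (op ω ∩ S)} := by
  intro ω ω' h hω
  simp only [Set.mem_ofPred_eq] at hω ⊢
  rwa [← op_inter_congr h]

lemma con_iff_exists_bx {O : Set (Sym2 (Zd d))} {x y : Zd d} :
    con O x y ↔ ∃ k : ℕ, con (O ∩ edgesIn (bx 0 k)) x y := by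
  constructor
  · intro h
    induction h with
    | refl => exact ⟨0, .refl⟩
    | tail _ h ih =>
      rename_i b c _
      obtain ⟨k, hk⟩ := ih
      have hb : ∀ z : Zd d, ∃ j : ℕ, z ∈ bx 0 j := by
        intro z
        refine ⟨∑ i, (z i).natAbs, fun i => ?_⟩
        have := Finset.single_le_sum (f := fun i => (z i).natAbs) (fun _ _ => Nat.zero_le _)
          (Finset.mem_univ i)
        simp only [Pi.zero_apply] at *
        omega
      obtain ⟨j1, h1⟩ := hb b
      obtain ⟨j2, h2⟩ := hb c
      refine ⟨k + j1 + j2, (hk.mono ?_).tail h.1 ⟨h.2, mk_mem_edgesIn.2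
        ⟨bx_mono _ (by push_cast; omega) h1, bx_mono _ (by push_cast; omega) h2⟩⟩⟩
      exact Set.inter_subset_inter_right _ (edgesIn_mono (bx_mono _ (by push_cast; omega)))
  · rintro ⟨k, h⟩
    exact h.mono Set.inter_subset_left

lemma measurableSet_con (x y : Zd d) : MeasurableSet {ω : Config d | con (op ω) x y} := by
  have : {ω : Config d | con (op ω) x y} =
      ⋃ k : ℕ, {ω | con (op ω ∩ edgesIn (bx 0 k)) x y} := by
    ext ω
    simp only [Set.mem_ofPred_eq, Set.mem_iUnion]
    exact con_iff_exists_bx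
  rw [this]
  exact MeasurableSet.iUnion fun k =>
    (dep_op (edgesIn (bx 0 k)) fun O => con O x y).measurableSet (edgesIn_finite (bx_finite _ _))

lemma infinite_iff_bx {S : Set (Zd d)} : S.Infinite ↔ ∀ n : ℕ, ∃ y ∈ S, y ∉ bx 0 n := by
  constructor
  · intro h n
    exact (h.exists_notMem_finite (bx_finite 0 n))
  · intro h hfin
    have hb : ∃ n : ℕ, ∀ z ∈ S, z ∈ bx 0 n := by
      refine ⟨∑ z ∈ hfin.toFinset, ∑ i, (z i).natAbs, fun z hz i => ?_⟩
      have h1 := Finset.single_le_sum (f := fun i => (z i).natAbs) (fun _ _ => Nat.zero_le _)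
        (Finset.mem_univ i)
      have h2 := Finset.single_le_sum (f := fun z : Zd d => ∑ i, (z i).natAbs)
        (fun _ _ => Nat.zero_le _) (hfin.mem_toFinset.2 hz)
      simp only [Pi.zero_apply] at *
      omega
    obtain ⟨n, hn⟩ := hb
    obtain ⟨y, hy, hy'⟩ := h n
    exact hy' (hn y hy)

lemma measurableSet_infinite (x : Zd d) :
    MeasurableSet {ω : Config d | {y | con (op ω) x y}.Infinite} := by
  have : {ω : Config d | {y | con (op ω) x y}.Infinite} =
      ⋂ n : ℕ, ⋃ y ∈ (bx (0 : Zd d) n)ᶜ, {ω | con (op ω) x y} := by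
    ext ω
    simp only [Set.mem_ofPred_eq, Set.mem_iInter, Set.mem_iUnion, infinite_iff_bx]
    refine forall_congr' fun n => exists_congr fun y => ?_
    simp [and_comm]
  rw [this]
  exact MeasurableSet.iInter fun n => MeasurableSet.biUnion (Set.to_countable _)
    fun y _ => measurableSet_con x y

lemma infinite_of_agree {ω ω' : Config d} {F : Set (Sym2 (Zd d))} (hF : F.Finite)
    (h : ∀ e, e ∉ F → ω e = ω' e) (hx : ∃ x, {y | con (op ω) x y}.Infinite) :
    ∃ x, {y | con (op ω') x y}.Infinite := by
  obtain ⟨x, hx⟩ := hx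
  by_contra hc
  push Not at hc
  have hV : {v : Zd d | ∃ e ∈ F, v ∈ e}.Finite := by
    have : {v : Zd d | ∃ e ∈ F, v ∈ e} = ⋃ e ∈ F, {v | v ∈ e} := by ext; simp
    rw [this]
    refine hF.biUnion fun e _ => ?_
    induction e using Sym2.ind with
    | _ a b =>
      refine (Set.toFinite {a, b}).subset fun v hv => ?_
      simpa using hv
  refine hx (((hc x).union (hV.biUnion fun v _ => hc v)).subset ?_)
  intro y hy
  change con (op ω) x y at hy
  induction hy with
  | refl => exact .inl .refl
  | tail _ hstep ih =>
    rename_i b c _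
    by_cases he : s(b, c) ∈ F
    · exact .inr (Set.mem_biUnion (show c ∈ {v : Zd d | ∃ e ∈ F, v ∈ e} from
        ⟨_, he, by simp⟩) con.refl)
    · have he' : s(b, c) ∈ op ω' := by
        have := hstep.2
        simp only [op, Set.mem_ofPred_eq] at this ⊢
        rwa [← h _ he]
      rcases ih with ih | ih
      · exact .inl (con.tail ih hstep.1 he')
      · simp only [Set.mem_iUnion, exists_prop] at ih
        obtain ⟨v, hv, ih⟩ := ih
        exact .inr (Set.mem_biUnion hv (con.tail ih hstep.1 he'))

lemma zero_one_infinite (q : Sym2 (Zd d) → unitInterval) :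
    bern q {ω | ∃ x, {y | con (op ω) x y}.Infinite} = 0 ∨
      bern q {ω | ∃ x, {y | con (op ω) x y}.Infinite} = 1 := by
  classical
  set E : Set (Config d) := {ω | ∃ x, {y | con (op ω) x y}.Infinite} with hE
  have hind := (iIndepFun_infinitePi (P := fun i => bernoulliMeasure true false (q i))
    (X := fun _ b => b) (fun _ => measurable_id)).iIndep
  refine measure_zero_or_one_of_measurableSet_limsup (f := Filter.cofinite)
    (p := fun t : Set (Sym2 (Zd d)) => t.Finite) (ns := fun t : Finset (Sym2 (Zd d)) => t)
    (fun n => ?_) hind (fun t ht => by simpa using ht) ?_ (fun t => t.finite_toSet)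
    (fun n => ⟨{n}, by simp⟩) ?_
  · exact (measurable_pi_apply n).comap_le
  · intro s t
    exact ⟨s ∪ t, by simp, by simp⟩
  · rw [Filter.limsup_eq_iInf_iSup, MeasurableSpace.measurableSet_iInf]
    intro t
    rw [MeasurableSpace.measurableSet_iInf]
    intro ht
    let g : Config d → Config d := fun ω e => if e ∈ t then ω e else false
    have hgE : E = g ⁻¹' E := by
      ext ω
      simp only [hE, Set.mem_ofPred_eq, Set.mem_preimage]
      have hag : ∀ e, e ∉ tᶜ → ω e = g ω e := by
        intro e he
        have : e ∈ t := by simpa using he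
        simp [g, this]
      exact ⟨infinite_of_agree ht hag, infinite_of_agree ht fun e he => (hag e he).symm⟩
    have hEm : MeasurableSet E := by
      have : E = ⋃ x, {ω : Config d | {y | con (op ω) x y}.Infinite} := by
        ext ω; simp [hE]
      rw [this]
      exact MeasurableSet.iUnion fun x => measurableSet_infinite x
    rw [hgE]
    refine measurableSet_preimage (m := _) ?_ hEm
    refine @measurable_pi_lambda _ _ _ (_) _ _ fun e => ?_
    by_cases he : e ∈ t
    · simp only [g, he, if_true]
      refine Measurable.mono (comap_measurable fun ω : Config d => ω e) ?_ le_rfl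
      exact le_iSup₂_of_le e he le_rfl
    · simp only [g, he, if_false]
      exact @measurable_const _ _ _ (_) _

/-- The vertices of the sphere of radius `n` reached from `bx 0 m` inside `bx 0 n`. -/
def hit (O : Set (Sym2 (Zd d))) (m n : ℤ) : Set (Zd d) :=
  {x | x ∈ sph 0 n ∧ ∃ u ∈ bx 0 m, con (O ∩ edgesIn (bx 0 n)) u x}

lemma exists_hit_nonempty (q : Sym2 (Zd d) → unitInterval)
    (h : bern q {ω | (cluster ω).Infinite} ≠ 0) {η : ℝ} (hη : 0 < η) :
    ∃ m : ℕ, ∀ n : ℕ, m ≤ n → 1 - η ≤ (bern q).real {ω | (hit (op ω) m n).Nonempty} := by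
  have h1 : bern q {ω | ∃ x, {y | con (op ω) x y}.Infinite} = 1 := by
    refine (zero_one_infinite q).resolve_left fun h0 => h ?_
    exact measure_mono_null (fun ω (hω : (cluster ω).Infinite) => Exists.intro 0 hω) h0
  let E : ℕ → Set (Config d) := fun m => {ω | ∃ x ∈ bx 0 m, {y | con (op ω) x y}.Infinite}
  have hE : (⋃ m, E m) = {ω | ∃ x, {y | con (op ω) x y}.Infinite} := by
    ext ω
    simp only [E, Set.mem_iUnion, Set.mem_ofPred_eq]
    constructor
    · rintro ⟨_, x, _, hx⟩; exact ⟨x, hx⟩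
    · rintro ⟨x, hx⟩
      by_contra hc
      push Not at hc
      have : ({x} : Set (Zd d)).Infinite := infinite_iff_bx.2 fun n => ⟨x, rfl, fun hn =>
        hx (hc n x hn)⟩
      exact this (Set.finite_singleton x)
  have hmono : Monotone E := by
    intro m m' hm ω
    rintro ⟨x, hx, hx'⟩
    exact ⟨x, bx_mono _ (by exact_mod_cast hm) hx, hx'⟩
  have ht := tendsto_measure_iUnion_atTop (μ := bern q) hmono
  rw [hE, h1] at ht
  have ht' : Filter.Tendsto (fun m => (bern q).real (E m)) Filter.atTop (nhds 1) :=
    (ENNReal.tendsto_toReal ENNReal.one_ne_top).comp ht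
  obtain ⟨m, hm⟩ := (ht'.eventually_const_lt (show 1 - η < 1 by linarith)).exists
  refine ⟨m, fun n hn => hm.le.trans (measureReal_mono ?_)⟩
  rintro ω ⟨x, hx, hinf⟩
  obtain ⟨y, hy, hy'⟩ := infinite_iff_bx.1 hinf n
  obtain ⟨u, hu, hu'⟩ := con.hits_sph hy (bx_mono _ (by exact_mod_cast hn) hx) hy'
  exact ⟨u, hu, x, hx, hu'⟩

end Hits

section Counting

lemma bern_all_closed {I : Type*} (q : I → unitInterval) {r : ℝ} {T : Set I} (hT : T.Finite)
    (hq : ∀ i ∈ T, (q i : ℝ) = r) :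
    (bern q).real {ω | ∀ i ∈ T, ω i = false} = (1 - r) ^ T.ncard := by
  have := bern_cyl_real q hT.toFinset (fun _ => false)
  simp only [Set.Finite.mem_toFinset, Bool.false_eq_true, if_false] at this
  rw [this, Set.ncard_eq_toFinset_card _ hT, ← Finset.prod_const]
  exact Finset.prod_congr rfl fun i hi => by rw [hq i (by simpa using hi)]

lemma bern_all_open {I : Type*} (q : I → unitInterval) {r : ℝ} {T : Set I} (hT : T.Finite)
    (hq : ∀ i ∈ T, (q i : ℝ) = r) :
    (bern q).real {ω | ∀ i ∈ T, ω i = true} = r ^ T.ncard := by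
  have := bern_cyl_real q hT.toFinset (fun _ => true)
  simp only [Set.Finite.mem_toFinset, if_true] at this
  rw [this, Set.ncard_eq_toFinset_card _ hT, ← Finset.prod_const]
  exact Finset.prod_congr rfl fun i hi => by rw [hq i (by simpa using hi)]

lemma dep_all {I : Type*} (T : Set I) (b : Bool) : Dep T {ω : I → Bool | ∀ i ∈ T, ω i = b} :=
  fun ω ω' h hω i hi => by rw [← h i hi]; exact hω i hi

variable {d : ℕ}

/-- Open neighbours of a set: the pairs leaving `o` along lattice edges. -/
def outEdges (o : Set (Zd d)) : Set (Sym2 (Zd d)) :=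
  {e | ∃ u ∈ o, ∃ v, v ∉ o ∧ latAdj u v ∧ e = s(u, v)}

lemma outEdges_subset_image (o : Set (Zd d)) : outEdges o ⊆
    (fun p : Zd d × (Fin d × Bool) =>
      s(p.1, Function.update p.1 p.2.1 (p.1 p.2.1 + if p.2.2 then 1 else -1))) ''
      (o ×ˢ (Set.univ : Set (Fin d × Bool))) := by
  rintro e ⟨u, hu, v, _, huv, rfl⟩
  obtain ⟨i, σ, hσ, rfl⟩ := latAdj_iff.1 huv
  rcases hσ with rfl | rfl
  · exact ⟨(u, i, true), ⟨hu, trivial⟩, by simp⟩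
  · exact ⟨(u, i, false), ⟨hu, trivial⟩, by simp⟩

lemma outEdges_finite {o : Set (Zd d)} (ho : o.Finite) : (outEdges o).Finite :=
  ((ho.prod Set.finite_univ).image _).subset (outEdges_subset_image o)

lemma outEdges_ncard_le {o : Set (Zd d)} (ho : o.Finite) :
    (outEdges o).ncard ≤ 2 * d * o.ncard := by
  refine (Set.ncard_le_ncard (outEdges_subset_image o)
    ((ho.prod Set.finite_univ).image _)).trans ?_
  refine (Set.ncard_image_le (ho.prod Set.finite_univ)).trans ?_
  rw [Set.ncard_prod, Set.ncard_univ]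
  simp
  rw [mul_comm, mul_comm d]

lemma sph_finite (b : Zd d) (r : ℤ) : (sph b r).Finite := (bx_finite b r).subset (sph_subset b r)

lemma hit_subset_sph (O : Set (Sym2 (Zd d))) (m n : ℤ) : hit O m n ⊆ sph 0 n := fun _ h => h.1

lemma hit_finite (O : Set (Sym2 (Zd d))) (m n : ℤ) : (hit O m n).Finite :=
  (sph_finite 0 n).subset (hit_subset_sph O m n)

lemma hit_congr {O O' : Set (Sym2 (Zd d))} {m n : ℤ}
    (h : O ∩ edgesIn (bx 0 n) = O' ∩ edgesIn (bx 0 n)) : hit O m n = hit O' m n := by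
  unfold hit; rw [h]

lemma hit_mono {O O' : Set (Sym2 (Zd d))} (h : O ⊆ O') (m n : ℤ) : hit O m n ⊆ hit O' m n := by
  rintro x ⟨h1, u, hu, h2⟩
  exact ⟨h1, u, hu, h2.mono (Set.inter_subset_inter_left _ h)⟩

lemma dep_hit (m n : ℤ) (P : Set (Zd d) → Prop) :
    Dep (edgesIn (bx 0 n)) {ω : Config d | P (hit (op ω) m n)} := by
  intro ω ω' h hω
  simp only [Set.mem_ofPred_eq] at hω ⊢
  rwa [← hit_congr (op_inter_congr h)]

lemma hit_pred {O : Set (Sym2 (Zd d))} {m n : ℤ} (hmn : m ≤ n) {y : Zd d}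
    (hy : y ∈ hit O m (n + 1)) : ∃ u ∈ hit O m n, ∃ v, v ∉ bx 0 n ∧ latAdj u v ∧ s(u, v) ∈ O := by
  obtain ⟨⟨_, i, hi⟩, x, hx, hxy⟩ := hy
  have hyn : y ∉ bx 0 n := fun h => by
    have := h i
    simp only [Pi.zero_apply] at *
    omega
  obtain ⟨u, hu, v, hv, h1, h2, h3, _⟩ := hxy.first_exit (bx_mono _ hmn hx) hyn
  refine ⟨u, ⟨(exit_mem_sph hu hv h1).1, x, hx, h3.mono ?_⟩, v, hv, h1, h2.1⟩
  exact Set.inter_subset_inter_left _ Set.inter_subset_left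

lemma exists_hit_card (q : Sym2 (Zd d) → unitInterval) {r : ℝ} (hq : ∀ e, (q e : ℝ) = r)
    (hr : r < 1) {m : ℕ} {η : ℝ} (hη : 0 < η)
    (h : ∀ n : ℕ, m ≤ n → 1 - η ≤ (bern q).real {ω | (hit (op ω) m n).Nonempty})
    (K n0 : ℕ) :
    ∃ n : ℕ, n0 ≤ n ∧ m ≤ n ∧ (bern q).real {ω | (hit (op ω) m n).ncard < K} ≤ 2 * η := by
  have hr0 : 0 < 1 - r := by linarith
  have hr1 : 1 - r ≤ 1 := by
    have := (q s(0, 0)).2.1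
    rw [hq] at this
    linarith
  let a : ℕ → ℝ := fun n => (bern q).real {ω | (hit (op ω) m ((m + n : ℕ) : ℤ)).Nonempty}
  have hanti : Antitone a := by
    refine antitone_nat_of_succ_le fun n => measureReal_mono ?_
    rintro ω ⟨y, hy⟩
    have hy' : y ∈ hit (op ω) m (((m + n : ℕ) : ℤ) + 1) := by
      have : (((m + n : ℕ) : ℤ) + 1) = ((m + (n + 1) : ℕ) : ℤ) := by push_cast; ring
      rw [this]; exact hy
    obtain ⟨u, hu, _⟩ := hit_pred (by push_cast; omega) hy'
    exact ⟨u, hu⟩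
  have hconv := tendsto_atTop_ciInf hanti ⟨0, by rintro _ ⟨n, rfl⟩; exact measureReal_nonneg⟩
  have hdiff : Filter.Tendsto (fun n => a n - a (n + 1)) Filter.atTop (nhds 0) := by
    have := hconv.sub (hconv.comp (Filter.tendsto_add_atTop_nat 1))
    simpa using this
  have hpos : 0 < η * (1 - r) ^ (2 * d * K) := by positivity
  obtain ⟨k, hk1, hk2⟩ := ((hdiff.eventually_lt_const hpos).and
    (Filter.eventually_ge_atTop n0)).exists
  refine ⟨m + k, by omega, by omega, ?_⟩
  set n : ℤ := ((m + k : ℕ) : ℤ) with hn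
  have hfinr : (Set.range fun ω : Config d => hit (op ω) m n).Finite := by
    refine (sph_finite 0 n).finite_subsets.subset ?_
    rintro _ ⟨ω, rfl⟩
    exact hit_subset_sph _ _ _
  have hF : ∀ o : Set (Zd d), Dep {e | e ∈ outEdges o ∧ e ∉ edgesIn (bx 0 n)}
      {ω : Config d | ∀ e ∈ {e | e ∈ outEdges o ∧ e ∉ edgesIn (bx 0 n)}, ω e = false} :=
    fun o => dep_all _ _
  have hofin : ∀ o ∈ Set.range (fun ω : Config d => hit (op ω) m n), o.Finite := by
    rintro _ ⟨ω, rfl⟩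
    exact hit_finite _ _ _
  have key := bern_explore_ge q hfinr (S := fun _ => edgesIn (bx 0 n))
    (T := fun o => {e | e ∈ outEdges o ∧ e ∉ edgesIn (bx 0 n)})
    (fun _ _ => edgesIn_finite (bx_finite _ _))
    (fun o ho => (outEdges_finite (hofin o ho)).subset fun _ h => h.1)
    (fun o _ => Set.disjoint_left.2 fun _ h1 h2 => h2.2 h1)
    (fun o _ => dep_hit m n fun X => X = o) (fun o _ => hF o)
    {o | o.Nonempty ∧ o.ncard < K} ((1 - r) ^ (2 * d * K)) (by
      rintro o ho ⟨_, hoK⟩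
      have hfin : {e | e ∈ outEdges o ∧ e ∉ edgesIn (bx 0 n)}.Finite :=
        (outEdges_finite (hofin o ho)).subset fun _ h => h.1
      rw [bern_all_closed q (r := r) hfin fun e _ => hq e]
      refine pow_le_pow_of_le_one hr0.le hr1 ?_
      calc _ ≤ (outEdges o).ncard :=
            Set.ncard_le_ncard (fun _ h => h.1) (outEdges_finite (hofin o ho))
        _ ≤ 2 * d * o.ncard := outEdges_ncard_le (hofin o ho)
        _ ≤ _ := Nat.mul_le_mul_left _ hoK.le)
  have hsub : {ω : Config d | hit (op ω) m n ∈ {o : Set (Zd d) | o.Nonempty ∧ o.ncard < K}} ∩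
      {ω | ω ∈ {ω : Config d | ∀ e ∈ {e | e ∈ outEdges (hit (op ω) m n) ∧
        e ∉ edgesIn (bx 0 n)}, ω e = false}} ⊆
      {ω | (hit (op ω) m n).Nonempty} \ {ω | (hit (op ω) m (n + 1)).Nonempty} := by
    rintro ω ⟨⟨h1, _⟩, h2⟩
    refine ⟨h1, ?_⟩
    rintro ⟨y, hy⟩
    obtain ⟨u, hu, v, hv, huv, ho⟩ := hit_pred (by rw [hn]; push_cast; omega) hy
    have := h2 s(u, v) ⟨⟨u, hu, v, fun hv' => hv (sph_subset _ _ hv'.1), huv, rfl⟩,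
      fun h => hv (mk_mem_edgesIn.1 h).2⟩
    rw [op, Set.mem_ofPred_eq] at ho
    rw [ho] at this
    exact absurd this (by simp)
  have hmeas : MeasurableSet {ω : Config d | (hit (op ω) m (n + 1)).Nonempty} :=
    (dep_hit m (n + 1) fun X => X.Nonempty).measurableSet (edgesIn_finite (bx_finite _ _))
  have hsub2 : {ω : Config d | (hit (op ω) m (n + 1)).Nonempty} ⊆
      {ω | (hit (op ω) m n).Nonempty} := by
    rintro ω ⟨y, hy⟩
    obtain ⟨u, hu, _⟩ := hit_pred (by rw [hn]; push_cast; omega) hy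
    exact ⟨u, hu⟩
  have h3 := key.trans (measureReal_mono hsub)
  rw [measureReal_sdiff hsub2 hmeas] at h3
  have ha : a k - a (k + 1) = (bern q).real {ω | (hit (op ω) m n).Nonempty} -
      (bern q).real {ω | (hit (op ω) m (n + 1)).Nonempty} := by
    have : n + 1 = ((m + (k + 1) : ℕ) : ℤ) := by rw [hn]; push_cast; ring
    rw [this]
  rw [← ha] at h3
  have h4 : (bern q).real {ω | hit (op ω) m n ∈ {o : Set (Zd d) | o.Nonempty ∧ o.ncard < K}}
      ≤ η := by
    by_contra hc
    push Not at hc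
    have := mul_lt_mul_of_pos_left hc (pow_pos hr0 (2 * d * K))
    nlinarith
  have h5 : (bern q).real {ω | (hit (op ω) m n).Nonempty}ᶜ ≤ η := by
    have hm : MeasurableSet {ω : Config d | (hit (op ω) m n).Nonempty} :=
      (dep_hit m n fun X => X.Nonempty).measurableSet (edgesIn_finite (bx_finite _ _))
    rw [probReal_compl_eq_one_sub hm]
    have := h (m + k) (by omega)
    linarith
  have h6 : {ω : Config d | (hit (op ω) m n).ncard < K} ⊆
      {ω | hit (op ω) m n ∈ {o : Set (Zd d) | o.Nonempty ∧ o.ncard < K}} ∪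
      {ω | (hit (op ω) m n).Nonempty}ᶜ := by
    intro ω hω
    by_cases hne : (hit (op ω) m n).Nonempty
    · exact .inl ⟨hne, hω⟩
    · exact .inr hne
  calc _ ≤ _ := measureReal_mono h6
    _ ≤ _ := measureReal_union_le _ _
    _ ≤ 2 * η := by linarith

end Counting

section Symmetry
variable {d : ℕ}

/-- Lattice automorphisms. -/
def IsAuto (φ : Zd d ≃ Zd d) : Prop := ∀ x y, latAdj (φ x) (φ y) ↔ latAdj x y

lemma con_preimage {φ : Zd d ≃ Zd d} (hφ : IsAuto φ) (O : Set (Sym2 (Zd d))) (x y : Zd d) :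
    con (Sym2.map φ ⁻¹' O) x y ↔ con O (φ x) (φ y) := by
  constructor
  · intro h
    induction h with
    | refl => exact .refl
    | tail _ h ih => exact ih.tail ((hφ _ _).2 h.1) h.2
  · intro h
    have key : ∀ z, con O (φ x) z → con (Sym2.map φ ⁻¹' O) x (φ.symm z) := by
      intro z hz
      induction hz with
      | refl => simpa using con.refl
      | tail _ h ih =>
        refine ih.tail ((hφ _ _).1 (by simpa using h.1)) ?_
        simpa using h.2
    simpa using key _ h

lemma op_comp (φ : Zd d ≃ Zd d) (ω : Config d) :
    op (fun e => ω (Sym2.map φ e)) = Sym2.map φ ⁻¹' op ω := rfl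

lemma map_edgesIn (φ : Zd d ≃ Zd d) (S : Set (Zd d)) :
    Sym2.map φ ⁻¹' edgesIn S = edgesIn (φ ⁻¹' S) := by
  ext e
  induction e using Sym2.ind with
  | _ a b => simp

lemma sym2_map_injective (φ : Zd d ≃ Zd d) : Function.Injective (Sym2.map φ) :=
  Sym2.map.injective φ.injective

lemma bern_auto {q : Sym2 (Zd d) → unitInterval} {r : unitInterval} (hq : ∀ e, q e = r)
    (φ : Zd d ≃ Zd d) {E : Set (Config d)} (hE : MeasurableSet E) :
    (bern q).real {ω | (fun e => ω (Sym2.map φ e)) ∈ E} = (bern q).real E := by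
  rw [bern_reindex q (sym2_map_injective φ) hE]
  congr 2
  ext e
  rw [hq, hq]

/-- The sign attached to a Boolean. -/
def sg (b : Bool) : ℤ := if b then 1 else -1

lemma sg_mul_self (b : Bool) : sg b * sg b = 1 := by cases b <;> rfl

/-- The part of the sphere of radius `n` around `b` on the face `(i, τ i)`, in the orthant `τ`. -/
def facet (b : Zd d) (n : ℤ) (i : Fin d) (τ : Fin d → Bool) : Set (Zd d) :=
  {x | sg (τ i) * (x i - b i) = n ∧ ∀ j, 0 ≤ sg (τ j) * (x j - b j) ∧ sg (τ j) * (x j - b j) ≤ n}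

lemma sg_cases (b : Bool) : sg b = 1 ∨ sg b = -1 := by cases b <;> simp [sg]

lemma facet_subset_sph (b : Zd d) (n : ℤ) (i : Fin d) (τ : Fin d → Bool) :
    facet b n i τ ⊆ sph b n := by
  rintro x ⟨h1, h2⟩
  refine ⟨fun j => ?_, i, ?_⟩
  · have := h2 j
    rcases sg_cases (τ j) with h | h <;> rw [h] at this <;> constructor <;> linarith
  · rcases sg_cases (τ i) with h | h <;> rw [h] at h1
    · left; linarith
    · right; linarith

lemma sph_subset_facet (b : Zd d) {n : ℤ} (hn : 0 ≤ n) :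
    sph b n ⊆ ⋃ p : Fin d × (Fin d → Bool), facet b n p.1 p.2 := by
  rintro x ⟨h1, i, hi⟩
  have hσ : ∃ σ : Bool, sg σ * (x i - b i) = n := by
    rcases hi with hi | hi
    · exact ⟨true, by rw [hi]; simp [sg]⟩
    · exact ⟨false, by rw [hi]; simp [sg]⟩
  obtain ⟨σ, hσ⟩ := hσ
  refine Set.mem_iUnion.2 ⟨(i, fun j => if j = i then σ else decide (b j ≤ x j)), ?_, fun j => ?_⟩
  · simpa using hσ
  · by_cases hj : j = i
    · subst hj
      simp only [if_true]
      omega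
    · have := h1 j
      simp only [hj, if_false, sg, decide_eq_true_eq]
      split_ifs <;> omega

/-- Signed coordinate permutation exchanging two facets. -/
def signPerm (π : Equiv.Perm (Fin d)) (τ : Fin d → Bool) : Zd d ≃ Zd d where
  toFun x j := sg (τ j) * x (π j)
  invFun x j := sg (τ (π.symm j)) * x (π.symm j)
  left_inv x := by
    ext j
    simp only [Equiv.apply_symm_apply]
    rw [← mul_assoc, sg_mul_self, one_mul]
  right_inv x := by
    ext j
    simp only [Equiv.symm_apply_apply]
    rw [← mul_assoc, sg_mul_self, one_mul]

lemma sg_abs (b : Bool) (x : ℤ) : |sg b * x| = |x| := by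
  rcases sg_cases b with h | h <;> rw [h] <;> simp

lemma signPerm_isAuto (π : Equiv.Perm (Fin d)) (τ : Fin d → Bool) : IsAuto (signPerm π τ) := by
  intro x y
  unfold latAdj signPerm
  simp only [Equiv.coe_fn_mk, ← mul_sub, sg_abs]
  rw [Equiv.sum_comp π fun j => |x j - y j|]

lemma signPerm_mem_bx (π : Equiv.Perm (Fin d)) (τ : Fin d → Bool) (r : ℤ) (x : Zd d) :
    signPerm π τ x ∈ bx 0 r ↔ x ∈ bx 0 r := by
  have key : ∀ z : Zd d, z ∈ bx 0 r ↔ ∀ j, |z j| ≤ r := by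
    intro z
    refine forall_congr' fun j => ?_
    rw [abs_le]
    simp
  rw [key, key]
  simp only [signPerm, Equiv.coe_fn_mk, sg_abs]
  exact ⟨fun h j => by simpa using h (π.symm j), fun h j => h _⟩

lemma signPerm_mem_facet (i i' : Fin d) (τ τ' : Fin d → Bool) :
    ∃ π : Equiv.Perm (Fin d), ∃ ρ : Fin d → Bool, ∀ (n : ℤ) (x : Zd d),
      signPerm π ρ x ∈ facet 0 n i' τ' ↔ x ∈ facet 0 n i τ := by
  refine ⟨Equiv.swap i i', fun j => (τ' j) == (τ (Equiv.swap i i' j)), fun n x => ?_⟩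
  have hs : ∀ a b : Bool, ∀ z : ℤ, sg a * (sg (a == b) * z) = sg b * z := by
    intro a b z; cases a <;> cases b <;> simp [sg]
  simp only [facet, signPerm, Equiv.coe_fn_mk, Pi.zero_apply, sub_zero, hs, Set.mem_ofPred_eq,
    Equiv.swap_apply_right]
  refine and_congr Iff.rfl ⟨fun h j => ?_, fun h j => h _⟩
  simpa using h (Equiv.swap i i' j)

lemma signPerm_mem_sph (π : Equiv.Perm (Fin d)) (τ : Fin d → Bool) (r : ℤ) (x : Zd d) :
    signPerm π τ x ∈ sph 0 r ↔ x ∈ sph 0 r := by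
  refine and_congr (signPerm_mem_bx π τ r x) ?_
  simp only [signPerm, Equiv.coe_fn_mk, Pi.zero_apply, zero_add, zero_sub]
  constructor
  · rintro ⟨j, hj⟩
    refine ⟨π j, ?_⟩
    rcases sg_cases (τ j) with h | h <;> rw [h] at hj <;> omega
  · rintro ⟨j, hj⟩
    refine ⟨π.symm j, ?_⟩
    rcases sg_cases (τ (π.symm j)) with h | h <;> rw [h] <;>
      simp only [Equiv.apply_symm_apply] <;> omega

lemma hit_signPerm (π : Equiv.Perm (Fin d)) (τ : Fin d → Bool) (O : Set (Sym2 (Zd d))) (m n : ℤ) :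
    hit (Sym2.map (signPerm π τ) ⁻¹' O) m n = signPerm π τ ⁻¹' hit O m n := by
  have hb : ∀ r, signPerm π τ ⁻¹' bx 0 r = bx 0 r := fun r => by
    ext x; exact signPerm_mem_bx π τ r x
  ext x
  simp only [hit, Set.mem_preimage, Set.mem_ofPred_eq]
  refine and_congr (signPerm_mem_sph π τ n x).symm ?_
  have hE : Sym2.map (signPerm π τ) ⁻¹' O ∩ edgesIn (bx 0 n) =
      Sym2.map (signPerm π τ) ⁻¹' (O ∩ edgesIn (bx 0 n)) := by
    rw [Set.preimage_inter, map_edgesIn, hb]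
  simp only [hE, con_preimage (signPerm_isAuto π τ)]
  constructor
  · rintro ⟨u, hu, h⟩
    exact ⟨_, (signPerm_mem_bx π τ m u).2 hu, h⟩
  · rintro ⟨u, hu, h⟩
    refine ⟨(signPerm π τ).symm u, ?_, by simpa using h⟩
    rw [← signPerm_mem_bx π τ]
    simpa using hu

lemma prob_facet_eq {q : Sym2 (Zd d) → unitInterval} {r : unitInterval} (hq : ∀ e, q e = r)
    (m n : ℤ) (K : ℕ) (i i' : Fin d) (τ τ' : Fin d → Bool) :
    (bern q).real {ω | K ≤ (hit (op ω) m n ∩ facet 0 n i τ).ncard} =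
      (bern q).real {ω | K ≤ (hit (op ω) m n ∩ facet 0 n i' τ').ncard} := by
  obtain ⟨π, ρ, h⟩ := signPerm_mem_facet i i' τ τ'
  have hE : MeasurableSet {ω : Config d | K ≤ (hit (op ω) m n ∩ facet 0 n i τ).ncard} :=
    (dep_hit m n fun X => K ≤ (X ∩ facet 0 n i τ).ncard).measurableSet
      (edgesIn_finite (bx_finite _ _))
  rw [← bern_auto hq (signPerm π ρ) hE]
  congr 1
  ext ω
  simp only [Set.mem_ofPred_eq, op_comp, hit_signPerm]
  have : signPerm π ρ ⁻¹' hit (op ω) m n ∩ facet 0 n i τ =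
      signPerm π ρ ⁻¹' (hit (op ω) m n ∩ facet 0 n i' τ') := by
    ext x
    simp [h n x]
  rw [this, Set.ncard_preimage_of_injective_subset_range (signPerm π ρ).injective (by simp)]

lemma prob_facet_lt {q : Sym2 (Zd d) → unitInterval} {r : unitInterval} (hq : ∀ e, q e = r)
    {m n : ℤ} (hn : 0 ≤ n) {K : ℕ} {ε : ℝ} (hε : 0 ≤ ε)
    (h : (bern q).real {ω | (hit (op ω) m n).ncard < d * 2 ^ d * K} ≤ ε ^ (d * 2 ^ d))
    (i : Fin d) (τ : Fin d → Bool) :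
    (bern q).real {ω | K ≤ (hit (op ω) m n ∩ facet 0 n i τ).ncard}ᶜ ≤ ε := by
  have hd : 0 < d := i.pos
  let E : Fin d × (Fin d → Bool) → Set (Config d) :=
    fun p => {ω | K ≤ (hit (op ω) m n ∩ facet 0 n p.1 p.2).ncard}
  have hdep : ∀ p, Dep (edgesIn (bx 0 n)) (E p) := fun p =>
    dep_hit m n fun X => K ≤ (X ∩ facet 0 n p.1 p.2).ncard
  have hinc : ∀ p, Inc (E p) := by
    intro p ω ω' hω h
    refine le_trans (show K ≤ _ from h) (Set.ncard_le_ncard ?_ ((hit_finite _ _ _).inter_of_left _))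
    exact Set.inter_subset_inter_left _ (hit_mono (fun e he => hω e he) _ _)
  have h1 := harris_prod_compl q (edgesIn_finite (bx_finite 0 n)) Finset.univ
    (fun p _ => hdep p) (fun p _ => hinc p)
  have h2 : ∀ p ∈ Finset.univ, (bern q).real (E p)ᶜ = (bern q).real (E (i, τ))ᶜ := by
    intro p _
    rw [probReal_compl_eq_one_sub ((hdep p).measurableSet (edgesIn_finite (bx_finite _ _))),
      probReal_compl_eq_one_sub ((hdep (i, τ)).measurableSet (edgesIn_finite (bx_finite _ _)))]
    rw [prob_facet_eq hq m n K p.1 i p.2 τ]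
  rw [Finset.prod_congr rfl h2, Finset.prod_const, Finset.card_univ] at h1
  simp only [Fintype.card_prod, Fintype.card_fin, Fintype.card_pi, Fintype.card_bool,
    Finset.prod_const, Finset.card_univ] at h1
  have h3 : (⋂ p ∈ (Finset.univ : Finset (Fin d × (Fin d → Bool))), (E p)ᶜ) ⊆
      {ω | (hit (op ω) m n).ncard < d * 2 ^ d * K} := by
    intro ω hω
    simp only [Finset.mem_univ, Set.iInter_true, Set.mem_iInter, Set.mem_compl_iff, E,
      Set.mem_ofPred_eq, not_le] at hω ⊢
    have hcov : hit (op ω) m n =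
        ⋃ p ∈ (Finset.univ : Finset (Fin d × (Fin d → Bool))),
          (hit (op ω) m n ∩ facet 0 n p.1 p.2) := by
      simp only [Finset.mem_univ, Set.iUnion_true, ← Set.inter_iUnion]
      exact (Set.inter_eq_left.2 ((hit_subset_sph _ _ _).trans (sph_subset_facet 0 hn))).symm
    have hle := Finset.set_ncard_biUnion_le
      (Finset.univ : Finset (Fin d × (Fin d → Bool))) (fun p => hit (op ω) m n ∩ facet 0 n p.1 p.2)
    rw [← hcov] at hle
    refine hle.trans_lt ?_
    have : ∑ p : Fin d × (Fin d → Bool), (hit (op ω) m n ∩ facet 0 n p.1 p.2).ncard <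
        ∑ p : Fin d × (Fin d → Bool), K :=
      Finset.sum_lt_sum_of_nonempty ⟨(i, τ), Finset.mem_univ _⟩ fun p _ => hω p
    simpa using this
  have h4 := h1.trans ((measureReal_mono h3).trans h)
  exact le_of_pow_le_pow_left₀ (by positivity) hε h4

end Symmetry

section Layers
variable {d : ℕ} {Λ : Type}

/-- The open edges of the layer `l`. -/
def lay (ω : Λ × Sym2 (Zd d) → Bool) (l : Λ) : Set (Sym2 (Zd d)) := op fun e => ω (l, e)

lemma lay_inter_congr {ω ω' : Λ × Sym2 (Zd d) → Bool} {l : Λ} {S : Set (Sym2 (Zd d))}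
    (h : ∀ e ∈ S, ω (l, e) = ω' (l, e)) : lay ω l ∩ S = lay ω' l ∩ S :=
  op_inter_congr h

lemma subset_lay_congr {ω ω' : Λ × Sym2 (Zd d) → Bool} {l : Λ} {S : Set (Sym2 (Zd d))}
    (h : ∀ e ∈ S, ω (l, e) = ω' (l, e)) : S ⊆ lay ω l ↔ S ⊆ lay ω' l := by
  rw [← Set.inter_eq_right, ← Set.inter_eq_right, lay_inter_congr h]

lemma bern_layer {q : Λ × Sym2 (Zd d) → unitInterval} {l : Λ} {r : unitInterval}
    (hq : ∀ e, q (l, e) = r) {E : Set (Config d)} (hE : MeasurableSet E) :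
    (bern q).real {ω | (fun e => ω (l, e)) ∈ E} = (bern fun _ : Sym2 (Zd d) => r).real E := by
  rw [bern_reindex q (f := fun e => (l, e)) (fun a b h => by simpa using h) hE]
  simp [hq]

/-- Translation by `b`. -/
def tr (b : Zd d) : Zd d ≃ Zd d := Equiv.addRight b

@[simp] lemma tr_apply (b x : Zd d) : tr b x = x + b := rfl

lemma sym2_map_surjective (φ : Zd d ≃ Zd d) : Function.Surjective (Sym2.map φ) := fun e => by
  induction e with
  | _ x y => exact ⟨s(φ.symm x, φ.symm y), by simp⟩

lemma tr_isAuto (b : Zd d) : IsAuto (tr b) := fun _ _ => latAdj_add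

lemma tr_preimage_bx (b x : Zd d) (r : ℤ) : tr b ⁻¹' bx (x + b) r = bx x r := by
  ext y
  simp only [Set.mem_preimage, mem_bx, tr_apply, Pi.add_apply]
  exact forall_congr' fun i => by constructor <;> rintro ⟨h1, h2⟩ <;> constructor <;> linarith

lemma tr_preimage_facet (b : Zd d) (n : ℤ) (i : Fin d) (τ : Fin d → Bool) :
    tr b ⁻¹' facet b n i τ = facet 0 n i τ := by
  ext y
  simp [facet]

lemma bern_translate {q : Λ × Sym2 (Zd d) → unitInterval} (hq : ∀ l e e', q (l, e) = q (l, e'))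
    (b : Zd d) {E : Set (Λ × Sym2 (Zd d) → Bool)} (hE : MeasurableSet E) :
    (bern q).real {ω | (fun j => ω (j.1, Sym2.map (tr b) j.2)) ∈ E} = (bern q).real E := by
  rw [bern_reindex q (f := fun j => (j.1, Sym2.map (tr b) j.2)) ?_ hE]
  · congr 2
    ext j
    rw [hq j.1 _ j.2]
  · rintro ⟨l, e⟩ ⟨l', e'⟩ h
    simp only [Prod.mk.injEq] at h
    rw [h.1, sym2_map_injective (tr b) h.2]

lemma lay_translate (b : Zd d) (ω : Λ × Sym2 (Zd d) → Bool) (l : Λ) :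
    lay (fun j => ω (j.1, Sym2.map (tr b) j.2)) l = Sym2.map (tr b) ⁻¹' lay ω l := rfl

/-- `bx b m` is joined inside `bx b n` by the edges `O` to a point of the facet all of whose
surrounding edges within distance `m` are in `Sd`. -/
def linked (O Sd : Set (Sym2 (Zd d))) (m n : ℤ) (b : Zd d) (i : Fin d) (τ : Fin d → Bool) : Prop :=
  ∃ u ∈ bx b m, ∃ x ∈ facet b n i τ, con (O ∩ edgesIn (bx b n)) u x ∧ edgesIn (bx x m) ⊆ Sd

lemma linked_translate (O Sd : Set (Sym2 (Zd d))) (m n : ℤ) (b : Zd d) (i : Fin d)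
    (τ : Fin d → Bool) :
    linked (Sym2.map (tr b) ⁻¹' O) (Sym2.map (tr b) ⁻¹' Sd) m n 0 i τ ↔ linked O Sd m n b i τ := by
  have hb : ∀ r, tr b ⁻¹' bx b r = bx 0 r := fun r => by simpa using tr_preimage_bx b 0 r
  have hE : Sym2.map (tr b) ⁻¹' O ∩ edgesIn (bx 0 n) =
      Sym2.map (tr b) ⁻¹' (O ∩ edgesIn (bx b n)) := by
    rw [Set.preimage_inter, map_edgesIn, hb]
  have hS : ∀ x, edgesIn (bx x m) ⊆ Sym2.map (tr b) ⁻¹' Sd ↔ edgesIn (bx (x + b) m) ⊆ Sd := by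
    intro x
    rw [← tr_preimage_bx b x m, ← map_edgesIn]
    refine (Function.Surjective.preimage_subset_preimage_iff ?_)
    exact (sym2_map_surjective (tr b))
  simp only [linked, hE, con_preimage (tr_isAuto b), hS]
  constructor
  · rintro ⟨u, hu, x, hx, h1, h2⟩
    refine ⟨tr b u, ?_, tr b x, ?_, h1, h2⟩
    · rw [← hb] at hu; exact hu
    · rw [← tr_preimage_facet b] at hx; exact hx
  · rintro ⟨u, hu, x, hx, h1, h2⟩
    refine ⟨(tr b).symm u, ?_, (tr b).symm x, ?_, by simpa using h1, ?_⟩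
    · rw [← hb]; simpa using hu
    · rw [← tr_preimage_facet b]; simpa using hx
    · have : (tr b).symm x + b = x := (tr b).apply_symm_apply x
      rwa [this]

lemma edgesIn_bx_ncard (x : Zd d) (m : ℤ) :
    (edgesIn (bx x m)).ncard = (edgesIn (bx (0 : Zd d) m)).ncard := by
  have := tr_preimage_bx x 0 m
  rw [zero_add] at this
  rw [← this, ← map_edgesIn, Set.ncard_preimage_of_injective_subset_range (sym2_map_injective _)]
  rw [Set.range_eq_univ.2 (sym2_map_surjective (tr x))]
  exact Set.subset_univ _

end Layers

section Blocks

/-- Among pairwise disjoint sets of coordinates, it is unlikely that none is entirely open. -/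
lemma bern_no_block_open {I κ : Type*} (q : I → unitInterval) {r : ℝ} {E : ℕ} (K : Finset κ)
    (T : κ → Set I) (hT : ∀ k, (T k).Finite) (hc : ∀ k, (T k).ncard = E)
    (hq : ∀ k, ∀ i ∈ T k, (q i : ℝ) = r)
    (hd : ∀ k ∈ K, ∀ k' ∈ K, k ≠ k' → Disjoint (T k) (T k')) :
    (bern q).real {ω | ∀ k ∈ K, ¬ ∀ i ∈ T k, ω i = true} = (1 - r ^ E) ^ K.card := by
  classical
  induction K using Finset.induction_on with
  | empty => simp
  | insert a K ha ih =>
    have ih := ih fun k hk k' hk' =>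
      hd k (Finset.mem_insert_of_mem hk) k' (Finset.mem_insert_of_mem hk')
    have e : {ω : I → Bool | ∀ k ∈ insert a K, ¬ ∀ i ∈ T k, ω i = true} =
        {ω | ∀ i ∈ T a, ω i = true}ᶜ ∩ {ω | ∀ k ∈ K, ¬ ∀ i ∈ T k, ω i = true} := by
      ext ω
      simp
    have hdep : Dep (⋃ k ∈ K, T k) {ω : I → Bool | ∀ k ∈ K, ¬ ∀ i ∈ T k, ω i = true} := by
      intro ω ω' h hω k hk hc
      refine hω k hk fun i hi => ?_
      rw [h i (Set.mem_biUnion hk hi)]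
      exact hc i hi
    rw [e, bern_indep q (hT a) (K.finite_toSet.biUnion fun k _ => hT k) _ (dep_all _ _).compl hdep,
      ih, probReal_compl_eq_one_sub ((dep_all _ _).measurableSet (hT a)),
      bern_all_open q (hT a) (hq a), hc, Finset.card_insert_of_notMem ha, pow_succ']
    simp only [Set.disjoint_iUnion_right]
    intro k hk
    exact hd a (Finset.mem_insert_self _ _) k (Finset.mem_insert_of_mem hk)
      (fun h => ha (h ▸ hk))

/-- A finite set of `K * (2 * m + 1)^d` points contains `K` points whose boxes of radius `m` are
disjoint. -/
lemma exists_spaced {d : ℕ} (o : Finset (Zd d)) (m K : ℕ) (h : (2 * m + 1) ^ d * K ≤ o.card) :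
    ∃ o' ⊆ o, K ≤ o'.card ∧ ∀ x ∈ o', ∀ y ∈ o', x ≠ y → Disjoint (bx x m) (bx y m) := by
  classical
  let f : Zd d → (Fin d → ZMod (2 * m + 1)) := fun x i => (x i : ZMod (2 * m + 1))
  have hne : NeZero (2 * m + 1) := ⟨by omega⟩
  obtain ⟨c, -, hc⟩ := Finset.exists_le_card_fiber_of_mul_le_card_of_maps_to (s := o)
    (t := Finset.univ) (f := f) (n := K) (fun _ _ => Finset.mem_univ _) ⟨0, Finset.mem_univ _⟩
    (by simpa [ZMod.card] using h)
  refine ⟨o.filter fun x => f x = c, Finset.filter_subset _ _, hc, ?_⟩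
  intro x hx y hy hxy
  rw [Set.disjoint_left]
  intro z hzx hzy
  apply hxy
  ext i
  have hxi := congrFun (((Finset.mem_filter.1 hx).2).trans ((Finset.mem_filter.1 hy).2).symm) i
  have h1 := (ZMod.intCast_eq_intCast_iff_dvd_sub _ _ _).1 hxi
  have h2 := hzx i
  have h3 := hzy i
  have := Int.eq_zero_of_abs_lt_dvd h1 (by rw [abs_lt]; push_cast; constructor <;> linarith)
  linarith

end Blocks

section OneStep
variable {d : ℕ}

lemma hit_facet_dep {Λ : Type} (l : Λ) (m n : ℤ) (i : Fin d) (τ : Fin d → Bool) (o : Set (Zd d)) :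
    Dep ({l} ×ˢ edgesIn (bx 0 n))
      {ω : Λ × Sym2 (Zd d) → Bool | hit (lay ω l) m n ∩ facet 0 n i τ = o} := by
  refine Dep.of_iff fun ω ω' h => ?_
  simp only [Set.mem_ofPred_eq]
  rw [hit_congr (lay_inter_congr (l := l) (S := edgesIn (bx 0 n)) fun e he => h (l, e) ⟨rfl, he⟩)]

lemma linked_congr {O O' Sd Sd' : Set (Sym2 (Zd d))} {m n : ℤ} {b : Zd d} {i : Fin d}
    {τ : Fin d → Bool} (h : O ∩ edgesIn (bx b n) = O' ∩ edgesIn (bx b n))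
    (h' : ∀ x ∈ facet b n i τ, edgesIn (bx x m) ⊆ Sd ↔ edgesIn (bx x m) ⊆ Sd') :
    linked O Sd m n b i τ ↔ linked O' Sd' m n b i τ := by
  unfold linked
  rw [h]
  refine exists_congr fun u => and_congr_right fun _ => exists_congr fun x =>
    and_congr_right fun hx => and_congr_right fun _ => h' x hx

lemma bx_subset_of_mem {b x : Zd d} {n m : ℤ} (hx : x ∈ bx b n) : bx x m ⊆ bx b (n + m) :=
  bx_subset fun i => by have := hx i; omega

lemma linked_dep {Λ : Type} (l l' : Λ) (m n : ℤ) (b : Zd d) (i : Fin d) (τ : Fin d → Bool) :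
    Dep ({l} ×ˢ edgesIn (bx b n) ∪ {l'} ×ˢ edgesIn (bx b (n + m)))
      {ω : Λ × Sym2 (Zd d) → Bool | linked (lay ω l) (lay ω l') m n b i τ} := by
  refine Dep.of_iff fun ω ω' h => linked_congr (lay_inter_congr fun e he => ?_) fun x hx =>
    subset_lay_congr fun e he => ?_
  · exact h (l, e) (.inl ⟨rfl, he⟩)
  · refine h (l', e) (.inr ⟨rfl, edgesIn_mono ?_ he⟩)
    exact bx_subset_of_mem (facet_subset_sph b n i τ hx).1

lemma exists_linked {r δ : unitInterval} (hr : (r : ℝ) < 1) (hδ : 0 < (δ : ℝ))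
    (hinf : bern (fun _ : Sym2 (Zd d) => r) {ω | (cluster ω).Infinite} ≠ 0) {η : ℝ} (hη : 0 < η)
    (hη1 : η < 1) :
    ∃ m n : ℕ, m ≤ n ∧ 1 ≤ n ∧ ∀ (Λ : Type) (q : Λ × Sym2 (Zd d) → unitInterval) (l l' : Λ),
      l ≠ l' → (∀ k e e', q (k, e) = q (k, e')) → (∀ e, q (l, e) = r) → (∀ e, q (l', e) = δ) →
      ∀ (b : Zd d) (i : Fin d) (τ : Fin d → Bool),
        1 - η ≤ (bern q).real {ω | linked (lay ω l) (lay ω l') m n b i τ} := by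
  classical
  have hη2 : 0 < (η / 2) ^ (d * 2 ^ d) / 2 := by positivity
  obtain ⟨m, hm⟩ := exists_hit_nonempty _ hinf hη2
  set E := (edgesIn (bx (0 : Zd d) m)).ncard with hE
  have hδE : 0 < (δ : ℝ) ^ E := by positivity
  have hδE1 : (δ : ℝ) ^ E ≤ 1 := pow_le_one₀ δ.2.1 δ.2.2
  obtain ⟨K, hK⟩ := exists_pow_lt_of_lt_one (half_pos hη) (show 1 - (δ : ℝ) ^ E < 1 by linarith)
  obtain ⟨n, hn1, hmn, hn⟩ := exists_hit_card _ (fun _ => rfl) hr hη2 hm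
    (d * 2 ^ d * ((2 * m + 1) ^ d * K)) 1
  refine ⟨m, n, hmn, hn1, fun Λ q l l' hll hq hql hql' b i τ => ?_⟩
  have hfin : ({l} ×ˢ edgesIn (bx (0 : Zd d) n) ∪ {l'} ×ˢ edgesIn (bx 0 (n + m)) :
      Set (Λ × Sym2 (Zd d))).Finite :=
    ((Set.finite_singleton _).prod (edgesIn_finite (bx_finite _ _))).union
      ((Set.finite_singleton _).prod (edgesIn_finite (bx_finite _ _)))
  -- translate to the origin
  have htr : (bern q).real {ω | linked (lay ω l) (lay ω l') m n b i τ} =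
      (bern q).real {ω | linked (lay ω l) (lay ω l') m n 0 i τ} := by
    rw [← bern_translate hq b ((linked_dep l l' m n 0 i τ).measurableSet hfin)]
    simp only [Set.mem_ofPred_eq, lay_translate, linked_translate]
  rw [htr]
  have h1 := prob_facet_lt (q := fun _ : Sym2 (Zd d) => r) (fun _ => rfl) (m := m) (n := n)
    (by positivity) (half_pos hη).le (hn.trans (by linarith)) i τ
  have hEm : MeasurableSet {ω : Config d |
      (2 * m + 1) ^ d * K ≤ (hit (op ω) m n ∩ facet 0 n i τ).ncard} :=
    (dep_hit m n fun X => (2 * m + 1) ^ d * K ≤ (X ∩ facet 0 n i τ).ncard).measurableSet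
      (edgesIn_finite (bx_finite _ _))
  rw [probReal_compl_eq_one_sub hEm, ← bern_layer hql hEm] at h1
  let X : (Λ × Sym2 (Zd d) → Bool) → Set (Zd d) := fun ω => hit (lay ω l) m n ∩ facet 0 n i τ
  have hXs : ∀ o ∈ Set.range X, o ⊆ facet 0 n i τ := by
    rintro o ⟨ω, rfl⟩; exact Set.inter_subset_right
  have hffin : (facet (0 : Zd d) n i τ).Finite := (sph_finite 0 n).subset (facet_subset_sph _ _ _ _)
  have h2 := bern_explore_ge q (X := X) (hffin.finite_subsets.subset fun o ho => hXs o ho)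
    (S := fun _ => {l} ×ˢ edgesIn (bx 0 n)) (T := fun _ => {l'} ×ˢ edgesIn (bx 0 (n + m)))
    (fun _ _ => (Set.finite_singleton _).prod (edgesIn_finite (bx_finite _ _)))
    (fun _ _ => (Set.finite_singleton _).prod (edgesIn_finite (bx_finite _ _)))
    (fun _ _ => by
      rw [Set.disjoint_left]
      rintro ⟨k, e⟩ ⟨h, _⟩ ⟨h', _⟩
      exact hll (h.symm.trans h'))
    (fun o _ => hit_facet_dep l m n i τ o)
    (F := fun o => {ω | ∃ x ∈ o, edgesIn (bx x m) ⊆ lay ω l'})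
    (fun o ho => by
      refine Dep.of_iff fun ω ω' h => exists_congr fun x => and_congr_right fun hx =>
        subset_lay_congr fun e he => h (l', e) ⟨rfl, edgesIn_mono ?_ he⟩
      exact bx_subset_of_mem (facet_subset_sph 0 n i τ (hXs o ho hx)).1)
    {o | (2 * m + 1) ^ d * K ≤ o.ncard} (1 - η / 2) (by
      intro o ho hoK
      have hof := hffin.subset (hXs o ho)
      obtain ⟨o', ho', hKo', hdis⟩ := exists_spaced hof.toFinset m K
        (by rw [← Set.ncard_eq_toFinset_card _ hof]; exact hoK)
      have h3 := bern_no_block_open q (r := δ) (E := E) o'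
        (fun x => {l'} ×ˢ edgesIn (bx x m))
        (fun x => (Set.finite_singleton _).prod (edgesIn_finite (bx_finite _ _)))
        (fun x => by rw [Set.ncard_prod]; simp [edgesIn_bx_ncard x m, hE])
        (fun x => by
          rintro ⟨k, e⟩ ⟨h, _⟩
          have h : k = l' := h
          rw [h, hql'])
        (fun x hx y hy hxy => by
          rw [Set.disjoint_left]
          rintro ⟨k, e⟩ ⟨_, h⟩ ⟨_, h'⟩
          exact Set.disjoint_left.1 (edgesIn_disjoint (hdis x hx y hy hxy)) h h')
      have h4 : (bern q).real {ω | ∃ x ∈ o, edgesIn (bx x m) ⊆ lay ω l'}ᶜ ≤ η / 2 := by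
        refine le_trans (measureReal_mono ?_) (h3.le.trans ?_)
        · intro ω hω x hx hc
          refine hω ⟨x, by simpa using ho' hx, fun e he => hc (l', e) ⟨rfl, he⟩⟩
        · refine le_trans (pow_le_pow_of_le_one (by linarith) (by linarith) hKo') hK.le
      rw [probReal_compl_eq_one_sub] at h4
      · linarith
      · refine Dep.measurableSet (S := {l'} ×ˢ edgesIn (bx 0 (n + m))) ?_
          ((Set.finite_singleton _).prod (edgesIn_finite (bx_finite _ _)))
        refine Dep.of_iff fun ω ω' h => exists_congr fun x => and_congr_right fun hx =>
          subset_lay_congr fun e he => h (l', e) ⟨rfl, edgesIn_mono ?_ he⟩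
        exact bx_subset_of_mem (facet_subset_sph 0 n i τ (hXs o ho hx)).1)
  have h5 : (1 - η / 2) * (1 - η / 2) ≤
      (bern q).real {ω | linked (lay ω l) (lay ω l') m n 0 i τ} := by
    have h6 : 1 - η / 2 ≤ (bern q).real
        {ω | X ω ∈ {o : Set (Zd d) | (2 * m + 1) ^ d * K ≤ o.ncard}} := by
      have := h1
      simp only [Set.mem_ofPred_eq] at this
      change 1 - (bern q).real {ω | X ω ∈ {o : Set (Zd d) | (2 * m + 1) ^ d * K ≤ o.ncard}} ≤ _
        at this
      linarith
    refine (mul_le_mul_of_nonneg_left h6 (by linarith)).trans (h2.trans (measureReal_mono ?_))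
    rintro ω ⟨_, x, ⟨⟨_, u, hu, h⟩, hx⟩, hs⟩
    exact ⟨u, hu, x, hx, h, hs⟩
  nlinarith

end OneStep

section Growth
variable {d : ℕ}

/-- The points of `S` outside `R` reached from `R` by crossing one edge of `O₁` and then following
edges of `O₀` that avoid `R`. -/
def grow (O₀ O₁ : Set (Sym2 (Zd d))) (R S : Set (Zd d)) : Set (Zd d) :=
  {v | ∃ u ∈ R ∩ S, ∃ w ∈ S \ R, latAdj u w ∧ s(u, w) ∈ O₁ ∧ con (O₀ ∩ edgesIn (S \ R)) w v}

lemma grow_subset (O₀ O₁ : Set (Sym2 (Zd d))) (R S : Set (Zd d)) : grow O₀ O₁ R S ⊆ S \ R := by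
  rintro v ⟨u, _, w, hw, _, _, h⟩
  exact h.mem Set.inter_subset_right hw

/-- The seeded points of the facet. -/
def seeded (O : Set (Sym2 (Zd d))) (m n : ℤ) (b : Zd d) (i : Fin d) (τ : Fin d → Bool) :
    Set (Zd d) := {x | x ∈ facet b n i τ ∧ edgesIn (bx x m) ⊆ O}

/-- The edges leaving `R` in `S` whose endpoint is joined outside `R` to the set `Z`. -/
def gates (O₀ : Set (Sym2 (Zd d))) (R S Z : Set (Zd d)) : Set (Sym2 (Zd d)) :=
  {e | ∃ u ∈ R ∩ S, ∃ w ∈ S \ R, latAdj u w ∧ e = s(u, w) ∧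
    ∃ x ∈ Z, con (O₀ ∩ edgesIn (S \ R)) w x}

lemma gates_subset (O₀ : Set (Sym2 (Zd d))) (R S Z : Set (Zd d)) :
    gates O₀ R S Z ⊆ edgesIn S \ edgesIn (S \ R) := by
  rintro e ⟨u, hu, w, hw, _, rfl, _⟩
  exact ⟨mk_mem_edgesIn.2 ⟨hu.2, hw.1⟩, fun h => (mk_mem_edgesIn.1 h).1.2 hu.1⟩

lemma one_step {r δ : unitInterval} (hr : (r : ℝ) < 1) (hδ : 0 < (δ : ℝ))
    (hinf : bern (fun _ : Sym2 (Zd d) => r) {ω | (cluster ω).Infinite} ≠ 0) {ε : ℝ} (hε : 0 < ε) :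
    ∃ m n : ℕ, m ≤ n ∧ 1 ≤ n ∧ ∀ (Λ : Type) (q : Λ × Sym2 (Zd d) → unitInterval) (l₀ l₁ l₂ : Λ),
      l₀ ≠ l₁ → l₀ ≠ l₂ → l₁ ≠ l₂ → (∀ k e e', q (k, e) = q (k, e')) → (∀ e, q (l₀, e) = r) →
      (∀ e, q (l₁, e) = δ) → (∀ e, q (l₂, e) = δ) →
      ∀ (b : Zd d) (i : Fin d) (τ : Fin d → Bool) (R : Set (Zd d)), bx b m ⊆ R →
        1 - ε ≤ (bern q).real {ω | ∃ x ∈ seeded (lay ω l₂) m n b i τ,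
          x ∈ R ∪ grow (lay ω l₀) (lay ω l₁) R (bx b n)} := by
  classical
  obtain ⟨M, hM⟩ := exists_pow_lt_of_lt_one (half_pos hε) (show 1 - (δ : ℝ) < 1 by linarith)
  have hrM : 0 < (1 - (r : ℝ)) ^ M := pow_pos (by linarith) _
  obtain ⟨η, hη, hηe⟩ : ∃ η : ℝ, η = min (1 / 2) (ε / 2 * (1 - (r : ℝ)) ^ M) ∧ 0 < η :=
    ⟨_, rfl, by positivity⟩
  obtain ⟨m, n, hmn, hn, H⟩ := exists_linked hr hδ hinf hηe
    (by rw [hη]; exact (min_le_left _ _).trans_lt (by norm_num))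
  refine ⟨m, n, hmn, hn, fun Λ q l₀ l₁ l₂ h01 h02 h12 hq hq0 hq1 hq2 b i τ R hR => ?_⟩
  have H := H Λ q l₀ l₂ h02 hq hq0 hq2 b i τ
  set S := bx b n with hS
  have hSf : S.Finite := bx_finite _ _
  let Z : (Λ × Sym2 (Zd d) → Bool) → Set (Zd d) := fun ω => seeded (lay ω l₂) m n b i τ
  let W : (Λ × Sym2 (Zd d) → Bool) → Set (Sym2 (Zd d)) := fun ω => gates (lay ω l₀) R S (Z ω)
  have hWS : ∀ ω, W ω ⊆ edgesIn S \ edgesIn (S \ R) := fun ω => gates_subset _ _ _ _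
  let X : (Λ × Sym2 (Zd d) → Bool) → Set (Sym2 (Zd d)) × Prop :=
    fun ω => (W ω, ∃ x ∈ Z ω, x ∈ R)
  let D : Set (Λ × Sym2 (Zd d)) := {l₀} ×ˢ edgesIn (S \ R) ∪ {l₂} ×ˢ edgesIn (bx b (n + m))
  have hDf : D.Finite :=
    ((Set.finite_singleton _).prod (edgesIn_finite (hSf.sdiff))).union
      ((Set.finite_singleton _).prod (edgesIn_finite (bx_finite _ _)))
  have hZ : ∀ ω ω' : Λ × Sym2 (Zd d) → Bool, (∀ j ∈ D, ω j = ω' j) → Z ω = Z ω' := by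
    intro ω ω' h
    ext x
    refine and_congr_right fun hx => subset_lay_congr fun e he => h (l₂, e) (.inr ⟨rfl, ?_⟩)
    exact edgesIn_mono (bx_subset_of_mem (facet_subset_sph b n i τ hx).1) he
  have hXD : ∀ o, Dep D {ω | X ω = o} := by
    intro o
    refine Dep.of_iff fun ω ω' h => ?_
    have e1 : lay ω l₀ ∩ edgesIn (S \ R) = lay ω' l₀ ∩ edgesIn (S \ R) :=
      lay_inter_congr fun e he => h (l₀, e) (.inl ⟨rfl, he⟩)
    have : X ω = X ω' := by
      simp only [X, W, gates, hZ ω ω' h, e1]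
    simp only [Set.mem_ofPred_eq, this]
  have hXf : (Set.range X).Finite :=
    (((edgesIn_finite hSf).sdiff (t := edgesIn (S \ R))).finite_subsets.prod
      (Set.finite_univ (α := Prop))).subset (by rintro _ ⟨ω, rfl⟩; exact ⟨hWS ω, trivial⟩)
  have hoS : ∀ o ∈ Set.range X, o.1 ⊆ edgesIn S \ edgesIn (S \ R) := by
    rintro _ ⟨ω, rfl⟩; exact hWS ω
  have hof : ∀ o ∈ Set.range X, o.1.Finite := fun o ho =>
    (edgesIn_finite hSf).subset ((hoS o ho).trans Set.sdiff_subset)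
  have hTf : ∀ l : Λ, ∀ o ∈ Set.range X, ({l} ×ˢ o.1 : Set (Λ × Sym2 (Zd d))).Finite :=
    fun l o ho => (Set.finite_singleton _).prod (hof o ho)
  -- few gates: compare with closing all of them
  have hfew := bern_explore_ge q hXf (S := fun _ => D) (T := fun o => {l₀} ×ˢ o.1)
    (fun _ _ => hDf) (hTf l₀) (fun o ho => by
      rw [Set.disjoint_left]
      rintro ⟨k, e⟩ (⟨_, h⟩ | ⟨h, _⟩) ⟨h', h''⟩
      · exact (hoS o ho h'').2 h
      · exact h02 (h'.symm.trans h))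
    (fun o _ => hXD o)
    (F := fun o => {ω | ∀ j ∈ ({l₀} ×ˢ o.1 : Set (Λ × Sym2 (Zd d))), ω j = false})
    (fun o _ => dep_all _ _) {o | o.1.ncard < M ∧ ¬ o.2} ((1 - (r : ℝ)) ^ M) (by
      intro o ho hM'
      rw [bern_all_closed q (r := r) (hTf l₀ o ho)]
      · refine pow_le_pow_of_le_one (by linarith) (by linarith [r.2.1]) ?_
        rw [Set.ncard_prod]
        simpa using hM'.1.le
      · rintro ⟨k, e⟩ ⟨h, _⟩
        have h : k = l₀ := h
        rw [h, hq0])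
  have hmany := bern_explore_le q hXf (S := fun _ => D) (T := fun o => {l₁} ×ˢ o.1)
    (fun _ _ => hDf) (hTf l₁) (fun o ho => by
      rw [Set.disjoint_left]
      rintro ⟨k, e⟩ (⟨h, _⟩ | ⟨h, _⟩) ⟨h', h''⟩
      · exact h01 (h.symm.trans h')
      · exact h12 (h'.symm.trans h))
    (fun o _ => hXD o)
    (F := fun o => {ω | ∀ j ∈ ({l₁} ×ˢ o.1 : Set (Λ × Sym2 (Zd d))), ω j = false})
    (fun o _ => dep_all _ _) {o | M ≤ o.1.ncard} ((1 - (δ : ℝ)) ^ M) (by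
      intro o ho hM'
      rw [bern_all_closed q (r := δ) (hTf l₁ o ho)]
      · refine pow_le_pow_of_le_one (by linarith [δ.2.2]) (by linarith) ?_
        rw [Set.ncard_prod]
        simpa using hM'
      · rintro ⟨k, e⟩ ⟨h, _⟩
        have h : k = l₁ := h
        rw [h, hq1])
  have hlm : MeasurableSet {ω : Λ × Sym2 (Zd d) → Bool |
      linked (lay ω l₀) (lay ω l₂) m n b i τ} :=
    (linked_dep l₀ l₂ m n b i τ).measurableSet
      (((Set.finite_singleton _).prod (edgesIn_finite (bx_finite _ _))).union
      ((Set.finite_singleton _).prod (edgesIn_finite (bx_finite _ _))))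
  have hfew' : (bern q).real {ω | X ω ∈ {o : Set (Sym2 (Zd d)) × Prop | o.1.ncard < M ∧ ¬ o.2}} ≤
      ε / 2 := by
    have hle : (bern q).real ({ω | X ω ∈ {o : Set (Sym2 (Zd d)) × Prop | o.1.ncard < M ∧ ¬ o.2}} ∩
        {ω | ω ∈ {ω' : Λ × Sym2 (Zd d) → Bool |
          ∀ j ∈ ({l₀} ×ˢ (X ω).1 : Set (Λ × Sym2 (Zd d))), ω' j = false}}) ≤
        (bern q).real {ω | linked (lay ω l₀) (lay ω l₂) m n b i τ}ᶜ := by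
      refine measureReal_mono ?_
      rintro ω ⟨⟨_, hno⟩, hcl⟩ ⟨u, hu, x, hx, hux, hsx⟩
      have hxR : x ∉ R := fun h => hno ⟨x, ⟨hx, hsx⟩, h⟩
      obtain ⟨y, hy, w, hw, h1, h2, h3, h4⟩ := hux.last_exit (hR hu) hxR
      have hyw := mk_mem_edgesIn.1 h2.2
      have h5 : s(y, w) ∈ W ω := by
        refine ⟨y, ⟨hy, hyw.1⟩, w, ⟨hyw.2, hw⟩, h1, rfl, x, ⟨hx, hsx⟩, h4.mono ?_⟩
        rintro e ⟨⟨he1, he2⟩, he3⟩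
        exact ⟨he1, fun z hz => ⟨he2 z hz, he3 z hz⟩⟩
      have h6 := hcl (l₀, s(y, w)) ⟨rfl, h5⟩
      have h7 : ω (l₀, s(y, w)) = true := h2.1
      rw [h6] at h7
      exact absurd h7 (by simp)
    have h8 := hfew.trans hle
    rw [probReal_compl_eq_one_sub hlm] at h8
    have h9 : η ≤ ε / 2 * (1 - (r : ℝ)) ^ M := by rw [hη]; exact min_le_right _ _
    refine le_of_mul_le_mul_left ?_ hrM
    linarith
  have hmany' : (bern q).real ({ω | X ω ∈ {o : Set (Sym2 (Zd d)) × Prop | M ≤ o.1.ncard}} ∩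
      {ω | ω ∈ {ω' : Λ × Sym2 (Zd d) → Bool |
          ∀ j ∈ ({l₁} ×ˢ (X ω).1 : Set (Λ × Sym2 (Zd d))), ω' j = false}}) ≤ ε / 2 := by
    refine hmany.trans ?_
    have : (bern q).real {ω | X ω ∈ {o : Set (Sym2 (Zd d)) × Prop | M ≤ o.1.ncard}} ≤ 1 :=
      measureReal_le_one
    nlinarith [measureReal_nonneg (μ := bern q)
      (s := {ω | X ω ∈ {o : Set (Sym2 (Zd d)) × Prop | M ≤ o.1.ncard}}),
      pow_nonneg (show (0 : ℝ) ≤ 1 - δ by linarith [δ.2.2]) M]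
  have hcov : (Set.univ : Set (Λ × Sym2 (Zd d) → Bool)) ⊆
      {ω | ∃ x ∈ seeded (lay ω l₂) m n b i τ, x ∈ R ∪ grow (lay ω l₀) (lay ω l₁) R S} ∪
      ({ω | X ω ∈ {o : Set (Sym2 (Zd d)) × Prop | o.1.ncard < M ∧ ¬ o.2}} ∪
      ({ω | X ω ∈ {o : Set (Sym2 (Zd d)) × Prop | M ≤ o.1.ncard}} ∩
      {ω | ω ∈ {ω' : Λ × Sym2 (Zd d) → Bool |
          ∀ j ∈ ({l₁} ×ˢ (X ω).1 : Set (Λ × Sym2 (Zd d))), ω' j = false}})) := by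
    intro ω _
    by_contra hc
    simp only [Set.mem_union, not_or] at hc
    obtain ⟨hc1, hc2, hc3⟩ := hc
    have hR' : ¬ ∃ x ∈ Z ω, x ∈ R := fun ⟨x, hx, hxR⟩ => hc1 ⟨x, hx, .inl hxR⟩
    have hMW : M ≤ (W ω).ncard := by
      by_contra hlt
      exact hc2 ⟨not_le.1 hlt, hR'⟩
    refine hc3 ⟨hMW, ?_⟩
    rintro ⟨k, e⟩ ⟨hk, he⟩
    obtain rfl : k = l₁ := hk
    by_contra hne
    obtain ⟨u, hu, w, hw, h1, rfl, x, hx, h2⟩ := he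
    exact hc1 ⟨x, hx, .inr ⟨u, hu, w, hw, h1, Bool.eq_true_of_not_eq_false hne, h2⟩⟩
  have h10 := (measureReal_mono (μ := bern q) hcov).trans
    ((measureReal_union_le _ _).trans (add_le_add_right (measureReal_union_le _ _) _))
  rw [probReal_univ] at h10
  linarith

end Growth

section Renormalisation
variable {d : ℕ}

/-- The layers: `none` is the base layer, `some (false, c)` the sprinkling and `some (true, c)` the
seeds used by the blocks of colour `c`. -/
abbrev Layer (d : ℕ) := Option (Bool × (Fin d → ZMod 9))

/-- The colour of a block. -/
def colour (z : Zd d) : Fin d → ZMod 9 := fun i => (z i : ZMod 9)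

/-- The centre of the block `z` at scale `n`. -/
def blk (n : ℤ) (z : Zd d) : Zd d := fun i => n * z i

lemma blk_disjoint {n : ℤ} (hn : 0 < n) {z z' : Zd d} (hc : colour z = colour z') (h : z ≠ z') :
    Disjoint (bx (blk n z) (4 * n)) (bx (blk n z') (4 * n)) := by
  rw [Set.disjoint_left]
  intro x hx hx'
  apply h
  ext i
  have h1 := (ZMod.intCast_eq_intCast_iff_dvd_sub _ _ _).1 (congrFun hc i)
  have h2 := hx i
  have h3 := hx' i
  simp only [blk] at h2 h3
  have : |z' i - z i| < 9 := by
    rw [abs_lt]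
    constructor <;> nlinarith
  have := Int.eq_zero_of_abs_lt_dvd h1 (by exact_mod_cast this)
  linarith

lemma exists_facet_subset {n : ℤ} {z z' b : Zd d} (h : latAdj z z') (hb : b ∈ bx (blk n z) n) :
    ∃ (i : Fin d) (τ : Fin d → Bool), facet b n i τ ⊆ bx (blk n z') n := by
  classical
  obtain ⟨i, σ, hσ, rfl⟩ := latAdj_iff.1 h
  refine ⟨i, fun j => if j = i then decide (σ = 1) else decide (b j ≤ n * z j), ?_⟩
  rintro x ⟨h1, h2⟩ j
  have hbj := hb j
  have h2 := h2 j
  simp only [blk] at hbj ⊢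
  by_cases hj : j = i
  · subst hj
    rcases hσ with rfl | rfl
    · simp [sg] at h1 ⊢
      constructor <;> linarith
    · simp [sg] at h1 ⊢
      constructor <;> linarith
  · simp only [hj, if_false] at h2
    rw [Function.update_of_ne hj]
    by_cases hle : b j ≤ n * z j
    · simp [sg, hle] at h2
      constructor <;> linarith
    · simp [sg, hle] at h2
      constructor <;> linarith

lemma bx_blk_subset {n m : ℤ} (hmn : m ≤ n) (hn : 0 ≤ n) {z z' b : Zd d} (h : latAdj z z')
    (hb : b ∈ bx (blk n z) n) : bx b (n + m) ⊆ bx (blk n z') (4 * n) := by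
  refine bx_subset fun i => ?_
  have h1 := hb i
  have h2 := h.bound i
  simp only [blk] at h1 ⊢
  constructor <;> nlinarith

/-- The open edges still available when the blocks in `U` are untested and `R` is explored. -/
def avail (n : ℤ) (R U : Set (Zd d)) (ω : Layer d × Sym2 (Zd d) → Bool) : Set (Sym2 (Zd d)) :=
  {e | ∃ z ∈ U, e ∈ edgesIn (bx (blk n z) (4 * n)) ∧
    ((e ∈ lay ω none ∧ e ∈ edgesIn Rᶜ) ∨ ∃ k, e ∈ lay ω (some (k, colour z)))}

lemma avail_mono {n : ℤ} {R R' U U' : Set (Zd d)} (hR : R ⊆ R') (hU : U' ⊆ U)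
    (ω : Layer d × Sym2 (Zd d) → Bool) : avail n R' U' ω ⊆ avail n R U ω := by
  rintro e ⟨z, hz, h1, h2⟩
  refine ⟨z, hU hz, h1, h2.imp_left fun h => ⟨h.1, edgesIn_mono (Set.compl_subset_compl.2 hR) h.2⟩⟩

/-- The coordinates that determine `avail n R U`. -/
def availCoords (n : ℤ) (R U : Set (Zd d)) : Set (Layer d × Sym2 (Zd d)) :=
  {j | ∃ z ∈ U, j.2 ∈ edgesIn (bx (blk n z) (4 * n)) ∧
    ((j.1 = none ∧ j.2 ∈ edgesIn Rᶜ) ∨ ∃ k, j.1 = some (k, colour z))}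

lemma avail_congr {n : ℤ} {R U : Set (Zd d)} {ω ω' : Layer d × Sym2 (Zd d) → Bool}
    (h : ∀ j ∈ availCoords n R U, ω j = ω' j) : avail n R U ω = avail n R U ω' := by
  ext e
  refine exists_congr fun z => and_congr_right fun hz => and_congr_right fun he => ?_
  refine or_congr (and_congr_left fun hR => ?_) (exists_congr fun k => ?_)
  · simp only [lay, op, Set.mem_ofPred_eq, h (none, e) ⟨z, hz, he, .inl ⟨rfl, hR⟩⟩]
  · simp only [lay, op, Set.mem_ofPred_eq,
      h (some (k, colour z), e) ⟨z, hz, he, .inr ⟨k, rfl⟩⟩]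

lemma availCoords_finite (n : ℤ) (R : Set (Zd d)) (U : Finset (Zd d)) :
    (availCoords n R U).Finite := by
  have : (⋃ z ∈ U, (Set.univ : Set (Layer d)) ×ˢ edgesIn (bx (blk n z) (4 * n))).Finite :=
    U.finite_toSet.biUnion fun z _ => Set.finite_univ.prod (edgesIn_finite (bx_finite _ _))
  refine this.subset ?_
  rintro ⟨k, e⟩ ⟨z, hz, h, _⟩
  exact Set.mem_biUnion hz ⟨trivial, h⟩

/-- Some explored point is joined to the block `b`. -/
def joined (n : ℤ) (b : Zd d) (R U : Set (Zd d)) : Set (Layer d × Sym2 (Zd d) → Bool) :=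
  {ω | ∃ u ∈ R, ∃ x ∈ bx (blk n b) n, con (avail n R U ω) u x}

lemma joined_dep (n : ℤ) (b : Zd d) (R U : Set (Zd d)) :
    Dep (availCoords n R U) (joined n b R U) :=
  Dep.of_iff fun ω ω' h => by simp only [joined, Set.mem_ofPred_eq, avail_congr h]

/-- The coordinates revealed when the growth from `R` inside `S` is found to be `o`. -/
def growCoords (c : Fin d → ZMod 9) (R S B o : Set (Zd d)) : Set (Layer d × Sym2 (Zd d)) :=
  {j | (j.1 = none ∧ j.2 ∈ edgesIn (S \ R) ∧ ∃ x ∈ j.2, x ∈ o) ∨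
    ∃ k, j.1 = some (k, c) ∧ j.2 ∈ edgesIn B}

lemma grow_dep (c : Fin d → ZMod 9) (R S B : Set (Zd d)) (hSB : S ⊆ B) (o : Set (Zd d)) :
    Dep (growCoords c R S B o) {ω : Layer d × Sym2 (Zd d) → Bool |
      grow (lay ω none) (lay ω (some (false, c))) R S = o} := by
  rintro ω ω' h rfl
  have h0 : ∀ e ∈ edgesIn (S \ R), ∀ x ∈ e, x ∈ grow (lay ω none) (lay ω (some (false, c))) R S →
      (e ∈ lay ω none ↔ e ∈ lay ω' none) := by
    intro e he x hx hxo
    simp only [lay, op, Set.mem_ofPred_eq, h (none, e) (.inl ⟨rfl, he, x, hx, hxo⟩)]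
  have h1 : ∀ u ∈ R ∩ S, ∀ w ∈ S \ R,
      (s(u, w) ∈ lay ω (some (false, c)) ↔ s(u, w) ∈ lay ω' (some (false, c))) := by
    intro u hu w hw
    simp only [lay, op, Set.mem_ofPred_eq,
      h (some (false, c), s(u, w)) (.inr ⟨_, rfl, mk_mem_edgesIn.2 ⟨hSB hu.2, hSB hw.1⟩⟩)]
  apply Set.Subset.antisymm
  · rintro v ⟨u, hu, w, hw, huw, ho, hc⟩
    have hw' : w ∈ grow (lay ω none) (lay ω (some (false, c))) R S :=
      ⟨u, hu, w, hw, huw, (h1 u hu w hw).2 ho, .refl⟩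
    refine hc.closed ?_ hw'
    rintro a b hab ⟨hab1, hab2⟩ ⟨u, hu, w, hw, huw, ho, hc⟩
    refine ⟨u, hu, w, hw, huw, ho, hc.tail hab ⟨?_, hab2⟩⟩
    exact (h0 _ hab2 a (by simp) ⟨u, hu, w, hw, huw, ho, hc⟩).2 hab1
  · rintro v ⟨u, hu, w, hw, huw, ho, hc⟩
    refine ⟨u, hu, w, hw, huw, (h1 u hu w hw).1 ho, ?_⟩
    have key : ∀ y, con (lay ω none ∩ edgesIn (S \ R)) w y →
        con (lay ω' none ∩ edgesIn (S \ R)) w y := by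
      intro y hy
      induction hy with
      | refl => exact .refl
      | tail hy h ih =>
        refine ih.tail h.1 ⟨?_, h.2.2⟩
        exact (h0 _ h.2.2 _ (by simp) ⟨u, hu, w, hw, huw, ho, hy⟩).1 h.2.1
    exact key v hc

end Renormalisation

section Site
variable {d : ℕ}

/-- `b` can be reached from `A` through the sites of `A ∪ V`. -/
def reach (A V : Set (Zd d)) (b : Zd d) : Prop := ∃ a ∈ A, con (edgesIn (A ∪ V)) a b

lemma reach_mono {A A' V V' : Set (Zd d)} (hA : A ⊆ A') (hV : A ∪ V ⊆ A' ∪ V') {b : Zd d}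
    (h : reach A V b) : reach A' V' b := by
  obtain ⟨a, ha, h⟩ := h
  exact ⟨a, hA ha, h.mono (edgesIn_mono hV)⟩

lemma reach_dep (A : Set (Zd d)) (U : Finset (Zd d)) (b : Zd d) :
    Dep (U : Set (Zd d)) {ξ : Zd d → Bool | reach A {z | z ∈ U ∧ ξ z = true} b} := by
  refine Dep.of_iff fun ξ ξ' h => ?_
  have : {z | z ∈ U ∧ ξ z = true} = {z | z ∈ U ∧ ξ' z = true} := by
    ext z
    refine and_congr_right fun hz => ?_
    rw [h z hz]
  simp only [Set.mem_ofPred_eq, this]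

lemma bern_single {I : Type*} (q : I → unitInterval) (i : I) :
    (bern q).real {ω | ω i = true} = q i := by
  have := bern_cyl_real q {i} (fun _ => true)
  simpa using this

lemma bern_single_false {I : Type*} (q : I → unitInterval) (i : I) :
    (bern q).real {ω | ω i = false} = 1 - q i := by
  have := bern_cyl_real q {i} (fun _ => false)
  simpa using this

open Classical in
lemma reach_rec (ρ : unitInterval) (A : Set (Zd d)) (U : Finset (Zd d)) (b : Zd d) {z : Zd d}
    (hz : z ∈ U) :
    (bern fun _ : Zd d => ρ).real {ξ | reach A {z | z ∈ U ∧ ξ z = true} b} ≤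
      ρ * (bern fun _ : Zd d => ρ).real
        {ξ | reach (insert z A) {y | y ∈ U.erase z ∧ ξ y = true} b} +
      (1 - ρ) * (bern fun _ : Zd d => ρ).real {ξ | reach A {y | y ∈ U.erase z ∧ ξ y = true} b} := by
  have hf : ({z} : Set (Zd d)).Finite := Set.finite_singleton z
  have hdis : Disjoint ({z} : Set (Zd d)) (U.erase z : Set (Zd d)) := by simp
  have hd : ∀ c : Bool, Dep ({z} : Set (Zd d)) {ξ : Zd d → Bool | ξ z = c} :=
    fun c ξ ξ' h hξ => by rw [Set.mem_ofPred_eq, ← h z rfl]; exact hξ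
  have h1 := bern_indep (fun _ : Zd d => ρ) hf (U.erase z).finite_toSet hdis (hd true)
    (reach_dep (insert z A) (U.erase z) b)
  have h2 := bern_indep (fun _ : Zd d => ρ) hf (U.erase z).finite_toSet hdis (hd false)
    (reach_dep A (U.erase z) b)
  rw [bern_single] at h1
  rw [bern_single_false] at h2
  rw [← h1, ← h2]
  refine le_trans (measureReal_mono ?_) (measureReal_union_le _ _)
  intro ξ hξ
  cases hc : ξ z with
  | true =>
    refine .inl ⟨hc, reach_mono (Set.subset_insert _ _) ?_ hξ⟩
    rintro y (hy | ⟨hy, hy'⟩)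
    · exact .inl (.inr hy)
    · by_cases hyz : y = z
      · exact .inl (.inl hyz)
      · exact .inr ⟨Finset.mem_erase.2 ⟨hyz, hy⟩, hy'⟩
  | false =>
    refine .inr ⟨hc, reach_mono subset_rfl ?_ hξ⟩
    rintro y (hy | ⟨hy, hy'⟩)
    · exact .inl hy
    · refine .inr ⟨Finset.mem_erase.2 ⟨?_, hy⟩, hy'⟩
      rintro rfl
      rw [hc] at hy'
      exact absurd hy' (by simp)

/-- If no site of `U` is adjacent to `A`, then nothing new can be reached. -/
lemma reach_stuck {A V : Set (Zd d)} {b : Zd d} (h : ∀ a ∈ A, ∀ z ∈ V, ¬ latAdj a z)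
    (hr : reach A V b) : b ∈ A := by
  obtain ⟨a, ha, hr⟩ := hr
  refine hr.closed ?_ ha
  intro x y hxy hm hx
  exact (mk_mem_edgesIn.1 hm).2.resolve_right fun hy => h x hx y hy hxy

end Site

section Exploration
variable {d : ℕ}

/-- Grown points are joined to the old region by available edges. -/
lemma grow_joined {n : ℤ} {R S U : Set (Zd d)} {z : Zd d}
    {ω : Layer d × Sym2 (Zd d) → Bool} (hz : z ∈ U) (hS : S ⊆ bx (blk n z) (4 * n))
    {v : Zd d} (hv : v ∈ R ∪ grow (lay ω none) (lay ω (some (false, colour z))) R S) :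
    ∃ u ∈ R, con (avail n R U ω) u v := by
  rcases hv with hv | ⟨u, hu, w, hw, huw, ho, hc⟩
  · exact ⟨v, hv, .refl⟩
  · refine ⟨u, hu.1, .head huw ?_ (hc.mono ?_)⟩
    · exact ⟨z, hz, mk_mem_edgesIn.2 ⟨hS hu.2, hS hw.1⟩, .inr ⟨_, ho⟩⟩
    · rintro e ⟨he1, he2⟩
      exact ⟨z, hz, fun y hy => hS (he2 y hy).1, .inl ⟨he1, fun y hy => (he2 y hy).2⟩⟩

/-- Points added to the explored region are joined to the old region by available edges. -/
lemma new_joined {n : ℤ} {m : ℤ} {R S U : Set (Zd d)} {z x : Zd d}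
    {ω : Layer d × Sym2 (Zd d) → Bool} (hz : z ∈ U) (hS : S ⊆ bx (blk n z) (4 * n))
    (hx : x ∈ R ∪ grow (lay ω none) (lay ω (some (false, colour z))) R S)
    (hxm : bx x m ⊆ bx (blk n z) (4 * n)) (hs : edgesIn (bx x m) ⊆ lay ω (some (true, colour z)))
    {v : Zd d}
    (hv : v ∈ R ∪ grow (lay ω none) (lay ω (some (false, colour z))) R S ∪ bx x m) :
    ∃ u ∈ R, con (avail n R U ω) u v := by
  rcases hv with hv | hv
  · exact grow_joined hz hS hv
  · obtain ⟨u, hu, h⟩ := grow_joined hz hS hx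
    refine ⟨u, hu, h.trans (bx_con ?_ hv)⟩
    intro a c _ ha hc
    have : s(a, c) ∈ edgesIn (bx x m) := mk_mem_edgesIn.2 ⟨ha, hc⟩
    exact ⟨z, hz, edgesIn_mono hxm this, .inr ⟨_, hs this⟩⟩

lemma joined_of_new {n : ℤ} {b : Zd d} {R R' U U' : Set (Zd d)}
    {ω : Layer d × Sym2 (Zd d) → Bool} (hR : R ⊆ R') (hU : U' ⊆ U)
    (h : ∀ v ∈ R', ∃ u ∈ R, con (avail n R U ω) u v) (hω : ω ∈ joined n b R' U') :
    ω ∈ joined n b R U := by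
  obtain ⟨v, hv, x, hx, hvx⟩ := hω
  obtain ⟨u, hu, huv⟩ := h v hv
  exact ⟨u, hu, x, hx, huv.trans (hvx.mono (avail_mono hR hU ω))⟩

end Exploration

section Exploration
variable {d : ℕ}

lemma growCoords_finite (c : Fin d → ZMod 9) {R S B o : Set (Zd d)} (hS : S.Finite)
    (hB : B.Finite) : (growCoords c R S B o).Finite := by
  refine ((Set.finite_univ (α := Layer d)).prod
    ((edgesIn_finite hS).union (edgesIn_finite hB))).subset ?_
  rintro ⟨k, e⟩ (⟨_, h, _⟩ | ⟨_, _, h⟩)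
  · exact ⟨trivial, .inl (edgesIn_mono Set.sdiff_subset h)⟩
  · exact ⟨trivial, .inr h⟩

lemma growCoords_disjoint {n : ℤ} (hn : 0 < n) {z : Zd d} {R S B o R' U' : Set (Zd d)}
    (hB : B ⊆ bx (blk n z) (4 * n)) (hz : z ∉ U') (ho : o ⊆ R') :
    Disjoint (growCoords (colour z) R S B o) (availCoords n R' U') := by
  rw [Set.disjoint_left]
  rintro ⟨k, e⟩ (⟨hk, h, x, hx, hxo⟩ | ⟨k', hk, he⟩) ⟨z', hz', he', ⟨hk2, h2⟩ | ⟨k2, hk2⟩⟩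
  · exact h2 x hx (ho hxo)
  · simp only at hk hk2
    rw [hk] at hk2; cases hk2
  · simp only at hk hk2
    rw [hk] at hk2; cases hk2
  · simp only at hk hk2
    rw [hk] at hk2
    simp only [Option.some.injEq, Prod.mk.injEq] at hk2
    have hne : z ≠ z' := fun h => hz (h ▸ hz')
    exact Set.disjoint_left.1 (edgesIn_disjoint (blk_disjoint hn hk2.2 hne))
      (edgesIn_mono hB he) he'

open Classical in
theorem joined_ge {m n : ℕ} (hmn : m ≤ n) (hn : 1 ≤ n)
    {q : Layer d × Sym2 (Zd d) → unitInterval} {ρ : unitInterval}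
    (hstep : ∀ (c : Fin d → ZMod 9) (b : Zd d) (i : Fin d) (τ : Fin d → Bool) (R : Set (Zd d)),
      bx b m ⊆ R → (ρ : ℝ) ≤ (bern q).real {ω | ∃ x ∈ seeded (lay ω (some (true, c))) m n b i τ,
        x ∈ R ∪ grow (lay ω none) (lay ω (some (false, c))) R (bx b n)})
    (b : Zd d) (U : Finset (Zd d)) :
    ∀ (A : Set (Zd d)) (s : Zd d → Zd d) (R : Set (Zd d)),
      (∀ z ∈ A, s z ∈ bx (blk n z) n ∧ bx (s z) m ⊆ R) →
      (bern fun _ : Zd d => ρ).real {ξ | reach A {z | z ∈ U ∧ ξ z = true} b} ≤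
        (bern q).real (joined n b R U) := by
  have hm0 : (m : ℤ) ≤ n := by exact_mod_cast hmn
  have hn0 : (0 : ℤ) < n := by exact_mod_cast hn
  induction U using Finset.strongInduction with
  | H U ih =>
  intro A s R hA
  by_cases hbA : b ∈ A
  · have : joined n b R U = Set.univ := by
      ext ω
      simp only [Set.mem_univ, iff_true]
      exact ⟨s b, (hA b hbA).2 (self_mem_bx _ (by positivity)), s b, (hA b hbA).1, .refl⟩
    rw [this, probReal_univ]
    exact measureReal_le_one
  by_cases hex : ∃ a ∈ A, ∃ z ∈ U, latAdj a z
  swap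
  · have : {ξ : Zd d → Bool | reach A {z | z ∈ U ∧ ξ z = true} b} = ∅ := by
      ext ξ
      simp only [Set.mem_ofPred_eq, Set.mem_empty_iff_false, iff_false]
      exact fun hr => hbA (reach_stuck (fun a ha z hz hadj => hex ⟨a, ha, z, hz.1, hadj⟩) hr)
    rw [this, measureReal_empty]
    exact measureReal_nonneg
  obtain ⟨a, ha, z, hz, haz⟩ := hex
  obtain ⟨hsa, hsR⟩ := hA a ha
  obtain ⟨i, τ, hfac⟩ := exists_facet_subset haz hsa
  set c := colour z with hc
  set S := bx (s a) n with hS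
  set B := bx (s a) (n + m) with hB
  have hSB : S ⊆ B := bx_mono _ (by omega)
  have hBz : B ⊆ bx (blk n z) (4 * n) := bx_blk_subset hm0 hn0.le haz hsa
  have hSf : S.Finite := bx_finite _ _
  have hff : (facet (s a) n i τ).Finite := (sph_finite _ _).subset (facet_subset_sph _ _ _ _)
  let Xg : (Layer d × Sym2 (Zd d) → Bool) → Set (Zd d) :=
    fun ω => grow (lay ω none) (lay ω (some (false, c))) R S
  let Xs : (Layer d × Sym2 (Zd d) → Bool) → Set (Zd d) :=
    fun ω => seeded (lay ω (some (true, c))) m n (s a) i τ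
  let X : (Layer d × Sym2 (Zd d) → Bool) → Set (Zd d) × Set (Zd d) := fun ω => (Xg ω, Xs ω)
  have hXfin : (Set.range X).Finite := by
    refine (hSf.finite_subsets.prod hff.finite_subsets).subset ?_
    rintro _ ⟨ω, rfl⟩
    exact ⟨(grow_subset _ _ _ _).trans Set.sdiff_subset, fun x hx => hx.1⟩
  have hXD : ∀ o : Set (Zd d) × Set (Zd d), Dep (growCoords c R S B o.1) {ω | X ω = o} := by
    intro o
    have e : {ω | X ω = o} = {ω | Xg ω = o.1} ∩ {ω | Xs ω = o.2} := by
      ext ω; simp [X, Prod.ext_iff]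
    rw [e]
    refine (grow_dep c R S B hSB o.1).inter (Dep.of_iff fun ω ω' h => ?_)
    have : Xs ω = Xs ω' := by
      ext x
      refine and_congr_right fun hx => subset_lay_congr fun e he => h _ (.inr ⟨true, rfl, ?_⟩)
      exact edgesIn_mono (bx_subset_of_mem (facet_subset_sph _ n i τ hx).1) he
    simp only [Set.mem_ofPred_eq, this]
  let G : Set (Set (Zd d) × Set (Zd d)) := {o | ∃ x ∈ o.2, x ∈ R ∪ o.1}
  let R' : Set (Zd d) × Set (Zd d) → Set (Zd d) := fun o =>
    if h : ∃ x ∈ o.2, x ∈ R ∪ o.1 then R ∪ o.1 ∪ bx h.choose m else R ∪ o.1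
  have hR' : ∀ o, R ∪ o.1 ⊆ R' o := by
    intro o
    simp only [R']
    split_ifs
    · exact Set.subset_union_left
    · exact subset_rfl
  let F : Set (Zd d) × Set (Zd d) → Set (Layer d × Sym2 (Zd d) → Bool) := fun o =>
    joined n b (R' o) (U.erase z)
  have hsub : {ω | ω ∈ F (X ω)} ⊆ joined n b R U := by
    intro ω hω
    refine joined_of_new (Set.subset_union_left.trans (hR' (X ω)))
      (by exact_mod_cast Finset.erase_subset z U) ?_ hω
    intro v hv
    simp only [R'] at hv
    split_ifs at hv with h
    · obtain ⟨h1, h2⟩ := h.choose_spec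
      refine new_joined (S := S) (by exact_mod_cast hz) (hSB.trans hBz) h2 ?_ h1.2 hv
      exact (bx_subset_of_mem (facet_subset_sph _ n i τ h1.1).1).trans hBz
    · exact grow_joined (S := S) (by exact_mod_cast hz) (hSB.trans hBz) hv
  have hDf : ∀ o, (growCoords c R S B o).Finite := fun o =>
    growCoords_finite c hSf (bx_finite _ _)
  have hdisj : ∀ o : Set (Zd d) × Set (Zd d), Disjoint (growCoords c R S B o.1)
      (availCoords n (R' o) ((U.erase z : Finset (Zd d)) : Set (Zd d))) := fun o =>
    growCoords_disjoint hn0 hBz (by simp) (Set.subset_union_right.trans (hR' o))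
  set f1 := (bern fun _ : Zd d => ρ).real
    {ξ | reach (insert z A) {y | y ∈ U.erase z ∧ ξ y = true} b} with hf1
  set f0 := (bern fun _ : Zd d => ρ).real {ξ | reach A {y | y ∈ U.erase z ∧ ξ y = true} b}
    with hf0
  have hf01 : f0 ≤ f1 := measureReal_mono fun ξ hξ =>
    reach_mono (Set.subset_insert _ _) (Set.union_subset_union_left _ (Set.subset_insert _ _)) hξ
  have hsucc := bern_explore_ge q hXfin (S := fun o => growCoords c R S B o.1)
    (T := fun o => availCoords n (R' o) ((U.erase z : Finset (Zd d)) : Set (Zd d)))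
    (fun o _ => hDf _) (fun o _ => availCoords_finite _ _ _) (fun o _ => hdisj o)
    (fun o _ => hXD o) (F := F) (fun o _ => joined_dep _ _ _ _) G f1 (by
      intro o ho hoG
      obtain ⟨ω, rfl⟩ := ho
      have hoG : ∃ x ∈ (X ω).2, x ∈ R ∪ (X ω).1 := hoG
      have hR'e : R' (X ω) = R ∪ (X ω).1 ∪ bx hoG.choose m := by simp only [R', dif_pos hoG]
      refine ih (U.erase z) (Finset.erase_ssubset hz) (insert z A)
        (Function.update s z hoG.choose) (R' (X ω)) ?_
      intro y hy
      by_cases hyz : y = z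
      · subst hyz
        rw [Function.update_self]
        refine ⟨hfac hoG.choose_spec.1.1, ?_⟩
        rw [hR'e]
        exact Set.subset_union_right
      · rw [Function.update_of_ne hyz]
        have := hA y (hy.resolve_left hyz)
        exact ⟨this.1, this.2.trans (Set.subset_union_left.trans (hR' _))⟩)
  have hfail := bern_explore_ge q hXfin (S := fun o => growCoords c R S B o.1)
    (T := fun o => availCoords n (R' o) ((U.erase z : Finset (Zd d)) : Set (Zd d)))
    (fun o _ => hDf _) (fun o _ => availCoords_finite _ _ _) (fun o _ => hdisj o)
    (fun o _ => hXD o) (F := F) (fun o _ => joined_dep _ _ _ _) Gᶜ f0 (by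
      intro o ho hoG
      refine ih (U.erase z) (Finset.erase_ssubset hz) A s (R' o) ?_
      intro y hy
      have := hA y hy
      exact ⟨this.1, this.2.trans (Set.subset_union_left.trans (hR' _))⟩)
  have hGm : MeasurableSet {ω | X ω ∈ G} := by
    have : {ω | X ω ∈ G} = ⋃ o ∈ Set.range X ∩ G, {ω | X ω = o} := by
      ext ω
      simp
    rw [this]
    exact (hXfin.inter_of_left G).measurableSet_biUnion fun o _ => (hXD o).measurableSet (hDf _)
  have hGp : (ρ : ℝ) ≤ (bern q).real {ω | X ω ∈ G} := hstep c (s a) i τ R hsR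
  have htot := measureReal_inter_add_sdiff (μ := bern q) (s := joined n b R U) hGm
  have h1 : (bern q).real ({ω | X ω ∈ G} ∩ {ω | ω ∈ F (X ω)}) ≤
      (bern q).real (joined n b R U ∩ {ω | X ω ∈ G}) :=
    measureReal_mono fun ω hω => ⟨hsub hω.2, hω.1⟩
  have h2 : (bern q).real ({ω | X ω ∈ Gᶜ} ∩ {ω | ω ∈ F (X ω)}) ≤
      (bern q).real (joined n b R U \ {ω | X ω ∈ G}) :=
    measureReal_mono fun ω hω => ⟨hsub hω.2, hω.1⟩
  have h3 : (bern q).real {ω | X ω ∈ Gᶜ} = 1 - (bern q).real {ω | X ω ∈ G} :=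
    probReal_compl_eq_one_sub hGm
  rw [h3] at hfail
  have hrec := reach_rec ρ A U b hz
  rw [← hf1, ← hf0] at hrec
  nlinarith

end Exploration

section Superpose
variable {d : ℕ}

lemma IsBernoulli.eq_bern {p : unitInterval} {Q : Measure (Config d)} (hQ : IsBernoulli p Q) :
    Q = bern fun _ => p := by
  have := hQ.1
  exact bern_unique _ Q hQ.2

lemma bern_infinite_ne_zero {p : unitInterval} (hp : pc d < p) :
    bern (fun _ : Sym2 (Zd d) => p) {ω | (cluster ω).Infinite} ≠ 0 := by
  intro h0
  refine not_le.2 hp (le_csSup ⟨1, fun x hx => hx.2.1⟩ ⟨p.2.1, p.2.2, fun Q hQ => ?_⟩)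
  rw [hQ.eq_bern, h0]

/-- The superposition of all layers. -/
noncomputable def superpose {Λ : Type} [Fintype Λ] (ω : Λ × Sym2 (Zd d) → Bool) : Config d :=
  open Classical in fun e => decide (∃ l, ω (l, e) = true)

lemma lay_subset_superpose {Λ : Type} [Fintype Λ] (ω : Λ × Sym2 (Zd d) → Bool) (l : Λ) :
    lay ω l ⊆ op (superpose ω) := by
  intro e he
  simpa [op, superpose] using ⟨l, he⟩

lemma dep_superpose {Λ : Type} [Fintype Λ] (s : Set (Sym2 (Zd d))) (f : Config d) :
    Dep (Set.univ ×ˢ s) {ω : Λ × Sym2 (Zd d) → Bool | ∀ e ∈ s, superpose ω e = f e} := by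
  intro ω ω' h hω e he
  rw [← hω e he]
  simp only [superpose]
  congr 1
  simp only [eq_iff_iff]
  exact exists_congr fun l => by rw [h (l, e) ⟨trivial, he⟩]

open Classical in
lemma bern_superpose {Λ : Type} [Fintype Λ] {q : Λ × Sym2 (Zd d) → unitInterval}
    {p : unitInterval} (hp : ∀ e, ∏ l, (1 - (q (l, e) : ℝ)) = 1 - p) :
    (bern q).map superpose = bern fun _ => p := by
  have hm : Measurable (superpose : (Λ × Sym2 (Zd d) → Bool) → Config d) := by
    refine measurable_pi_lambda _ fun e => measurable_to_bool ?_
    refine Dep.measurableSet (S := Set.univ ×ˢ {e}) ?_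
      (Set.finite_univ.prod (Set.finite_singleton e))
    refine (dep_superpose {e} fun _ => true).congr_left ?_
    ext ω
    simp
  have hf : ∀ e, (bern q).real {ω | superpose ω e = false} = 1 - p := by
    intro e
    have := bern_cyl_real q (Finset.univ.image fun l : Λ => (l, e)) (fun _ => false)
    rw [Finset.prod_image (fun a _ b _ h => by simpa using h)] at this
    simp only [Bool.false_eq_true, if_false, hp] at this
    rw [← this]
    congr 1
    ext ω
    simp [superpose]
  have ht : ∀ e b, (bern q).real {ω | superpose ω e = b} = if b then (p : ℝ) else 1 - p := by
    intro e b
    cases b with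
    | false => simpa using hf e
    | true =>
      have hms : MeasurableSet {ω : Λ × Sym2 (Zd d) → Bool | superpose ω e = false} :=
        (measurable_pi_apply e).comp hm (measurableSet_singleton false)
      have h2 := probReal_compl_eq_one_sub (μ := bern q) hms
      rw [hf] at h2
      have h3 : {ω : Λ × Sym2 (Zd d) → Bool | superpose ω e = false}ᶜ =
          {ω | superpose ω e = true} := by
        ext ω
        simp
      rw [← h3, h2]
      simp
  have := Measure.isProbabilityMeasure_map (μ := bern q) hm.aemeasurable
  refine bern_unique _ _ fun s f => ?_
  have hs : MeasurableSet {ω : Config d | ∀ e ∈ s, ω e = f e} := by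
    refine Dep.measurableSet (S := (s : Set (Sym2 (Zd d)))) ?_ s.finite_toSet
    intro ω ω' h hω e he
    rw [← h e he, hω e he]
  rw [Measure.map_apply hm hs]
  have key : (bern q).real {ω | ∀ e ∈ s, superpose ω e = f e} =
      ∏ e ∈ s, if f e then (p : ℝ) else 1 - p := by
    clear hs
    induction s using Finset.induction_on with
    | empty => simp
    | insert a s ha ih =>
      rw [Finset.prod_insert ha, ← ih, ← ht a (f a), ← bern_indep q
        (S := Set.univ ×ˢ {a}) (T := Set.univ ×ˢ (s : Set (Sym2 (Zd d))))
        (Set.finite_univ.prod (Set.finite_singleton a)) (Set.finite_univ.prod s.finite_toSet)]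
      · congr 1
        ext ω
        simp
      · rw [Set.disjoint_left]
        rintro ⟨l, e⟩ h1 h2
        simp only [Set.mem_prod, Set.mem_univ, true_and, Set.mem_singleton_iff,
          SetLike.mem_coe] at h1 h2
        exact ha (h1 ▸ h2)
      · refine (dep_superpose {a} f).congr_left ?_
        ext ω
        simp
      · exact dep_superpose (s : Set (Sym2 (Zd d))) f
  have h2 : (bern q) (superpose ⁻¹' {ω : Config d | ∀ e ∈ s, ω e = f e}) =
      ENNReal.ofReal (∏ e ∈ s, if f e then (p : ℝ) else 1 - p) := by
    rw [← key, ofReal_measureReal]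
    rfl
  rw [h2, ENNReal.ofReal_prod_of_nonneg]
  · refine Finset.prod_congr rfl fun e _ => ?_
    split_ifs <;> rfl
  · intro e _
    have h1 := p.2.1
    have h2 := p.2.2
    split_ifs <;> linarith

/-- The edges of the boxes of the blocks in `U`. -/
def blockEdges (n : ℤ) (U : Set (Zd d)) : Set (Sym2 (Zd d)) :=
  {e | ∃ z ∈ U, e ∈ edgesIn (bx (blk n z) (4 * n))}

lemma blockEdges_finite (n : ℤ) (U : Finset (Zd d)) :
    (blockEdges n (U : Set (Zd d))).Finite := by
  have : (⋃ z ∈ U, edgesIn (bx (blk n z) (4 * n))).Finite :=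
    U.finite_toSet.biUnion fun z _ => edgesIn_finite (bx_finite _ _)
  refine this.subset ?_
  rintro e ⟨z, hz, h⟩
  exact Set.mem_biUnion hz h

lemma avail_subset (n : ℤ) (R U : Set (Zd d)) (ω : Layer d × Sym2 (Zd d) → Bool) :
    avail n R U ω ⊆ op (superpose ω) ∩ blockEdges n U := by
  rintro e ⟨z, hz, h1, h2⟩
  refine ⟨?_, z, hz, h1⟩
  rcases h2 with h | ⟨k, h⟩
  · exact lay_subset_superpose ω _ h.1
  · exact lay_subset_superpose ω _ h

/-- Some point of the box of `a` is joined to the box of `b` inside the boxes of `U`. -/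
def blockCon (n : ℤ) (U : Set (Zd d)) (a b : Zd d) (O : Set (Sym2 (Zd d))) : Prop :=
  ∃ u ∈ bx (blk n a) n, ∃ x ∈ bx (blk n b) n, con (O ∩ blockEdges n U) u x

/-- Above `pc`, connections between blocks dominate a highly supercritical site percolation. -/
theorem exists_blockCon_ge {p : unitInterval} (hp : pc d < p) (ρ : unitInterval)
    (hρ : (ρ : ℝ) < 1) : ∃ n : ℕ, 1 ≤ n ∧ ∀ (U : Finset (Zd d)) (a b : Zd d),
      (bern fun _ : Zd d => ρ).real {ξ | reach {a} {z | z ∈ U ∧ ξ z = true} b} ≤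
        (bern fun _ : Sym2 (Zd d) => p).real {ω | blockCon n (U : Set (Zd d)) a b (op ω)} := by
  classical
  have hpc : 0 ≤ pc d := Real.sSup_nonneg fun x hx => hx.1
  obtain ⟨p₀, hp₀, hp₀p⟩ := exists_between hp
  have hp1 := p.2.2
  set r : unitInterval := ⟨p₀, by linarith, by linarith⟩ with hr
  set K := Fintype.card (Bool × (Fin d → ZMod 9)) with hK
  have hK0 : K ≠ 0 := Fintype.card_ne_zero
  set t : ℝ := (1 - p) / (1 - p₀) with ht
  have h1p0 : 0 < 1 - p₀ := by linarith
  have ht0 : 0 ≤ t := div_nonneg (by linarith) h1p0.le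
  have ht1 : t < 1 := (div_lt_one h1p0).2 (by linarith)
  have hu0 : 0 ≤ t ^ ((K : ℝ)⁻¹) := Real.rpow_nonneg ht0 _
  have hu1 : t ^ ((K : ℝ)⁻¹) < 1 := Real.rpow_lt_one ht0 ht1 (by positivity)
  set δ : unitInterval := ⟨1 - t ^ ((K : ℝ)⁻¹), by linarith, by linarith⟩ with hδ
  have hδ0 : 0 < (δ : ℝ) := by simp only [hδ]; linarith
  have hδK : (1 - (δ : ℝ)) ^ K = t := by
    simp only [hδ, sub_sub_cancel]
    exact Real.rpow_inv_natCast_pow ht0 hK0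
  have hr1 : (r : ℝ) < 1 := by simp only [hr]; linarith
  obtain ⟨m, n, hmn, hn, H⟩ := one_step hr1 hδ0 (bern_infinite_ne_zero (p := r) hp₀)
    (show 0 < 1 - (ρ : ℝ) by linarith)
  refine ⟨n, hn, fun U a b => ?_⟩
  let q : Layer d × Sym2 (Zd d) → unitInterval := fun j => j.1.elim r fun _ => δ
  have hq : ∀ e, ∏ l, (1 - (q (l, e) : ℝ)) = 1 - p := by
    intro e
    rw [Fintype.prod_option]
    simp only [q, Option.elim, Finset.prod_const, Finset.card_univ]
    rw [← hK, hδK, ht]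
    simp only [hr]
    field_simp
  have hj := joined_ge hmn hn (q := q) (ρ := ρ) (fun c b i τ R hR => by
    have := H (Layer d) q none (some (false, c)) (some (true, c)) (by simp) (by simp) (by simp)
      (fun _ _ _ => rfl) (fun _ => rfl) (fun _ => rfl) (fun _ => rfl) b i τ R hR
    linarith) b U {a} (fun z => blk n z) (bx (blk n a) m) (by
      rintro z rfl
      exact ⟨self_mem_bx _ (by positivity), subset_rfl⟩)
  refine hj.trans ?_
  have hD : MeasurableSet {ω : Config d | blockCon n (U : Set (Zd d)) a b (op ω)} :=
    (dep_op (blockEdges n (U : Set (Zd d))) fun O => ∃ u ∈ bx (blk n a) n,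
      ∃ x ∈ bx (blk n b) n, con O u x).measurableSet (blockEdges_finite _ _)
  have hm : AEMeasurable (superpose : (Layer d × Sym2 (Zd d) → Bool) → Config d) (bern q) := by
    by_contra hc
    have h1 := bern_superpose hq
    rw [Measure.map_of_not_aemeasurable hc] at h1
    exact IsProbabilityMeasure.ne_zero (bern fun _ : Sym2 (Zd d) => p) h1.symm
  rw [← bern_superpose hq, map_measureReal_apply_of_aemeasurable hm hD]
  refine measureReal_mono ?_
  rintro ω ⟨u, hu, x, hx, h⟩
  exact ⟨u, bx_mono _ (by exact_mod_cast hmn) hu, x, hx, h.mono (avail_subset _ _ _ _)⟩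

end Superpose

section Hierarchy
variable {d : ℕ}

lemma Icc_con {lo hi x y : Zd d} (hx : x ∈ Set.Icc lo hi) (hy : y ∈ Set.Icc lo hi) :
    con (edgesIn (Set.Icc lo hi)) x y := by
  classical
  generalize hN : ∑ i, (x i - y i).natAbs = N
  induction N generalizing x with
  | zero =>
    have : x = y := by
      ext i
      have := (Finset.sum_eq_zero_iff.1 hN) i (Finset.mem_univ i)
      omega
    exact this ▸ .refl
  | succ N ih =>
    have : ∃ i, x i ≠ y i := by
      by_contra hc
      push Not at hc
      simp [hc] at hN
    obtain ⟨i, hi'⟩ := this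
    have hxi1 : lo i ≤ x i := hx.1 i
    have hxi2 : x i ≤ hi i := hx.2 i
    have hyi1 : lo i ≤ y i := hy.1 i
    have hyi2 : y i ≤ hi i := hy.2 i
    obtain ⟨t, ht, htm, htn⟩ : ∃ t : ℤ, |x i - t| = 1 ∧ (lo i ≤ t ∧ t ≤ hi i) ∧
        (t - y i).natAbs + 1 = (x i - y i).natAbs := by
      rcases lt_or_gt_of_ne hi' with h | h
      · exact ⟨x i + 1, by simp, by omega, by omega⟩
      · exact ⟨x i - 1, by simp, by omega, by omega⟩
    have hadj : latAdj x (Function.update x i t) :=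
      latAdj_of i (by simpa using ht) fun j hj => by simp [hj]
    have hm : Function.update x i t ∈ Set.Icc lo hi := by
      constructor
      · intro j
        by_cases hj : j = i
        · subst hj; simpa using htm.1
        · simpa [hj] using hx.1 j
      · intro j
        by_cases hj : j = i
        · subst hj; simpa using htm.2
        · simpa [hj] using hx.2 j
    refine .head hadj (mk_mem_edgesIn.2 ⟨hx, hm⟩) (ih hm ?_)
    have h1 := Finset.add_sum_erase Finset.univ (fun j => (x j - y j).natAbs) (Finset.mem_univ i)
    have h2 := Finset.add_sum_erase Finset.univ
      (fun j => (Function.update x i t j - y j).natAbs) (Finset.mem_univ i)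
    have h3 : ∑ j ∈ Finset.univ.erase i, (Function.update x i t j - y j).natAbs =
        ∑ j ∈ Finset.univ.erase i, (x j - y j).natAbs :=
      Finset.sum_congr rfl fun j hj => by simp [Finset.ne_of_mem_erase hj]
    simp only [Function.update_self] at h2
    omega

lemma exists_ne_fin (hd : 2 ≤ d) (i : Fin d) : ∃ k, k ≠ i := by
  have : Nontrivial (Fin d) := Fin.nontrivial_iff_two_le.2 hd
  exact exists_ne i

/-- In dimension at least two, a union of slabs in all directions of a box is connected. -/
lemma slab_con (hd : 2 ≤ d) {lo hi : Zd d} {T : Fin d → Set ℤ}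
    (hT : ∀ i, T i ⊆ Set.Icc (lo i) (hi i)) (hne : ∀ i, (T i).Nonempty) {V : Set (Zd d)}
    (hV : ∀ x ∈ Set.Icc lo hi, (∃ i, x i ∈ T i) → x ∈ V) {x y : Zd d}
    (hx : x ∈ Set.Icc lo hi) (hx' : ∃ i, x i ∈ T i) (hy : y ∈ Set.Icc lo hi)
    (hy' : ∃ i, y i ∈ T i) : con (edgesIn V) x y := by
  classical
  have slab : ∀ {x y : Zd d} (i : Fin d), x ∈ Set.Icc lo hi → y ∈ Set.Icc lo hi → x i ∈ T i →
      y i = x i → con (edgesIn V) x y := by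
    intro x y i hx hy hi' hxy
    have hsub : Set.Icc (Function.update lo i (x i)) (Function.update hi i (x i)) ⊆ V := by
      intro z hz
      have hzi : z i = x i := by
        have h1 := hz.1 i
        have h2 := hz.2 i
        simp only [Function.update_self] at h1 h2
        omega
      refine hV z ⟨fun j => ?_, fun j => ?_⟩ ⟨i, hzi ▸ hi'⟩
      · by_cases hj : j = i
        · subst hj; rw [hzi]; exact hx.1 j
        · simpa [hj] using hz.1 j
      · by_cases hj : j = i
        · subst hj; rw [hzi]; exact hx.2 j
        · simpa [hj] using hz.2 j
    have hmem : ∀ w : Zd d, w ∈ Set.Icc lo hi → w i = x i →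
        w ∈ Set.Icc (Function.update lo i (x i)) (Function.update hi i (x i)) := by
      intro w hw hwi
      constructor <;> intro j <;> by_cases hj : j = i
      · subst hj; simp [hwi]
      · simpa [hj] using hw.1 j
      · subst hj; simp [hwi]
      · simpa [hj] using hw.2 j
    exact (Icc_con (hmem x hx rfl) (hmem y hy hxy)).mono (edgesIn_mono hsub)
  have upd : ∀ {x : Zd d} (k : Fin d) (t : ℤ), x ∈ Set.Icc lo hi → t ∈ Set.Icc (lo k) (hi k) →
      Function.update x k t ∈ Set.Icc lo hi := by
    intro x k t hx ht
    constructor <;> intro j <;> by_cases hj : j = k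
    · subst hj; simpa using ht.1
    · simpa [hj] using hx.1 j
    · subst hj; simpa using ht.2
    · simpa [hj] using hx.2 j
  have two : ∀ {x y : Zd d} (i j : Fin d), i ≠ j → x ∈ Set.Icc lo hi → y ∈ Set.Icc lo hi →
      x i ∈ T i → y j ∈ T j → con (edgesIn V) x y := by
    intro x y i j hij hx hy hi' hj'
    have hm := upd j (y j) hx ⟨hy.1 j, hy.2 j⟩
    exact (slab i hx hm hi' (by simp [hij])).trans (slab j hm hy (by simpa using hj') (by simp))
  obtain ⟨i, hxi⟩ := hx'
  obtain ⟨j, hyj⟩ := hy'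
  obtain ⟨k, hk⟩ := exists_ne_fin hd i
  by_cases hij : i = j
  · subst hij
    obtain ⟨t, ht⟩ := hne k
    have hm := upd k t hx (hT k ht)
    exact (two i k hk.symm hx hm hxi (by simpa using ht)).trans
      (two k i hk hm hy (by simpa using ht) hyj)
  · exact two i j hij hx hy hxi hyj

/-- The parent of a triadic cube. -/
def par (u : Zd d) : Zd d := fun i => u i / 3

lemma par_eq_iff {u v : Zd d} :
    par v = u ↔ v ∈ Set.Icc (fun i => 3 * u i) (fun i => 3 * u i + 2) := by
  constructor
  · rintro rfl
    constructor <;> intro i <;> simp only [par] <;> omega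
  · intro h
    ext i
    have h1 := h.1 i
    have h2 := h.2 i
    simp only [par] at h1 h2 ⊢
    omega

lemma par_iterate (j : ℕ) (a : Zd d) (i : Fin d) : par^[j] a i = a i / 3 ^ j := by
  induction j generalizing a with
  | zero => simp
  | succ j ih =>
    rw [Function.iterate_succ_apply, ih, pow_succ', ← Int.ediv_ediv_of_nonneg (by norm_num)]
    rfl

/-- A triadic cube is good if at most one of its children is bad. -/
def good (ξ : Zd d → Bool) : ℕ → Zd d → Prop
  | 0, u => ξ u = true
  | j + 1, u => ∀ v v', par v = u → par v' = u → ¬ good ξ j v → ¬ good ξ j v' → v = v'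

/-- The sites of a triadic cube all of whose ancestors up to that cube are good. -/
def skel (ξ : Zd d → Bool) : ℕ → Zd d → Set (Zd d)
  | 0, u => {z | z = u ∧ ξ u = true}
  | j + 1, u => {z | good ξ (j + 1) u ∧ ∃ v, par v = u ∧ z ∈ skel ξ j v}

lemma skel_good {ξ : Zd d → Bool} {j : ℕ} {u z : Zd d} (h : z ∈ skel ξ j u) : good ξ j u := by
  cases j with
  | zero => exact h.2
  | succ j => exact h.1

lemma skel_occupied {ξ : Zd d → Bool} {j : ℕ} {u z : Zd d} (h : z ∈ skel ξ j u) :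
    ξ z = true ∧ par^[j] z = u := by
  induction j generalizing u with
  | zero =>
    obtain ⟨rfl, h⟩ := h
    exact ⟨h, rfl⟩
  | succ j ih =>
    obtain ⟨_, v, rfl, h⟩ := h
    exact ⟨(ih h).1, by rw [Function.iterate_succ_apply', (ih h).2]⟩

lemma mem_skel {ξ : Zd d → Bool} {J : ℕ} {a : Zd d} (h : ∀ j ≤ J, good ξ j (par^[j] a)) :
    a ∈ skel ξ J (par^[J] a) := by
  induction J with
  | zero => exact ⟨rfl, h 0 le_rfl⟩
  | succ J ih =>
    exact ⟨h _ le_rfl, _, (Function.iterate_succ_apply' par J a).symm,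
      ih fun j hj => h j (hj.trans J.le_succ)⟩

lemma skel_adj (hd : 2 ≤ d) {ξ : Zd d → Bool} {j : ℕ} {u u' : Zd d} (h : latAdj u u')
    (hu : good ξ j u) (hu' : good ξ j u') : ∃ z ∈ skel ξ j u, ∃ z' ∈ skel ξ j u', latAdj z z' := by
  classical
  induction j generalizing u u' with
  | zero => exact ⟨u, ⟨rfl, hu⟩, u', ⟨rfl, hu'⟩, h⟩
  | succ j ih =>
    obtain ⟨i, σ, hσ, rfl⟩ := latAdj_iff.1 h
    obtain ⟨k, hk⟩ := exists_ne_fin hd i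
    let a : ℤ := if σ = 1 then 2 else 0
    have ha : (0 ≤ a ∧ a ≤ 2) ∧ (3 * (u i + σ) ≤ 3 * u i + a + σ ∧
        3 * u i + a + σ ≤ 3 * (u i + σ) + 2) := by
      rcases hσ with rfl | rfl <;> simp [a] <;> omega
    let v : ℤ → Zd d := fun t l => if l = i then 3 * u i + a else if l = k then 3 * u k + t
      else 3 * u l
    let v' : ℤ → Zd d := fun t => Function.update (v t) i (3 * u i + a + σ)
    have hv : ∀ t, 0 ≤ t → t ≤ 2 → par (v t) = u := by
      intro t h0 h2
      refine par_eq_iff.2 ⟨fun l => ?_, fun l => ?_⟩ <;> simp only [v] <;> split_ifs with h1 h2' <;>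
        first | (subst h1; omega) | (subst h2'; omega) | omega
    have hv' : ∀ t, 0 ≤ t → t ≤ 2 → par (v' t) = Function.update u i (u i + σ) := by
      intro t h0 h2
      ext l
      by_cases hl : l = i
      · subst hl
        simp only [par, v', Function.update_self]
        omega
      · have := congrFun (hv t h0 h2) l
        simp only [par] at this
        simp only [par, v', ne_eq, hl, not_false_eq_true, Function.update_of_ne, this]
    have hadj : ∀ t, latAdj (v t) (v' t) := fun t => latAdj_of i
      (by rcases hσ with rfl | rfl <;> simp [v, v']) fun l hl => by simp [v', hl]
    have hinj : ∀ t t', v t = v t' → t = t' := by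
      intro t t' htt
      have := congrFun htt k
      simp only [v, hk, if_false, if_true] at this
      omega
    have hinj' : ∀ t t', v' t = v' t' → t = t' := by
      intro t t' htt
      have := congrFun htt k
      simp only [v, v', ne_eq, hk, not_false_eq_true, Function.update_of_ne, if_false,
        if_true] at this
      omega
    obtain ⟨t, ht0, ht2, hg, hg'⟩ : ∃ t, 0 ≤ t ∧ t ≤ 2 ∧ good ξ j (v t) ∧ good ξ j (v' t) := by
      by_contra hc
      push Not at hc
      have key : ∀ t, 0 ≤ t → t ≤ 2 → ¬ good ξ j (v t) ∨ ¬ good ξ j (v' t) := fun t h0 h2 => by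
        by_cases hg : good ξ j (v t)
        · exact .inr (hc t h0 h2 hg)
        · exact .inl hg
      have h1 : ∀ t t', 0 ≤ t → t ≤ 2 → 0 ≤ t' → t' ≤ 2 → ¬ good ξ j (v t) →
          ¬ good ξ j (v t') → t = t' := fun t t' a1 a2 a3 a4 a5 a6 =>
        hinj _ _ (hu _ _ (hv t a1 a2) (hv t' a3 a4) a5 a6)
      have h2 : ∀ t t', 0 ≤ t → t ≤ 2 → 0 ≤ t' → t' ≤ 2 → ¬ good ξ j (v' t) →
          ¬ good ξ j (v' t') → t = t' := fun t t' a1 a2 a3 a4 a5 a6 =>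
        hinj' _ _ (hu' _ _ (hv' t a1 a2) (hv' t' a3 a4) a5 a6)
      have k0 := key 0 (by norm_num) (by norm_num)
      have k1 := key 1 (by norm_num) (by norm_num)
      have k2 := key 2 (by norm_num) (by norm_num)
      have a01 := h1 0 1 (by norm_num) (by norm_num) (by norm_num) (by norm_num)
      have a02 := h1 0 2 (by norm_num) (by norm_num) (by norm_num) (by norm_num)
      have a12 := h1 1 2 (by norm_num) (by norm_num) (by norm_num) (by norm_num)
      have b01 := h2 0 1 (by norm_num) (by norm_num) (by norm_num) (by norm_num)
      have b02 := h2 0 2 (by norm_num) (by norm_num) (by norm_num) (by norm_num)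
      have b12 := h2 1 2 (by norm_num) (by norm_num) (by norm_num) (by norm_num)
      norm_num only at a01 a02 a12 b01 b02 b12
      rcases k0 with k0 | k0 <;> rcases k1 with k1 | k1 <;> rcases k2 with k2 | k2 <;>
        first | exact a01 k0 k1 | exact a02 k0 k2 | exact a12 k1 k2 | exact b01 k0 k1 |
          exact b02 k0 k2 | exact b12 k1 k2
    obtain ⟨z, hz, z', hz', hzz⟩ := ih (hadj t) hg hg'
    exact ⟨z, ⟨hu, v t, hv t ht0 ht2, hz⟩, z', ⟨hu', v' t, hv' t ht0 ht2, hz'⟩, hzz⟩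

lemma skel_lift (hd : 2 ≤ d) {ξ : Zd d → Bool} {j : ℕ}
    (hc : ∀ v, ∀ z ∈ skel ξ j v, ∀ z' ∈ skel ξ j v, con (edgesIn (skel ξ j v)) z z')
    {G : Set (Zd d)} (hG : ∀ v ∈ G, good ξ j v) {v v' : Zd d} (h : con (edgesIn G) v v')
    (hv : v ∈ G) {z z' : Zd d} (hz : z ∈ skel ξ j v) (hz' : z' ∈ skel ξ j v') :
    con (edgesIn (⋃ u ∈ G, skel ξ j u)) z z' := by
  have hsub : ∀ u ∈ G, skel ξ j u ⊆ ⋃ u ∈ G, skel ξ j u := fun u hu =>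
    Set.subset_biUnion_of_mem (u := fun u => skel ξ j u) hu
  induction h generalizing z' with
  | refl => exact (hc v z hz z' hz').mono (edgesIn_mono (hsub v hv))
  | @tail w w' h hww ih =>
    obtain ⟨hw, hw'⟩ := mk_mem_edgesIn.1 hww.2
    obtain ⟨y, hy, y', hy', hyy⟩ := skel_adj hd hww.1 (hG _ hw) (hG _ hw')
    exact ((ih hy).tail hyy (mk_mem_edgesIn.2 ⟨hsub _ hw hy, hsub _ hw' hy'⟩)).trans
      ((hc w' y' hy' z' hz').mono (edgesIn_mono (hsub w' hw')))

lemma skel_con (hd : 2 ≤ d) {ξ : Zd d → Bool} {j : ℕ} {u : Zd d} : ∀ z ∈ skel ξ j u,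
    ∀ z' ∈ skel ξ j u, con (edgesIn (skel ξ j u)) z z' := by
  induction j generalizing u with
  | zero =>
    rintro z ⟨rfl, _⟩ z' ⟨rfl, _⟩
    exact .refl
  | succ j ih =>
    rintro z ⟨hu, v, hv, hz⟩ z' ⟨_, v', hv', hz'⟩
    obtain ⟨w, hw1, hw2⟩ : ∃ w, (∀ y, par y = u → y ≠ w → good ξ j y) ∧
        (∀ y, par y = u → good ξ j y → y ≠ w) := by
      by_cases hb : ∃ w, par w = u ∧ ¬ good ξ j w
      · obtain ⟨w, hw, hwb⟩ := hb
        refine ⟨w, fun y hy hyw => ?_, fun y _ hyg hyw => hwb (hyw ▸ hyg)⟩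
        by_contra hc
        exact hyw (hu y w hy hw hc hwb)
      · push Not at hb
        refine ⟨fun i => 3 * u i - 1, fun y hy _ => hb y hy, fun y hy _ hyw => ?_⟩
        subst hyw
        have := congrFun hy ⟨0, by omega⟩
        simp only [par] at this
        omega
    have hcon : con (edgesIn {y | par y = u ∧ good ξ j y}) v v' := by
      refine slab_con hd (lo := fun i => 3 * u i) (hi := fun i => 3 * u i + 2)
        (T := fun i => {t | (3 * u i ≤ t ∧ t ≤ 3 * u i + 2) ∧ t ≠ w i}) (fun i t ht => ht.1)
        (fun i => ?_) ?_ (par_eq_iff.1 hv) ?_ (par_eq_iff.1 hv') ?_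
      · by_cases h : 3 * u i = w i
        · exact ⟨3 * u i + 1, ⟨by omega, by omega⟩, by omega⟩
        · exact ⟨3 * u i, ⟨by omega, by omega⟩, by omega⟩
      · rintro x hx ⟨i, hi⟩
        exact ⟨par_eq_iff.2 hx, hw1 x (par_eq_iff.2 hx) fun h => hi.2 (congrFun h i)⟩
      · have hne := Function.ne_iff.1 (hw2 v hv (skel_good hz))
        obtain ⟨i, hi⟩ := hne
        exact ⟨i, ⟨(par_eq_iff.1 hv).1 i, (par_eq_iff.1 hv).2 i⟩, hi⟩
      · have hne := Function.ne_iff.1 (hw2 v' hv' (skel_good hz'))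
        obtain ⟨i, hi⟩ := hne
        exact ⟨i, ⟨(par_eq_iff.1 hv').1 i, (par_eq_iff.1 hv').2 i⟩, hi⟩
    refine (skel_lift hd (fun v => ih (u := v)) (fun _ h => h.2) hcon ⟨hv, skel_good hz⟩ hz
      hz').mono (edgesIn_mono ?_)
    exact Set.iUnion₂_subset fun y hy x hx => ⟨hu, y, hy.1, hx⟩

lemma reach_of_good (hd : 2 ≤ d) {ξ : Zd d → Bool} {J : ℕ} {G : Set (Zd d)}
    (hG : ∀ v ∈ G, good ξ J v) {a b : Zd d} (ha : par^[J] a ∈ G)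
    (hab : con (edgesIn G) (par^[J] a) (par^[J] b))
    (ha' : ∀ j < J, good ξ j (par^[j] a)) (hb' : ∀ j < J, good ξ j (par^[j] b))
    {U : Set (Zd d)} (hU : ∀ z, par^[J] z ∈ G → z ∈ U) :
    reach {a} {z | z ∈ U ∧ ξ z = true} b := by
  have hb : par^[J] b ∈ G := hab.mem subset_rfl ha
  have hlt : ∀ {c : Zd d}, par^[J] c ∈ G → (∀ j < J, good ξ j (par^[j] c)) →
      ∀ j ≤ J, good ξ j (par^[j] c) := fun hc h j hj =>
    hj.lt_or_eq.elim (h j) fun hj => hj ▸ hG _ hc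
  refine ⟨a, rfl, (skel_lift hd (fun v => skel_con hd (u := v)) hG hab ha (mem_skel (hlt ha ha'))
    (mem_skel (hlt hb hb'))).mono (edgesIn_mono ?_)⟩
  refine Set.iUnion₂_subset fun y hy x hx => .inr ?_
  have := skel_occupied hx
  exact ⟨hU x (this.2 ▸ hy), this.1⟩

end Hierarchy

section HierarchyProb
variable {d : ℕ}

/-- The sites of a triadic cube. -/
def cube (j : ℕ) (u : Zd d) : Set (Zd d) := {z | par^[j] z = u}

lemma cube_finite (j : ℕ) (u : Zd d) : (cube j u).Finite := by
  refine (Set.finite_Icc (fun i => 3 ^ j * u i) (fun i => 3 ^ j * u i + 3 ^ j)).subset ?_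
  rintro z rfl
  have h3 : (0 : ℤ) < 3 ^ j := by positivity
  constructor <;> intro i <;> simp only [par_iterate]
  · exact Int.mul_ediv_self_le h3.ne'
  · exact (Int.lt_mul_ediv_self_add h3).le

lemma cube_disjoint {j : ℕ} {u v : Zd d} (h : u ≠ v) : Disjoint (cube j u) (cube j v) := by
  rw [Set.disjoint_left]
  rintro z rfl hz
  exact h hz

lemma good_dep (j : ℕ) (u : Zd d) : Dep (cube j u) {ξ | good ξ j u} := by
  refine Dep.of_iff fun ξ ξ' h => ?_
  simp only [Set.mem_ofPred_eq]
  induction j generalizing u with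
  | zero => simp only [good, h u rfl]
  | succ j ih =>
    have : ∀ v, par v = u → (good ξ j v ↔ good ξ' j v) := fun v hv => ih v fun z hz =>
      h z (by
        have hz : par^[j] z = v := hz
        rw [cube, Set.mem_ofPred_eq, Function.iterate_succ_apply', hz, hv])
    simp only [good]
    refine forall_congr' fun v => forall_congr' fun v' => forall_congr' fun hv =>
      forall_congr' fun hv' => ?_
    rw [this v hv, this v' hv']

lemma bad_le (ρ : unitInterval) (j : ℕ) (u : Zd d) :
    (bern fun _ : Zd d => ρ).real {ξ | ¬ good ξ j u} ≤ (9 ^ d * (1 - ρ)) ^ 2 ^ j / 9 ^ d := by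
  classical
  have h9 : (0 : ℝ) < 9 ^ d := by positivity
  have hρ : 0 ≤ 1 - (ρ : ℝ) := by linarith [ρ.2.2]
  induction j generalizing u with
  | zero =>
    have := bern_single_false (fun _ : Zd d => ρ) u
    simp only [pow_zero, pow_one, mul_div_cancel_left₀ _ h9.ne', good, Bool.not_eq_true]
    exact this.le
  | succ j ih =>
    set b := (9 ^ d * (1 - (ρ : ℝ))) ^ 2 ^ j / 9 ^ d with hb
    set I : Finset (Zd d) := Finset.Icc (fun i => 3 * u i) (fun i => 3 * u i + 2) with hI
    have hcard : I.card = 3 ^ d := by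
      rw [hI, Pi.card_Icc]
      simp only [Int.card_Icc]
      rw [Finset.prod_congr rfl (g := fun _ => 3) (fun i _ => by omega)]
      simp
    have hsub : {ξ : Zd d → Bool | ¬ good ξ (j + 1) u} ⊆ ⋃ x ∈ (I ×ˢ I).filter fun x => x.1 ≠ x.2,
        {ξ | ¬ good ξ j x.1} ∩ {ξ | ¬ good ξ j x.2} := by
      intro ξ hξ
      simp only [Set.mem_ofPred_eq, good] at hξ
      push Not at hξ
      obtain ⟨v, v', hv, hv', h, h', hne⟩ := hξ
      refine Set.mem_biUnion (x := (v, v')) ?_ ⟨h, h'⟩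
      simp only [Finset.coe_filter, Finset.mem_product, Set.mem_ofPred_eq, hI, Finset.mem_Icc]
      exact ⟨⟨par_eq_iff.1 hv, par_eq_iff.1 hv'⟩, hne⟩
    refine (measureReal_mono hsub (measure_ne_top _ _)).trans
      ((measureReal_biUnion_finset_le _ _).trans ?_)
    have h1 : ∀ x ∈ (I ×ˢ I).filter fun x => x.1 ≠ x.2, (bern fun _ : Zd d => ρ).real
        ({ξ | ¬ good ξ j x.1} ∩ {ξ | ¬ good ξ j x.2}) ≤ b * b := by
      intro x hx
      have hd := fun v : Zd d => (good_dep j v).compl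
      have := bern_indep (fun _ : Zd d => ρ) (cube_finite j x.1) (cube_finite j x.2)
        (cube_disjoint (Finset.mem_filter.1 hx).2) (hd x.1) (hd x.2)
      refine this.le.trans ?_
      exact mul_le_mul (ih _) (ih _) measureReal_nonneg (by positivity)
    refine (Finset.sum_le_card_nsmul _ _ _ h1).trans ?_
    rw [nsmul_eq_mul]
    have h2 : (((I ×ˢ I).filter fun x => x.1 ≠ x.2).card : ℝ) ≤ 9 ^ d := by
      have : ((I ×ˢ I).filter fun x => x.1 ≠ x.2).card ≤ 9 ^ d := by
        refine (Finset.card_filter_le _ _).trans ?_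
        rw [Finset.card_product, hcard, ← mul_pow]
        norm_num
      exact_mod_cast this
    calc _ ≤ 9 ^ d * (b * b) := by gcongr
      _ = _ := by
        rw [hb, pow_succ 2 j, pow_mul]
        field_simp

lemma reach_ge (hd : 2 ≤ d) {ρ : unitInterval} (hρ : 9 ^ d * (1 - (ρ : ℝ)) ≤ 1 / (4 * 30 ^ d))
    {J : ℕ} (G : Finset (Zd d)) (hGc : (G.card : ℝ) ≤ (6 * 3 ^ J) ^ d) {a b : Zd d}
    (ha : par^[J] a ∈ G) (hab : con (edgesIn (G : Set (Zd d))) (par^[J] a) (par^[J] b))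
    {U : Set (Zd d)} (hU : ∀ z, par^[J] z ∈ G → z ∈ U) :
    1 / 2 ≤ (bern fun _ : Zd d => ρ).real {ξ | reach {a} {z | z ∈ U ∧ ξ z = true} b} := by
  set P := bern fun _ : Zd d => ρ
  have h9 : (9 : ℝ) ≤ 9 ^ d := le_self_pow₀ (by norm_num) (by omega)
  have hρ0 : 0 ≤ 1 - (ρ : ℝ) := by linarith [ρ.2.2]
  set η := 9 ^ d * (1 - (ρ : ℝ)) with hη
  have hη0 : 0 ≤ η := by positivity
  have hη4 : η ≤ 1 / 4 := hρ.trans (by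
    rw [div_le_div_iff₀ (by positivity) (by positivity)]
    have : (1 : ℝ) ≤ 30 ^ d := one_le_pow₀ (by norm_num)
    linarith)
  have h2J : ∀ j : ℕ, j + 1 ≤ 2 ^ j := fun j => Nat.lt_two_pow_self
  have hbad : ∀ j u, P.real {ξ | ¬ good ξ j u} ≤ (1 / 4) ^ (j + 1) / 9 := by
    intro j u
    refine (bad_le ρ j u).trans ?_
    refine div_le_div₀ (by positivity) ?_ (by norm_num) h9
    calc η ^ 2 ^ j ≤ (1 / 4) ^ 2 ^ j := by gcongr
      _ ≤ _ := pow_le_pow_of_le_one (by norm_num) (by norm_num) (h2J j)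
  have hgeo : ∀ J : ℕ, ∑ j ∈ Finset.range J, ((1 : ℝ) / 4) ^ (j + 1) / 9 ≤ 1 / 27 := by
    intro J
    have : ∑ j ∈ Finset.range J, ((1 : ℝ) / 4) ^ (j + 1) / 9 = (1 - (1 / 4) ^ J) / 27 := by
      induction J with
      | zero => simp
      | succ J ih => rw [Finset.sum_range_succ, ih]; ring
    rw [this]
    have : (0 : ℝ) ≤ (1 / 4) ^ J := by positivity
    linarith
  have hanc : ∀ c : Zd d, P.real (⋃ j ∈ Finset.range J, {ξ | ¬ good ξ j (par^[j] c)}) ≤ 1 / 27 :=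
    fun c => (measureReal_biUnion_finset_le _ _).trans
      ((Finset.sum_le_sum fun j _ => hbad j _).trans (hgeo J))
  have htop : P.real (⋃ u ∈ G, {ξ | ¬ good ξ J u}) ≤ 1 / 4 := by
    refine (measureReal_biUnion_finset_le _ _).trans
      ((Finset.sum_le_card_nsmul _ _ _ fun u _ => bad_le ρ J u).trans ?_)
    rw [nsmul_eq_mul, ← hη]
    have h3 : (6 * 3 ^ J : ℝ) ≤ 30 ^ 2 ^ J := by
      clear hGc ha hab hU hanc
      induction J with
      | zero => norm_num
      | succ J ih =>
        have h1 : (3 : ℝ) ≤ 30 ^ 2 ^ J := by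
          calc (3 : ℝ) ≤ 30 ^ 1 := by norm_num
            _ ≤ _ := pow_le_pow_right₀ (by norm_num) Nat.one_le_two_pow
        calc (6 * 3 ^ (J + 1) : ℝ) = (6 * 3 ^ J) * 3 := by ring
          _ ≤ 30 ^ 2 ^ J * 30 ^ 2 ^ J := by gcongr
          _ = _ := by rw [← pow_add, pow_succ 2 J]; congr 1; omega
    calc (G.card : ℝ) * (η ^ 2 ^ J / 9 ^ d) ≤ (30 ^ 2 ^ J) ^ d * (η ^ 2 ^ J / 1) := by
          gcongr
          · exact hGc.trans (by gcongr)
          · linarith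
      _ = (30 ^ d * η) ^ 2 ^ J := by
          rw [div_one, mul_pow (30 ^ d) η, ← pow_mul, ← pow_mul, mul_comm d]
      _ ≤ (1 / 4) ^ 2 ^ J := by
          gcongr
          calc 30 ^ d * η ≤ 30 ^ d * (1 / (4 * 30 ^ d)) := by gcongr
            _ = 1 / 4 := by field_simp
      _ ≤ (1 / 4) ^ 1 := pow_le_pow_of_le_one (by norm_num) (by norm_num) Nat.one_le_two_pow
      _ = 1 / 4 := by norm_num
  set E := (⋃ u ∈ G, {ξ : Zd d → Bool | ¬ good ξ J u}) ∪
    ((⋃ j ∈ Finset.range J, {ξ : Zd d → Bool | ¬ good ξ j (par^[j] a)}) ∪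
      ⋃ j ∈ Finset.range J, {ξ : Zd d → Bool | ¬ good ξ j (par^[j] b)}) with hE
  have hEp : P.real E ≤ 1 / 4 + (1 / 27 + 1 / 27) :=
    (measureReal_union_le _ _).trans (add_le_add htop ((measureReal_union_le _ _).trans
      (add_le_add (hanc a) (hanc b))))
  have hm : ∀ j u, MeasurableSet {ξ : Zd d → Bool | ¬ good ξ j u} := fun j u =>
    (good_dep j u).compl.measurableSet (cube_finite j u)
  have hEm : MeasurableSet E :=
    (Finset.measurableSet_biUnion _ fun u _ => hm _ _).union
      ((Finset.measurableSet_biUnion _ fun j _ => hm _ _).union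
        (Finset.measurableSet_biUnion _ fun j _ => hm _ _))
  have h1 := probReal_compl_eq_one_sub (μ := P) hEm
  have h2 : P.real Eᶜ ≤ P.real {ξ | reach {a} {z | z ∈ U ∧ ξ z = true} b} := by
    refine measureReal_mono fun ξ hξ => ?_
    simp only [hE, Set.compl_union, Set.mem_inter_iff, Set.mem_compl_iff, Set.mem_iUnion,
      not_exists, Set.mem_ofPred_eq, not_not, Finset.mem_range] at hξ
    exact reach_of_good hd (G := (G : Set (Zd d))) (fun v hv => hξ.1 v hv) ha hab
      (fun j hj => hξ.2.1 j hj) (fun j hj => hξ.2.2 j hj) hU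
  linarith

end HierarchyProb

section Isoperimetry
variable {d : ℕ}

/-- The radii of the nested boxes at scale `n * s`. -/
def rad (n s T : ℤ) : ℤ := n * (s * T - 6)

/-- The boundary layer of `[-T-1, T]^d`. -/
def bdLayer (d : ℕ) (T : ℤ) : Set (Zd d) :=
  {u | u ∈ Set.Icc (fun _ => -T - 1) (fun _ => T) ∧ ∃ i, u i = T ∨ u i = -T - 1}

lemma bdLayer_finite (T : ℤ) : (bdLayer d T).Finite :=
  (Set.finite_Icc _ _).subset fun _ h => h.1

lemma bdLayer_con (hd : 2 ≤ d) {T : ℤ} (hT : 0 ≤ T) {x y : Zd d} (hx : x ∈ bdLayer d T)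
    (hy : y ∈ bdLayer d T) : con (edgesIn (bdLayer d T)) x y := by
  refine slab_con hd (lo := fun _ => -T - 1) (hi := fun _ => T) (T := fun _ => {T, -T - 1})
    ?_ ?_ ?_ hx.1 ?_ hy.1 ?_
  · rintro i t (rfl | rfl) <;> constructor <;> omega
  · exact fun i => ⟨T, by simp⟩
  · rintro x hx ⟨i, hi⟩
    exact ⟨hx, i, hi⟩
  · exact hx.2
  · exact hy.2

lemma bdLayer_card (T : ℤ) (hT : 0 ≤ T) :
    ((bdLayer_finite (d := d) T).toFinset.card : ℝ) ≤ (2 * T + 2) ^ d := by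
  classical
  have h1 : (bdLayer_finite (d := d) T).toFinset ⊆
      Finset.Icc (fun _ : Fin d => -T - 1) (fun _ => T) := by
    intro u hu
    simp only [Set.Finite.mem_toFinset] at hu
    exact Finset.mem_Icc.2 hu.1
  have h2 := Finset.card_le_card h1
  rw [Pi.card_Icc] at h2
  simp only [Int.card_Icc, Finset.prod_const, Finset.card_univ, Fintype.card_fin] at h2
  have h3 : (((T + 1 - (-T - 1)).toNat : ℕ) : ℝ) = 2 * T + 2 := by
    have : (((T + 1 - (-T - 1)).toNat : ℕ) : ℤ) = 2 * T + 2 := by omega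
    exact_mod_cast this
  calc ((bdLayer_finite (d := d) T).toFinset.card : ℝ)
      ≤ (((T + 1 - (-T - 1)).toNat ^ d : ℕ) : ℝ) := by exact_mod_cast h2
    _ = _ := by rw [Nat.cast_pow, h3]

/-- From a point of a box one reaches, outside the given box, any point beyond one of its faces. -/
lemma con_beyond {x u : Zd d} {r m : ℤ} (hu : u ∈ bx x m)
    (h : ∃ i, (x i = r ∧ r < u i) ∨ (x i = -r ∧ u i < -r)) :
    con (edgesIn (bx x m) \ edgesIn (bx 0 r)) x u := by
  classical
  obtain ⟨i, hi⟩ := h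
  have hm : 1 ≤ m := by have := hu i; omega
  set σ : ℤ := if x i = r ∧ r < u i then 1 else -1 with hσ
  have hσ1 : σ = 1 ∨ σ = -1 := by rw [hσ]; split_ifs <;> simp
  set y := Function.update x i (x i + σ) with hy
  have hyi : y i = x i + σ := by simp [hy]
  have hyj : ∀ j, j ≠ i → y j = x j := fun j hj => by simp [hy, hj]
  have hyx : y ∈ bx x m := by
    intro j
    by_cases hj : j = i
    · subst hj; rw [hyi]; omega
    · rw [hyj j hj]; omega
  have hσ' : (σ = 1 ∧ x i = r ∧ r < u i) ∨ (σ = -1 ∧ x i = -r ∧ u i < -r) := by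
    rw [hσ]
    split_ifs with h
    · exact Or.inl ⟨rfl, h⟩
    · rcases hi with hi | hi
      · exact absurd hi h
      · exact Or.inr ⟨rfl, hi⟩
  have h0 : ∀ z : Zd d, (σ = 1 ∧ r < z i ∨ σ = -1 ∧ z i < -r) → z ∉ bx 0 r := by
    intro z hz hz'
    have := hz' i
    simp only [Pi.zero_apply] at this
    omega
  set lo : Zd d := fun j => if j = i then (if σ = 1 then r + 1 else x i - m) else x j - m with hlo
  set hi' : Zd d := fun j => if j = i then (if σ = 1 then x i + m else -r - 1) else x j + m
    with hhi
  have hmem : ∀ z ∈ bx x m, (σ = 1 ∧ r < z i ∨ σ = -1 ∧ z i < -r) → z ∈ Set.Icc lo hi' := by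
    intro z hz hzi
    constructor <;> intro j <;> have := hz j <;> by_cases hj : j = i
    · subst hj
      simp only [hlo, if_true]; split_ifs <;> omega
    · simp only [hlo, hj, if_false]; omega
    · subst hj
      simp only [hhi, if_true]; split_ifs <;> omega
    · simp only [hhi, hj, if_false]; omega
  have hsub : edgesIn (Set.Icc lo hi') ⊆ edgesIn (bx x m) \ edgesIn (bx 0 r) := by
    have hz : ∀ z ∈ Set.Icc lo hi', z ∈ bx x m ∧ z ∉ bx 0 r := by
      intro z hz
      refine ⟨fun j => ?_, h0 z ?_⟩
      · have h1 : lo j ≤ z j := hz.1 j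
        have h2 : z j ≤ hi' j := hz.2 j
        simp only [hlo, hhi] at h1 h2
        split_ifs at h1 h2 with ha hb <;> first | (subst ha; omega) | omega
      · have h1 : lo i ≤ z i := hz.1 i
        have h2 : z i ≤ hi' i := hz.2 i
        simp only [hlo, hhi, if_true] at h1 h2
        split_ifs at h1 h2 <;> omega
    intro e he
    induction e using Sym2.ind with
    | _ a b =>
      rw [mk_mem_edgesIn] at he
      refine ⟨mk_mem_edgesIn.2 ⟨(hz a he.1).1, (hz b he.2).1⟩, fun h => ?_⟩
      exact (hz a he.1).2 (mk_mem_edgesIn.1 h).1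
  have hadj : latAdj x y := latAdj_iff.2 ⟨i, σ, hσ1, rfl⟩
  refine con.head hadj ⟨mk_mem_edgesIn.2 ⟨self_mem_bx x (by omega), hyx⟩, fun h => ?_⟩
    ((Icc_con (hmem y hyx ?_) (hmem u hu ?_)).mono hsub)
  · exact h0 y (by rw [hyi]; omega) (mk_mem_edgesIn.1 h).2
  · rw [hyi]; omega
  · omega

lemma sph_block {n s T : ℤ} (hn : 1 ≤ n) (hs : 10 ≤ s) (hT : 1 ≤ T) {J : ℕ} (hJ : s = 3 ^ J)
    {x : Zd d} (hx : x ∈ sph 0 (rad n s T)) :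
    ∃ a : Zd d, par^[J] a ∈ bdLayer d T ∧ ∀ u ∈ bx (blk n a) n,
      con (edgesIn (bx x (9 * n)) \ edgesIn (bx 0 (rad n s T))) x u := by
  classical
  obtain ⟨hx, i, hi⟩ := hx
  simp only [Pi.zero_apply, zero_add, zero_sub] at hi
  have hx' : ∀ j, -rad n s T ≤ x j ∧ x j ≤ rad n s T := fun j => by
    have := hx j; simp only [Pi.zero_apply] at this; omega
  have hsT : 10 ≤ s * T := by nlinarith
  have hrad : rad n s T = n * (s * T) - 6 * n := by simp only [rad]; ring
  have hpos : 0 < rad n s T := by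
    rw [rad]; exact mul_pos (by omega) (by omega)
  set a : Zd d := fun j => if j = i then (if x i = rad n s T then s * T else -(s * T) - 1)
    else x j / n with ha
  have hai : a i = if x i = rad n s T then s * T else -(s * T) - 1 := by simp [ha]
  have haj : ∀ j, j ≠ i → a j = x j / n := fun j hj => by simp [ha, hj]
  refine ⟨a, ⟨⟨fun j => ?_, fun j => ?_⟩, i, ?_⟩, fun u hu => ?_⟩
  · rw [par_iterate, ← hJ, Int.le_ediv_iff_mul_le (by omega)]
    by_cases hj : j = i
    · subst hj; rw [hai]; split_ifs <;> nlinarith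
    · rw [haj j hj, Int.le_ediv_iff_mul_le (by omega)]
      have := hx' j
      nlinarith
  · rw [par_iterate, ← hJ]
    refine Int.lt_add_one_iff.1 ((Int.ediv_lt_iff_lt_mul (by omega)).2 ?_)
    by_cases hj : j = i
    · subst hj; rw [hai]; split_ifs <;> nlinarith
    · rw [haj j hj, Int.ediv_lt_iff_lt_mul (by omega)]
      have := hx' j
      nlinarith
  · rw [par_iterate, ← hJ, hai]
    split_ifs
    · left; exact Int.mul_ediv_cancel_left _ (by omega)
    · right
      rw [show -(s * T) - 1 = (s - 1) + s * (-T - 1) by ring,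
        Int.add_mul_ediv_left _ _ (by omega), Int.ediv_eq_zero_of_lt (by omega) (by omega)]
      ring
  · refine con_beyond (fun j => ?_) ⟨i, ?_⟩
    · have h1 : n * a j - n ≤ u j ∧ u j ≤ n * a j + n := hu j
      by_cases hj : j = i
      · subst hj
        rw [hai] at h1
        split_ifs at h1 with h
        · constructor <;> nlinarith
        · have h2 : x j = -rad n s T := by omega
          have h3 : n * (-(s * T) - 1) = -(n * (s * T)) - n := by ring
          omega
      · rw [haj j hj] at h1
        have h2 := Int.mul_ediv_self_le (x := x j) (k := n) (by omega)
        have h3 := Int.lt_mul_ediv_self_add (x := x j) (k := n) (by omega)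
        omega
    · have h1 : n * a i - n ≤ u i ∧ u i ≤ n * a i + n := hu i
      rw [hai] at h1
      split_ifs at h1 with h
      · left; omega
      · right
        have h2 : x i = -rad n s T := by omega
        have h3 : n * (-(s * T) - 1) = -(n * (s * T)) - n := by ring
        omega

lemma bx_sph_subset {n s T : ℤ} (hn : 1 ≤ n) (hs : 10 ≤ s) {x : Zd d}
    (hx : x ∈ sph 0 (rad n s T)) : bx x (9 * n) ⊆ bx 0 (rad n s (T + 2)) := by
  have h : rad n s (T + 2) = rad n s T + 2 * (n * s) := by simp only [rad]; ring
  have h' : n * 10 ≤ n * s := by nlinarith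
  refine bx_subset fun i => ?_
  have := hx.1 i
  simp only [Pi.zero_apply] at this ⊢
  omega

lemma blockEdges_subset_shell {n s T : ℤ} (hn : 1 ≤ n) (hs : 10 ≤ s) {J : ℕ}
    (hJ : s = 3 ^ J) :
    blockEdges n {z : Zd d | par^[J] z ∈ bdLayer d T} ⊆
      edgesIn (bx 0 (rad n s (T + 2))) \ edgesIn (bx 0 (rad n s T)) := by
  have h : rad n s (T + 2) = n * (s * T) + 2 * (n * s) - 6 * n := by simp only [rad]; ring
  have hr : rad n s T = n * (s * T) - 6 * n := by simp only [rad]; ring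
  have h' : n * 10 ≤ n * s := by nlinarith
  rintro e ⟨z, hz, he⟩
  obtain ⟨⟨h1, h2⟩, i, hi⟩ := hz
  have key : ∀ j, (par^[J] z) j = z j / s := fun j => by rw [par_iterate, ← hJ]
  have hb : ∀ j, n * (z j) ≤ n * (s * T) + n * s - n ∧ -(n * (s * T)) - n * s ≤ n * z j := by
    intro j
    have h1 : -T - 1 ≤ (par^[J] z) j := h1 j
    have h2 : (par^[J] z) j ≤ T := h2 j
    rw [key] at h1 h2
    have h3 := Int.mul_ediv_self_le (x := z j) (k := s) (by omega)
    have h4 := Int.lt_mul_ediv_self_add (x := z j) (k := s) (by omega)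
    have h5 : z j ≤ s * T + s - 1 := by nlinarith
    have h6 : -(s * T) - s ≤ z j := by nlinarith
    constructor <;> nlinarith
  have hbi : n * (s * T) ≤ n * z i ∨ n * z i ≤ -(n * (s * T)) - n := by
    rw [key] at hi
    have h3 := Int.mul_ediv_self_le (x := z i) (k := s) (by omega)
    have h4 := Int.lt_mul_ediv_self_add (x := z i) (k := s) (by omega)
    rcases hi with hi | hi <;> rw [hi] at h3 h4
    · left; nlinarith
    · right
      have : z i ≤ -(s * T) - 1 := by nlinarith
      nlinarith
  have hv : ∀ v ∈ bx (blk n z) (4 * n), v ∈ bx 0 (rad n s (T + 2)) ∧ v ∉ bx 0 (rad n s T) := by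
    intro v hv
    constructor
    · intro j
      have h1 : n * z j - 4 * n ≤ v j ∧ v j ≤ n * z j + 4 * n := hv j
      have := hb j
      simp only [Pi.zero_apply]
      omega
    · intro hv'
      have h1 : n * z i - 4 * n ≤ v i ∧ v i ≤ n * z i + 4 * n := hv i
      have := hv' i
      simp only [Pi.zero_apply] at this
      omega
  induction e using Sym2.ind with
  | _ a b =>
    rw [mk_mem_edgesIn] at he
    exact ⟨mk_mem_edgesIn.2 ⟨(hv a he.1).1, (hv b he.2).1⟩,
      fun h => (hv a he.1).2 (mk_mem_edgesIn.1 h).1⟩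

/-- Points of the inner sphere are connected inside a shell with probability bounded below. -/
theorem shell_con_ge (hd : 2 ≤ d) {p ρ : unitInterval}
    (hρ : 9 ^ d * (1 - (ρ : ℝ)) ≤ 1 / (4 * 30 ^ d)) {n : ℕ} (hn : 1 ≤ n)
    (h : ∀ (U : Finset (Zd d)) (a b : Zd d),
      (bern fun _ : Zd d => ρ).real {ξ | reach {a} {z | z ∈ U ∧ ξ z = true} b} ≤
        (bern fun _ : Sym2 (Zd d) => p).real {ω | blockCon n (U : Set (Zd d)) a b (op ω)})
    {J : ℕ} {s T : ℤ} (hJ : s = 3 ^ J) (hs : 10 ≤ s) (hT : 1 ≤ T) (hTs : T + 1 ≤ 3 * s)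
    {x y : Zd d} (hx : x ∈ sph 0 (rad n s T)) (hy : y ∈ sph 0 (rad n s T)) :
    (p : ℝ) ^ (edgesIn (bx (0 : Zd d) (9 * n))).ncard *
      (p : ℝ) ^ (edgesIn (bx (0 : Zd d) (9 * n))).ncard * (1 / 2) ≤
      (bern fun _ : Sym2 (Zd d) => p).real {ω | con (op ω ∩
        (edgesIn (bx 0 (rad n s (T + 2))) \ edgesIn (bx 0 (rad n s T)))) x y} := by
  classical
  have hn' : (1 : ℤ) ≤ n := by exact_mod_cast hn
  obtain ⟨a, ha, hxa⟩ := sph_block hn' hs hT hJ hx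
  obtain ⟨b, hb, hyb⟩ := sph_block hn' hs hT hJ hy
  set G := (bdLayer_finite (d := d) T).toFinset with hG
  have hGc : (G.card : ℝ) ≤ (6 * 3 ^ J) ^ d := by
    refine (bdLayer_card T (by omega)).trans ?_
    have h1 : (T : ℝ) + 1 ≤ 3 * s := by exact_mod_cast hTs
    have h2 : (1 : ℝ) ≤ T := by exact_mod_cast hT
    have h3 : (s : ℝ) = 3 ^ J := by rw [hJ]; push_cast; rfl
    exact pow_le_pow_left₀ (by linarith) (by linarith) _
  have hUfin : {z : Zd d | par^[J] z ∈ bdLayer d T}.Finite := by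
    have : (⋃ u ∈ bdLayer d T, cube J u).Finite :=
      (bdLayer_finite T).biUnion fun u _ => cube_finite J u
    refine this.subset fun z hz => Set.mem_biUnion hz rfl
  have hmemG : ∀ u, u ∈ G ↔ u ∈ bdLayer d T := fun u => by simp [hG]
  have h1 := reach_ge hd hρ (J := J) G hGc (a := a) (b := b) ((hmemG _).2 ha)
    (by rw [hG, Set.Finite.coe_toFinset]; exact bdLayer_con hd (by omega) ha hb)
    (U := {z | z ∈ hUfin.toFinset}) (by simp [hG])
  have h2 : (1 / 2 : ℝ) ≤ (bern fun _ : Sym2 (Zd d) => p).real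
      {ω | blockCon n {z : Zd d | par^[J] z ∈ bdLayer d T} a b (op ω)} := by
    have h3 := h hUfin.toFinset a b
    rw [Set.Finite.coe_toFinset] at h3
    exact h1.trans h3
  set S := edgesIn (bx (0 : Zd d) (rad n s (T + 2)))
  have hSf : S.Finite := edgesIn_finite (bx_finite _ _)
  have hBS := blockEdges_subset_shell (d := d) (T := T) hn' hs hJ
  have hball : ∀ x : Zd d, (bern fun _ : Sym2 (Zd d) => p).real
      {ω | ∀ e ∈ edgesIn (bx x (9 * n)), ω e = true} =
        (p : ℝ) ^ (edgesIn (bx (0 : Zd d) (9 * n))).ncard := fun x => by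
    rw [bern_all_open _ (edgesIn_finite (bx_finite _ _)) (r := p) (fun _ _ => rfl)]
    congr 1
    exact_mod_cast edgesIn_bx_ncard x (9 * n)
  have hinc : ∀ x : Zd d, Inc {ω : Config d | ∀ e ∈ edgesIn (bx x (9 * n)), ω e = true} :=
    fun x ω ω' h hω e he => h e (hω e he)
  have hdx := (dep_all (edgesIn (bx x (9 * n))) true).mono
    (edgesIn_mono (bx_sph_subset hn' hs hx))
  have hdy := (dep_all (edgesIn (bx y (9 * n))) true).mono
    (edgesIn_mono (bx_sph_subset hn' hs hy))
  have hincB : Inc {ω : Config d | blockCon n {z : Zd d | par^[J] z ∈ bdLayer d T} a b (op ω)} := by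
    rintro ω ω' h ⟨u, hu, v, hv, huv⟩
    exact ⟨u, hu, v, hv, huv.mono (Set.inter_subset_inter_left _ fun e he => h e he)⟩
  have hdB : Dep S {ω : Config d |
      blockCon n {z : Zd d | par^[J] z ∈ bdLayer d T} a b (op ω)} := by
    refine Dep.mono ?_ (hBS.trans Set.sdiff_subset)
    exact dep_op _ fun O => ∃ u ∈ bx (blk n a) n, ∃ x ∈ bx (blk n b) n, con O u x
  have k1 := harris (fun _ : Sym2 (Zd d) => p) hSf hdx hdy (hinc x) (hinc y)
  have k2 := harris (fun _ : Sym2 (Zd d) => p) hSf (hdx.inter hdy) hdB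
    ((hinc x).inter (hinc y)) hincB
  rw [hball, hball] at k1
  have hp0 := p.2.1
  refine (mul_le_mul k1 h2 (by norm_num) measureReal_nonneg).trans (k2.trans ?_)
  refine measureReal_mono ?_ (measure_ne_top _ _)
  rintro ω ⟨⟨hωx, hωy⟩, u, hu, v, hv, huv⟩
  have aux : ∀ {w z : Zd d}, (∀ e ∈ edgesIn (bx w (9 * n)), ω e = true) →
      w ∈ sph 0 (rad n s T) →
      con (edgesIn (bx w (9 * n)) \ edgesIn (bx 0 (rad n s T))) w z →
      con (op ω ∩ (S \ edgesIn (bx 0 (rad n s T)))) w z := by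
    intro w z hw hws h
    have hsub : edgesIn (bx w (9 * n)) \ edgesIn (bx 0 (rad n s T)) ⊆
        op ω ∩ (S \ edgesIn (bx 0 (rad n s T))) := fun e he =>
      ⟨hw e he.1, edgesIn_mono (bx_sph_subset hn' hs hws) he.1, he.2⟩
    exact h.mono hsub
  exact ((aux hωx hx (hxa u hu)).trans (huv.mono (Set.inter_subset_inter_right _ hBS))).trans
    (aux hωy hy (hyb v hv)).symm

/-- Two points reach the sphere of radius `r` without being connected in the box. -/
def split (r : ℤ) (x y : Zd d) (O : Set (Sym2 (Zd d))) : Prop :=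
  (∃ u ∈ sph 0 r, con (O ∩ edgesIn (bx 0 r)) x u) ∧
    (∃ v ∈ sph 0 r, con (O ∩ edgesIn (bx 0 r)) y v) ∧ ¬ con (O ∩ edgesIn (bx 0 r)) x y

lemma split_step {p : unitInterval} {c : ℝ} {r r' : ℤ} (hr : r ≤ r')
    (h : ∀ u ∈ sph (0 : Zd d) r, ∀ v ∈ sph (0 : Zd d) r,
      c ≤ (bern fun _ : Sym2 (Zd d) => p).real
        {ω | con (op ω ∩ (edgesIn (bx 0 r') \ edgesIn (bx 0 r))) u v})
    {x y : Zd d} (hx : x ∈ bx 0 r) (hy : y ∈ bx 0 r) :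
    (bern fun _ : Sym2 (Zd d) => p).real {ω | split r' x y (op ω)} ≤
      (1 - c) * (bern fun _ : Sym2 (Zd d) => p).real {ω | split r x y (op ω)} := by
  classical
  set q : Sym2 (Zd d) → unitInterval := fun _ => p with hq
  set B := edgesIn (bx (0 : Zd d) r) with hB
  set B' := edgesIn (bx (0 : Zd d) r') with hB'
  have hBB : B ⊆ B' := edgesIn_mono (bx_mono 0 hr)
  have hBf : B.Finite := edgesIn_finite (bx_finite _ _)
  have hBf' : B'.Finite := edgesIn_finite (bx_finite _ _)
  set X : Config d → Set (Sym2 (Zd d)) := fun ω => op ω ∩ B with hX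
  set G : Set (Set (Sym2 (Zd d))) :=
    {O | (∃ u ∈ sph 0 r, con O x u) ∧ (∃ v ∈ sph 0 r, con O y v) ∧ ¬ con O x y} with hG
  have hch : ∀ O, ∃ u v : Zd d, O ∈ G → (u ∈ sph 0 r ∧ con O x u) ∧ (v ∈ sph 0 r ∧ con O y v) := by
    intro O
    by_cases hO : O ∈ G
    · obtain ⟨⟨u, hu⟩, ⟨v, hv⟩, _⟩ := hO
      exact ⟨u, v, fun _ => ⟨hu, hv⟩⟩
    · exact ⟨0, 0, fun h => absurd h hO⟩
  choose u v huv using hch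
  set F : Set (Sym2 (Zd d)) → Set (Config d) :=
    fun O => {ω | ¬ con (op ω ∩ (B' \ B)) (u O) (v O)} with hF
  have hfin : (Set.range X).Finite := by
    refine hBf.finite_subsets.subset ?_
    rintro _ ⟨ω, rfl⟩
    exact Set.inter_subset_right
  have key := bern_explore_le q (X := X) hfin (S := fun _ => B) (T := fun _ => B' \ B)
    (fun _ _ => hBf) (fun _ _ => hBf'.subset Set.sdiff_subset)
    (fun _ _ => Set.disjoint_sdiff_right)
    (fun o _ => dep_op B fun O => O = o) (F := F)
    (fun o _ => dep_op (B' \ B) fun O => ¬ con O (u o) (v o)) G (1 - c) ?_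
  · refine le_trans (measureReal_mono ?_ (measure_ne_top _ _)) key
    rintro ω ⟨⟨u', hu', hxu⟩, ⟨v', hv', hyv⟩, hxy⟩
    have hXX : op ω ∩ B' ∩ B = X ω := by
      rw [hX, Set.inter_assoc, Set.inter_eq_right.2 hBB]
    have hXG : X ω ∈ G := by
      obtain ⟨a, ha, h1⟩ := hxu.hits_sph_of_mem hx hu' hr
      obtain ⟨b, hb, h2⟩ := hyv.hits_sph_of_mem hy hv' hr
      refine ⟨⟨a, ha, ?_⟩, ⟨b, hb, ?_⟩, fun h => hxy (h.mono ?_)⟩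
      · rwa [← hB, hXX] at h1
      · rwa [← hB, hXX] at h2
      · exact Set.inter_subset_inter_right _ hBB
    refine ⟨hXG, fun hc => hxy ?_⟩
    obtain ⟨⟨_, h1⟩, ⟨_, h2⟩⟩ := huv _ hXG
    have e1 : X ω ⊆ op ω ∩ B' := Set.inter_subset_inter_right _ hBB
    have e2 : op ω ∩ (B' \ B) ⊆ op ω ∩ B' := Set.inter_subset_inter_right _ Set.sdiff_subset
    exact ((h1.mono e1).trans (hc.mono e2)).trans (h2.mono e1).symm
  · intro o _ ho
    obtain ⟨⟨h1, _⟩, ⟨h2, _⟩⟩ := huv o ho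
    have h3 := h _ h1 _ h2
    have hm : MeasurableSet {ω : Config d | con (op ω ∩ (B' \ B)) (u o) (v o)} :=
      Dep.measurableSet (dep_op (B' \ B) fun O => con O (u o) (v o))
        (hBf'.subset Set.sdiff_subset)
    have h4 := probReal_compl_eq_one_sub (μ := bern q) hm
    have h5 : F o = {ω : Config d | con (op ω ∩ (B' \ B)) (u o) (v o)}ᶜ := rfl
    rw [h5, h4]
    linarith

lemma split_iterate {p : unitInterval} {c : ℝ} (hc : c ≤ 1) {r : ℕ → ℤ} (hr : Monotone r) {K : ℕ}
    (h : ∀ k < K, ∀ u ∈ sph (0 : Zd d) (r k), ∀ v ∈ sph (0 : Zd d) (r k),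
      c ≤ (bern fun _ : Sym2 (Zd d) => p).real
        {ω | con (op ω ∩ (edgesIn (bx 0 (r (k + 1))) \ edgesIn (bx 0 (r k)))) u v})
    {x y : Zd d} (hx : x ∈ bx 0 (r 0)) (hy : y ∈ bx 0 (r 0)) :
    (bern fun _ : Sym2 (Zd d) => p).real {ω | split (r K) x y (op ω)} ≤ (1 - c) ^ K := by
  induction K with
  | zero => simp
  | succ K ih =>
    refine (split_step (hr (Nat.le_succ K)) (h K (Nat.lt_succ_self K))
      (bx_mono 0 (hr (Nat.zero_le K)) hx) (bx_mono 0 (hr (Nat.zero_le K)) hy)).trans ?_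
    rw [pow_succ, mul_comm]
    exact mul_le_mul_of_nonneg_right (ih fun k hk => h k (by omega)) (by linarith)

/-- Connections from the box of radius `R` to the sphere of radius `R'` merge inside the latter. -/
def merge (b : Zd d) (R R' : ℤ) (O : Set (Sym2 (Zd d))) : Prop :=
  ∀ x ∈ bx b R, ∀ y ∈ bx b R, (∃ u ∈ sph b R', con (O ∩ edgesIn (bx b R')) x u) →
    (∃ v ∈ sph b R', con (O ∩ edgesIn (bx b R')) y v) → con (O ∩ edgesIn (bx b R')) x y

lemma merge_dep (b : Zd d) (R R' : ℤ) :
    Dep (edgesIn (bx b R')) {ω : Config d | merge b R R' (op ω)} :=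
  dep_op _ fun O => ∀ x ∈ bx b R, ∀ y ∈ bx b R, (∃ u ∈ sph b R', con O x u) →
    (∃ v ∈ sph b R', con O y v) → con O x y

lemma not_merge_le {p : unitInterval} {c : ℝ} (hc : c ≤ 1) {r : ℕ → ℤ} (hr : Monotone r) {K : ℕ}
    (h : ∀ k < K, ∀ u ∈ sph (0 : Zd d) (r k), ∀ v ∈ sph (0 : Zd d) (r k),
      c ≤ (bern fun _ : Sym2 (Zd d) => p).real
        {ω | con (op ω ∩ (edgesIn (bx 0 (r (k + 1))) \ edgesIn (bx 0 (r k)))) u v})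
    {R R' : ℤ} (hR : 0 ≤ R) (hR0 : R ≤ r 0) (hR' : r K ≤ R') :
    (bern fun _ : Sym2 (Zd d) => p).real {ω | ¬ merge 0 R R' (op ω)} ≤
      (2 * R + 1) ^ (2 * d) * (1 - c) ^ K := by
  classical
  set P := bern fun _ : Sym2 (Zd d) => p
  set B := (bx_finite (0 : Zd d) R).toFinset with hB
  have hsub : {ω : Config d | ¬ merge 0 R R' (op ω)} ⊆
      ⋃ x ∈ B ×ˢ B, {ω | split (r K) x.1 x.2 (op ω)} := by
    intro ω hω
    simp only [Set.mem_ofPred_eq, merge] at hω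
    push Not at hω
    obtain ⟨x, hx, y, hy, ⟨u, hu, hxu⟩, ⟨v, hv, hyv⟩, hxy⟩ := hω
    refine Set.mem_biUnion (x := (x, y)) (by simp [hB, hx, hy]) ?_
    have hrK := hR0.trans (hr (Nat.zero_le K))
    have hbb := edgesIn_mono (bx_mono (0 : Zd d) hR')
    have hee : op ω ∩ edgesIn (bx 0 R') ∩ edgesIn (bx 0 (r K)) = op ω ∩ edgesIn (bx 0 (r K)) := by
      rw [Set.inter_assoc, Set.inter_eq_right.2 hbb]
    obtain ⟨a, ha, h1⟩ := hxu.hits_sph_of_mem (bx_mono 0 hrK hx) hu hR'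
    obtain ⟨b, hb, h2⟩ := hyv.hits_sph_of_mem (bx_mono 0 hrK hy) hv hR'
    rw [hee] at h1 h2
    exact ⟨⟨a, ha, h1⟩, ⟨b, hb, h2⟩, fun h => hxy (h.mono (Set.inter_subset_inter_right _ hbb))⟩
  have hcard : ((B ×ˢ B).card : ℝ) = (2 * R + 1) ^ (2 * d) := by
    have h1 : B = Finset.Icc (fun i => (0 : Zd d) i - R) (fun i => (0 : Zd d) i + R) := by
      ext x; simp [hB, bx_eq_Icc]
    have h2 : B.card = (2 * R + 1).toNat ^ d := by
      rw [h1, Pi.card_Icc]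
      simp only [Int.card_Icc, Pi.zero_apply, Finset.prod_const, Finset.card_univ, Fintype.card_fin]
      congr 2; ring
    have h3 : (((2 * R + 1).toNat : ℕ) : ℝ) = 2 * R + 1 := by
      have : (((2 * R + 1).toNat : ℕ) : ℤ) = 2 * R + 1 := by omega
      exact_mod_cast this
    rw [Finset.card_product, h2, ← pow_add, ← two_mul]
    push_cast
    rw [h3]
  calc P.real {ω | ¬ merge 0 R R' (op ω)}
      ≤ P.real (⋃ x ∈ B ×ˢ B, {ω | split (r K) x.1 x.2 (op ω)}) :=
        measureReal_mono hsub (measure_ne_top _ _)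
    _ ≤ ∑ x ∈ B ×ˢ B, P.real {ω | split (r K) x.1 x.2 (op ω)} :=
        measureReal_biUnion_finset_le _ _
    _ ≤ ∑ x ∈ B ×ˢ B, (1 - c) ^ K := by
        refine Finset.sum_le_sum fun x hx => ?_
        simp only [Finset.mem_product, hB, Set.Finite.mem_toFinset] at hx
        exact split_iterate hc hr h (bx_mono 0 hR0 hx.1) (bx_mono 0 hR0 hx.2)
    _ = _ := by rw [Finset.sum_const, nsmul_eq_mul, hcard]

/-- Local uniqueness above `pc`. -/
theorem exists_merge (hd : 2 ≤ d) {p : unitInterval} (hp : pc d < p) {η : ℝ} (hη : 0 < η)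
    (N₀ : ℕ) : ∃ N : ℕ, N₀ ≤ N ∧ (bern fun _ : Sym2 (Zd d) => p).real
      {ω | ¬ merge 0 (2 * N) (4 * N) (op ω)} ≤ η := by
  have hpc : 0 ≤ pc d := Real.sSup_nonneg fun x hx => hx.1
  have hp0 : 0 < (p : ℝ) := hpc.trans_lt hp
  set t : ℝ := 1 / (9 ^ d * (4 * 30 ^ d)) with ht
  have ht0 : 0 < t := by positivity
  have ht1 : t ≤ 1 := by
    rw [ht, div_le_one (by positivity)]
    have h1 : (1 : ℝ) ≤ 9 ^ d := one_le_pow₀ (by norm_num)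
    have h2 : (1 : ℝ) ≤ 30 ^ d := one_le_pow₀ (by norm_num)
    nlinarith
  set ρ : unitInterval := ⟨1 - t, by linarith, by linarith⟩ with hρ
  have hρ' : 9 ^ d * (1 - (ρ : ℝ)) ≤ 1 / (4 * 30 ^ d) := by
    have : (ρ : ℝ) = 1 - t := rfl
    rw [this, sub_sub_cancel, ht]
    apply le_of_eq
    field_simp
  obtain ⟨n, hn, hblock⟩ := exists_blockCon_ge hp ρ (by
    have : (ρ : ℝ) = 1 - t := rfl
    linarith)
  set M := (edgesIn (bx (0 : Zd d) (9 * n))).ncard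
  set c : ℝ := (p : ℝ) ^ M * (p : ℝ) ^ M * (1 / 2) with hc
  have hc0 : 0 < c := by positivity
  have hc1 : c < 1 := by
    have : (p : ℝ) ^ M ≤ 1 := pow_le_one₀ hp0.le p.2.2
    have : (p : ℝ) ^ M * (p : ℝ) ^ M ≤ 1 := mul_le_one₀ this (by positivity) this
    rw [hc]; linarith
  have hlim : Filter.Tendsto
      (fun K : ℕ => (45 * n : ℝ) ^ (2 * d) * ((K : ℝ) ^ (4 * d) * (1 - c) ^ K)) Filter.atTop
      (nhds 0) := by
    have := (tendsto_pow_const_mul_const_pow_of_abs_lt_one (4 * d)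
      (r := 1 - c) (by rw [abs_lt]; constructor <;> linarith)).const_mul ((45 * n : ℝ) ^ (2 * d))
    simpa using this
  obtain ⟨K₀, hK₀⟩ := Filter.eventually_atTop.1 (hlim.eventually_le_const hη)
  set J := max (max N₀ K₀) 5 with hJ
  obtain ⟨K, hK⟩ : Odd (3 ^ J) := Odd.pow (by decide)
  have hJK : J ≤ K := by
    have h1 : (1 : ℤ) + J * 2 ≤ (1 + 2) ^ J := one_add_mul_le_pow (by norm_num) J
    have h2 : ((3 : ℤ)) ^ J = 2 * K + 1 := by exact_mod_cast hK
    norm_num at h1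
    omega
  have hK5 : 5 ≤ K := (le_max_right _ _).trans hJK
  have hNK : N₀ ≤ K := ((le_max_left _ _).trans (le_max_left _ _)).trans hJK
  have hKK : K₀ ≤ K := ((le_max_right _ _).trans (le_max_left _ _)).trans hJK
  set s : ℤ := 3 ^ J with hs
  have hsK : s = 2 * K + 1 := by rw [hs]; exact_mod_cast hK
  have hsub : ((2 * K ^ 2 + 3 * K - 2 : ℕ) : ℤ) = 2 * K ^ 2 + 3 * K - 2 := by
    have : 2 ≤ 2 * K ^ 2 + 3 * K := by nlinarith
    push_cast [Nat.cast_sub this]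
    ring
  set N : ℕ := n * (2 * K ^ 2 + 3 * K - 2) with hN
  have hNZ : (N : ℤ) = n * (2 * K ^ 2 + 3 * K - 2) := by rw [hN, Nat.cast_mul, hsub]
  have hnZ : (1 : ℤ) ≤ n := by exact_mod_cast hn
  have hK5Z : (5 : ℤ) ≤ K := by exact_mod_cast hK5
  have hKN : (K : ℤ) ≤ N := by
    rw [hNZ]
    have h1 : (K : ℤ) ≤ 2 * K ^ 2 + 3 * K - 2 := by nlinarith
    nlinarith
  refine ⟨N, by omega, ?_⟩
  set r : ℕ → ℤ := fun k => rad n s (s + 1 + 2 * k) with hr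
  have hrm : Monotone r := by
    intro a b hab
    have : (a : ℤ) ≤ b := by exact_mod_cast hab
    simp only [hr, rad]
    refine mul_le_mul_of_nonneg_left ?_ (by omega)
    nlinarith
  have key := not_merge_le (d := d) (p := p) hc1.le hrm (K := K) ?_
    (R := 2 * N) (R' := 4 * N) (by omega)
    ?_ ?_
  · refine key.trans (le_trans ?_ (hK₀ K hKK))
    have hKR : (5 : ℝ) ≤ K := by exact_mod_cast hK5
    have hnR : (1 : ℝ) ≤ n := by exact_mod_cast hn
    have hb : (2 * ((2 * N : ℤ) : ℝ) + 1) ≤ 45 * n * (K : ℝ) ^ 2 := by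
      have h1 : (N : ℝ) = n * (2 * K ^ 2 + 3 * K - 2) := by exact_mod_cast hNZ
      push_cast
      rw [h1]
      have h2 : 4 * (2 * (K : ℝ) ^ 2 + 3 * K - 2) + 1 ≤ 45 * K ^ 2 := by nlinarith
      nlinarith
    have h0 : (0 : ℝ) ≤ 2 * ((2 * N : ℤ) : ℝ) + 1 := by positivity
    calc (2 * ((2 * N : ℤ) : ℝ) + 1) ^ (2 * d) * (1 - c) ^ K
        ≤ (45 * n * (K : ℝ) ^ 2) ^ (2 * d) * (1 - c) ^ K :=
          mul_le_mul_of_nonneg_right (pow_le_pow_left₀ h0 hb _) (pow_nonneg (by linarith) _)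
      _ = _ := by rw [mul_pow, ← pow_mul, mul_assoc]; congr 3; ring
  · intro k hk u hu v hv
    have hk' : (k : ℤ) + 1 ≤ K := by exact_mod_cast hk
    have h3 : r (k + 1) = rad n s (s + 1 + 2 * k + 2) := by
      simp only [hr]; push_cast; ring_nf
    rw [h3]
    exact shell_con_ge hd hρ' hn hblock hs (by omega) (by omega) (by omega) hu hv
  · simp only [hr, rad, hNZ, hsK]
    push_cast
    nlinarith
  · simp only [hr, rad, hNZ, hsK]
    nlinarith

/-- The shift by the `i`-th unit vector, twisted by a `1`-cochain. -/
def twist {M : Type*} [AddCommGroup M] (w : Zd d → Fin d → M) (i : Fin d) :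
    Equiv.Perm (Zd d × M) where
  toFun v := (v.1 + Pi.single i 1, v.2 + w v.1 i)
  invFun v := (v.1 - Pi.single i 1, v.2 - w (v.1 - Pi.single i 1) i)
  left_inv v := by simp
  right_inv v := by simp

lemma twist_zpow_fst {M : Type*} [AddCommGroup M] (w : Zd d → Fin d → M) (i : Fin d) (k : ℤ)
    (v : Zd d × M) : ((twist w i ^ k) v).1 = v.1 + Pi.single i k := by
  induction k generalizing v with
  | zero => simp
  | succ k ih =>
    rw [zpow_add_one, Equiv.Perm.mul_apply, ih]
    simp only [twist, Equiv.coe_fn_mk, add_assoc, ← Pi.single_add]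
    rw [add_comm (1 : ℤ)]
  | pred k ih =>
    rw [zpow_sub_one, Equiv.Perm.mul_apply, ih]
    have : ((twist w i)⁻¹ v).1 = v.1 - Pi.single i 1 := rfl
    rw [this, Pi.single_sub]
    abel

/-- A closed `1`-cochain on the lattice is exact. -/
lemma exists_primitive {M : Type*} [AddCommGroup M] (w : Zd d → Fin d → M)
    (hw : ∀ x i j, w x i + w (x + Pi.single i 1) j = w x j + w (x + Pi.single j 1) i) :
    ∃ φ : Zd d → M, ∀ x i, φ (x + Pi.single i 1) = φ x + w x i := by
  classical
  have hcomm : ∀ i j, Commute (twist w i) (twist w j) := by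
    intro i j
    refine Equiv.ext fun v => ?_
    simp only [Equiv.Perm.mul_apply, twist, Equiv.coe_fn_mk]
    refine Prod.ext (by simp only; abel) ?_
    simp only
    rw [add_assoc, add_assoc, hw v.1 i j]
  set f : ∀ _ : Fin d, Multiplicative ℤ →* Equiv.Perm (Zd d × M) :=
    fun i => zpowersHom _ (twist w i) with hf
  have hc : Pairwise fun i j => ∀ x y, Commute (f i x) (f j y) := by
    intro i j _ x y
    simp only [hf, zpowersHom_apply]
    exact (hcomm i j).zpow_zpow _ _
  set Φ := MonoidHom.noncommPiCoprod f hc with hΦ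
  have hfst : ∀ g : Fin d → Multiplicative ℤ, ∀ v, (Φ g v).1 = v.1 + fun i => (g i).toAdd := by
    intro g
    induction g using Pi.mulSingle_induction with
    | one =>
      intro v
      rw [map_one]
      ext i
      simp
    | mul g h hg hh =>
      intro v
      rw [map_mul, Equiv.Perm.mul_apply, hg, hh]
      ext i
      simp only [Pi.add_apply, Pi.mul_apply, toAdd_mul]
      ring
    | mulSingle i m =>
      intro v
      rw [hΦ, MonoidHom.noncommPiCoprod_mulSingle]
      simp only [hf, zpowersHom_apply, twist_zpow_fst]
      congr 1
  refine ⟨fun x => (Φ (fun i => Multiplicative.ofAdd (x i)) (0, 0)).2, fun x i => ?_⟩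
  have h1 : (fun j => Multiplicative.ofAdd ((x + Pi.single i 1 : Zd d) j)) =
      (Pi.mulSingle i (Multiplicative.ofAdd (1 : ℤ)) : Fin d → Multiplicative ℤ) *
        fun j => Multiplicative.ofAdd (x j) := by
    ext j
    by_cases hj : j = i
    · subst hj; simp [add_comm]
    · simp [hj]
  have h2 := hfst (fun i => Multiplicative.ofAdd (x i)) (0, 0)
  simp only [toAdd_ofAdd, zero_add] at h2
  simp only [h1, map_mul, Equiv.Perm.mul_apply]
  have h3 : Φ (Pi.mulSingle i (Multiplicative.ofAdd (1 : ℤ))) = twist w i := by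
    rw [hΦ, MonoidHom.noncommPiCoprod_mulSingle]
    simp [hf, zpowersHom_apply]
  rw [h3]
  simp only [twist, Equiv.coe_fn_mk]
  rw [h2]

/-- Adjacency in the lattice with diagonals. -/
def star (x y : Zd d) : Prop := ∀ i, |x i - y i| ≤ 1

lemma star.symm {x y : Zd d} (h : star x y) : star y x := fun i => by
  rw [abs_sub_comm]; exact h i

lemma latAdj_add_single (x : Zd d) (i : Fin d) : latAdj x (x + Pi.single i 1) :=
  latAdj_of i (by simp) fun j hj => by simp [hj]

/-- The inner boundary of `D`. -/
def innerBd (D : Set (Zd d)) : Set (Zd d) := {z | z ∈ D ∧ ∃ y, y ∉ D ∧ latAdj z y}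

/-- The inner boundary of a connected set with connected complement is connected in the lattice
with diagonals. -/
theorem innerBd_starConn {D : Set (Zd d)} (hD : ∀ x ∈ D, ∀ y ∈ D, con (edgesIn D) x y)
    (hD' : ∀ x, x ∉ D → ∀ y, y ∉ D → con (edgesIn Dᶜ) x y) {a b : Zd d}
    (ha : a ∈ innerBd D) (hb : b ∈ innerBd D) :
    Relation.ReflTransGen (fun u v => star u v ∧ u ∈ innerBd D ∧ v ∈ innerBd D) a b := by
  classical
  set Γ : Set (Zd d) := {z | z ∈ innerBd D ∧
    Relation.ReflTransGen (fun u v => star u v ∧ u ∈ innerBd D ∧ v ∈ innerBd D) a z} with hΓ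
  have hclosed : ∀ u ∈ innerBd D, ∀ v ∈ innerBd D, star u v → (u ∈ Γ ↔ v ∈ Γ) := by
    intro u hu v hv huv
    exact ⟨fun h => ⟨hv, h.2.tail ⟨huv, hu, hv⟩⟩, fun h => ⟨hu, h.2.tail ⟨huv.symm, hv, hu⟩⟩⟩
  set W : Zd d → Zd d → ZMod 2 := fun x y =>
    if (x ∈ D ∧ y ∉ D ∧ x ∈ Γ) ∨ (y ∈ D ∧ x ∉ D ∧ y ∈ Γ) then 1 else 0 with hW
  set χ : Zd d → ZMod 2 := fun x => if x ∈ D then 1 else 0 with hχ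
  have hWχ : ∀ x y, latAdj x y → (x ∈ innerBd D → x ∈ Γ) → (y ∈ innerBd D → y ∈ Γ) →
      W x y = χ x + χ y := by
    intro x y hxy hx hy
    simp only [hW, hχ]
    by_cases h1 : x ∈ D <;> by_cases h2 : y ∈ D
    · simp only [h1, h2]; simp; decide
    · have := hx ⟨h1, y, h2, hxy⟩
      simp [h1, h2, this]
    · have := hy ⟨h2, x, h1, hxy.symm⟩
      simp [h1, h2, this]
    · simp [h1, h2]
  have hW0 : ∀ x y, latAdj x y → (x ∈ innerBd D → x ∉ Γ) → (y ∈ innerBd D → y ∉ Γ) →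
      W x y = 0 := by
    intro x y hxy hx hy
    simp only [hW]
    rw [if_neg]
    rintro (⟨_, _, h⟩ | ⟨_, _, h⟩)
    · exact hx h.1 h
    · exact hy h.1 h
  obtain ⟨φ, hφ⟩ := exists_primitive (fun x i => W x (x + Pi.single i 1)) (by
    intro x i j
    rcases eq_or_ne i j with rfl | hij
    · rfl
    have e1 := latAdj_add_single x i
    have e2 := latAdj_add_single (x + Pi.single i 1) j
    have e3 := latAdj_add_single x j
    have e4 := latAdj_add_single (x + Pi.single j 1) i
    have e5 : x + Pi.single j 1 + Pi.single i 1 = x + Pi.single i 1 + Pi.single j 1 := by abel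
    rw [e5] at e4 ⊢
    set y := x + Pi.single i 1 with hy
    set z := x + Pi.single j 1 with hz
    set t := y + Pi.single j 1 with ht
    have hcube : ∀ u ∈ ({x, y, z, t} : Set (Zd d)), ∀ k, x k ≤ u k ∧ u k ≤ x k + 1 := by
      have hsing : ∀ m k, 0 ≤ (Pi.single m 1 : Zd d) k ∧ (Pi.single m 1 : Zd d) k ≤ 1 ∧
          (k ≠ m → (Pi.single m 1 : Zd d) k = 0) := by
        intro m k
        by_cases hk : k = m
        · subst hk; simp
        · simp [hk]
      rintro u hu k
      have h1 := hsing i k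
      have h2 := hsing j k
      have h3 : (Pi.single i 1 : Zd d) k = 0 ∨ (Pi.single j 1 : Zd d) k = 0 := by
        by_cases hk : k = i
        · exact Or.inr (h2.2.2 (hk ▸ hij))
        · exact Or.inl (h1.2.2 hk)
      (rcases hu with rfl | rfl | rfl | rfl <;> try simp only [hy, hz, ht, Pi.add_apply]) <;> omega
    have hstar : ∀ u ∈ ({x, y, z, t} : Set (Zd d)), ∀ v ∈ ({x, y, z, t} : Set (Zd d)),
        star u v := by
      intro u hu v hv k
      have h1 := hcube u hu k
      have h2 := hcube v hv k
      rw [abs_le]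
      omega
    by_cases hc : ∃ u ∈ ({x, y, z, t} : Set (Zd d)), u ∈ Γ
    · obtain ⟨u, hu, huΓ⟩ := hc
      have hall : ∀ v ∈ ({x, y, z, t} : Set (Zd d)), v ∈ innerBd D → v ∈ Γ := fun v hv hvD =>
        (hclosed u huΓ.1 v hvD (hstar u hu v hv)).1 huΓ
      have hx := hall x (by simp)
      have hy' := hall y (by simp)
      have hz' := hall z (by simp)
      have ht' := hall t (by simp)
      rw [hWχ _ _ e1 hx hy', hWχ _ _ e2 hy' ht', hWχ _ _ e3 hx hz', hWχ _ _ e4 hz' ht']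
      have h2 : ∀ a : ZMod 2, a + a = 0 := by decide
      linear_combination h2 (χ y) - h2 (χ z)
    · have hall : ∀ v ∈ ({x, y, z, t} : Set (Zd d)), v ∈ innerBd D → v ∉ Γ := fun v hv _ hvΓ =>
        hc ⟨v, hv, hvΓ⟩
      have hx := hall x (by simp)
      have hy' := hall y (by simp)
      have hz' := hall z (by simp)
      have ht' := hall t (by simp)
      rw [hW0 _ _ e1 hx hy', hW0 _ _ e2 hy' ht', hW0 _ _ e3 hx hz', hW0 _ _ e4 hz' ht'])
  have hWs : ∀ x y, W x y = W y x := fun x y => by simp only [hW, or_comm]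
  have hφ' : ∀ x y, latAdj x y → φ y = φ x + W x y := by
    intro x y hxy
    obtain ⟨i, σ, hσ, rfl⟩ := latAdj_iff.1 hxy
    rcases hσ with rfl | rfl
    · have : Function.update x i (x i + 1) = x + Pi.single i 1 := by
        ext j; by_cases hj : j = i
        · subst hj; simp
        · simp [hj]
      rw [this, hφ]
    · set y := Function.update x i (x i + -1) with hy
      have hyx : x = y + Pi.single i 1 := by
        ext j; by_cases hj : j = i
        · subst hj; simp [hy]
        · simp [hj, hy]
      have h1 := hφ y i
      rw [← hyx] at h1
      have h2 : ∀ a : ZMod 2, a + a = 0 := by decide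
      rw [h1, hWs x y]
      linear_combination -h2 (W y x)
  have hconst : ∀ V : Set (Zd d), (∀ x ∈ V, ∀ y ∈ V, W x y = 0) → ∀ x y, con (edgesIn V) x y →
      φ y = φ x := by
    intro V hV x y h
    induction h with
    | refl => rfl
    | tail _ h ih =>
      rw [mk_mem_edgesIn] at h
      rw [hφ' _ _ h.1, hV _ h.2.1 _ h.2.2, add_zero, ih]
  by_contra hcon
  obtain ⟨haD, a', ha', haa'⟩ := ha
  obtain ⟨hbD, b', hb', hbb'⟩ := hb
  have haΓ : a ∈ Γ := ⟨⟨haD, a', ha', haa'⟩, .refl⟩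
  have hbΓ : b ∉ Γ := fun h => hcon h.2
  have h1 : φ b = φ a := hconst D (fun x hx y hy => by simp [hW, hx, hy]) _ _ (hD a haD b hbD)
  have h2 : φ b' = φ a' := hconst Dᶜ (fun x hx y hy => by
    simp only [Set.mem_compl_iff] at hx hy
    simp [hW, hx, hy]) _ _ (hD' a' ha' b' hb')
  have h3 : φ a' = φ a + 1 := by
    rw [hφ' a a' haa']; simp [hW, haD, ha', haΓ]
  have h4 : φ b' = φ b := by
    rw [hφ' b b' hbb']; simp [hW, hb', hbΓ]
  rw [h2, h3, h1] at h4
  simp at h4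

lemma con_compl_bx (hd : 2 ≤ d) {R : ℤ} {x y : Zd d} (hx : x ∉ bx 0 R) (hy : y ∉ bx 0 R) :
    con (edgesIn (bx (0 : Zd d) R)ᶜ) x y := by
  set M : ℤ := |R| + 1 + ∑ i, (|x i| + |y i|) with hM
  have hxy : ∀ i, |x i| + |y i| ≤ ∑ i, (|x i| + |y i|) := fun i =>
    Finset.single_le_sum (f := fun i => |x i| + |y i|) (fun i _ => by positivity)
      (Finset.mem_univ i)
  have hb : ∀ z : Zd d, z ∉ bx 0 R → ∃ i, ¬ (-R ≤ z i ∧ z i ≤ R) := by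
    intro z hz
    by_contra hc
    push Not at hc
    exact hz fun i => by simpa using hc i
  have hRM : R < M := by
    have := le_abs_self R
    have : 0 ≤ ∑ i, (|x i| + |y i|) := Finset.sum_nonneg fun i _ => by positivity
    omega
  have hin : ∀ i, (-M ≤ x i ∧ x i ≤ M) ∧ (-M ≤ y i ∧ y i ≤ M) := by
    intro i
    have := hxy i
    have := abs_nonneg R
    have := neg_abs_le (x i)
    have := le_abs_self (x i)
    have := neg_abs_le (y i)
    have := le_abs_self (y i)
    have := abs_nonneg (x i)
    have := abs_nonneg (y i)
    omega
  have hM0 : 0 ≤ M := by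
    have := abs_nonneg R
    have : 0 ≤ ∑ i, (|x i| + |y i|) := Finset.sum_nonneg fun i _ => by positivity
    omega
  obtain ⟨i, hi⟩ := hb x hx
  obtain ⟨j, hj⟩ := hb y hy
  refine slab_con hd (lo := fun _ => -M) (hi := fun _ => M)
    (T := fun _ => {t | (-M ≤ t ∧ t ≤ M) ∧ ¬ (-R ≤ t ∧ t ≤ R)}) (fun i t ht => ht.1)
    (fun i => ⟨M, ⟨by omega, le_rfl⟩, by omega⟩) ?_
    ⟨fun i => (hin i).1.1, fun i => (hin i).1.2⟩ ⟨i, (hin i).1, hi⟩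
    ⟨fun i => (hin i).2.1, fun i => (hin i).2.2⟩ ⟨j, (hin j).2, hj⟩
  rintro z _ ⟨k, hk⟩ hz
  exact hk.2 (by simpa using hz k)

lemma con_univ (x y : Zd d) : con (edgesIn Set.univ) x y := by
  refine bx_con (r := ∑ i, |y i - x i|) (fun u v _ _ _ => by simp) fun i => ?_
  have := Finset.single_le_sum (f := fun i => |y i - x i|) (fun i _ => abs_nonneg _)
    (Finset.mem_univ i)
  have := abs_le.1 this
  omega

/-- The outer boundary of a bounded connected set: it is connected in the lattice with diagonals
and meets every axis line through a point of the set. -/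
theorem exists_outer_boundary (hd : 2 ≤ d) {S : Set (Zd d)} {R : ℤ} (hS : S ⊆ bx 0 R)
    (hconn : ∀ x ∈ S, ∀ y ∈ S, con (edgesIn S) x y) :
    ∃ Γ : Set (Zd d), (∀ a ∈ Γ, ∀ b ∈ Γ,
        Relation.ReflTransGen (fun u v => star u v ∧ u ∈ Γ ∧ v ∈ Γ) a b) ∧
      (∀ z ∈ Γ, z ∉ S ∧ ∃ y ∈ S, latAdj z y) ∧
      ∀ x ∈ S, ∀ i, ∃ t, Function.update x i t ∈ Γ := by
  classical
  set D : Set (Zd d) := {z | ∃ y, y ∉ bx 0 R ∧ con (edgesIn Sᶜ) y z} with hDdef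
  have hDS : ∀ z ∈ D, z ∉ S := by
    rintro z ⟨y, hy, h⟩
    exact con.mem (S := Sᶜ) le_rfl h fun h => hy (hS h)
  have hout : ∀ z, z ∉ bx 0 R → z ∈ D := fun z hz => ⟨z, hz, .refl⟩
  have hstep : ∀ a b, latAdj a b → a ∈ D → b ∉ S → b ∈ D := by
    intro a b hab ha hb
    have ha' := hDS a ha
    obtain ⟨y, hy, h⟩ := ha
    exact ⟨y, hy, h.tail hab (mk_mem_edgesIn.2 ⟨ha', hb⟩)⟩
  have hD : ∀ x ∈ D, ∀ y ∈ D, con (edgesIn D) x y := by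
    have h1 : ∀ x ∈ D, ∃ u, u ∉ bx 0 R ∧ con (edgesIn D) u x := by
      rintro x ⟨u, hu, h⟩
      refine ⟨u, hu, (con.restrict (S := D) ?_ h (hout u hu)).mono Set.inter_subset_right⟩
      intro a b hab h' ha
      exact hstep a b hab ha (mk_mem_edgesIn.1 h').2
    intro x hx y hy
    obtain ⟨u, hu, hux⟩ := h1 x hx
    obtain ⟨v, hv, hvy⟩ := h1 y hy
    exact hux.symm.trans (((con_compl_bx hd hu hv).mono (edgesIn_mono hout)).trans hvy)
  have hD' : ∀ x, x ∉ D → ∀ y, y ∉ D → con (edgesIn Dᶜ) x y := by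
    have hSD : S ⊆ Dᶜ := fun x hx hxD => hDS x hxD hx
    have h1 : ∀ x, x ∉ D → ∃ s ∈ S, con (edgesIn Dᶜ) x s := by
      intro x hx
      by_cases hxS : x ∈ S
      · exact ⟨x, hxS, .refl⟩
      have hdpos : 0 < d := by omega
      have hfar : (fun _ => |R| + 1 : Zd d) ∈ D := by
        refine hout _ fun h => ?_
        have h1 := (h ⟨0, hdpos⟩).2
        have := le_abs_self R
        simp only [Pi.zero_apply] at h1
        omega
      obtain ⟨u, hu, v, hv, huv, _, h3, _⟩ := (con_univ x _).first_exit (R := Dᶜ \ S)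
        ⟨hx, hxS⟩ (fun h => h.1 hfar)
      have hvS : v ∈ S := by
        by_contra hvS
        have hvD : v ∈ D := by
          by_contra hvD
          exact hv ⟨hvD, hvS⟩
        exact hu.1 (hstep v u huv.symm hvD hu.2)
      refine ⟨v, hvS, con.tail (h3.mono ?_) huv (mk_mem_edgesIn.2 ⟨hu.1, hSD hvS⟩)⟩
      exact Set.inter_subset_right.trans (edgesIn_mono Set.sdiff_subset)
    intro x hx y hy
    obtain ⟨s, hs, hxs⟩ := h1 x hx
    obtain ⟨t, ht, hyt⟩ := h1 y hy
    exact hxs.trans (((hconn s hs t ht).mono (edgesIn_mono hSD)).trans hyt.symm)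
  refine ⟨innerBd D, fun a ha b hb => innerBd_starConn hD hD' ha hb, ?_, ?_⟩
  · rintro z ⟨hz, y, hy, hzy⟩
    refine ⟨hDS z hz, y, ?_, hzy⟩
    by_contra hyS
    exact hy (hstep z y hzy hz hyS)
  · intro x hx i
    have hex : ∃ k : ℕ, Function.update x i (x i + k) ∈ D := by
      refine ⟨(|R| + 1 + |x i|).toNat, hout _ fun h => ?_⟩
      have h1 := (h i).2
      have := le_abs_self R
      have := neg_abs_le (x i)
      have := abs_nonneg (x i)
      have := abs_nonneg R
      rw [Int.toNat_of_nonneg (by omega)] at h1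
      simp only [Pi.zero_apply, Function.update_self] at h1
      omega
    have hk := Nat.find_spec hex
    have hmin := fun m => Nat.find_min (m := m) hex
    set k := Nat.find hex
    have hk0 : k ≠ 0 := by
      intro h
      rw [h] at hk
      simp only [Nat.cast_zero, add_zero, Function.update_eq_self] at hk
      exact hDS x hk hx
    refine ⟨x i + k, hk, Function.update x i (x i + (k - 1 : ℕ)), hmin (k - 1) (by omega), ?_⟩
    refine latAdj_of i ?_ fun j hj => by simp [hj]
    simp only [Function.update_self]
    have : ((k - 1 : ℕ) : ℤ) = k - 1 := by omega
    rw [this]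
    ring_nf
    simp

lemma pi_count : Measure.pi (fun _ : Fin d => (Measure.count : Measure ℤ)) = Measure.count := by
  refine Measure.ext_of_singleton fun a => ?_
  rw [Measure.pi_singleton]
  simp

/-- A discrete Loomis–Whitney inequality: if every axis line through a point of `S` meets `Γ`,
then `|S| ^ (1 - 1/d) ≤ |Γ|`. -/
theorem ncard_rpow_le (hd : 2 ≤ d) {S Γ : Set (Zd d)} (hS : S.Finite) (hΓ : Γ.Finite)
    (h : ∀ x ∈ S, ∀ i, ∃ t, Function.update x i t ∈ Γ) :
    (S.ncard : ℝ) ^ (1 - 1 / (d : ℝ)) ≤ Γ.ncard := by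
  have hd' : (2 : ℝ) ≤ d := by exact_mod_cast hd
  have hc : ∀ T : Set (Zd d), T.Finite → Measure.count T = (T.ncard : ℝ≥0∞) := by
    intro T hT
    rw [Measure.count_apply_finite _ hT, Set.ncard_eq_toFinset_card _ hT]
  have hp : Real.HolderConjugate (Fintype.card (Fin d)) ((d : ℝ) / (d - 1)) := by
    rw [Fintype.card_fin, Real.holderConjugate_iff_eq_conjExponent (by linarith)]
  have key := lintegral_prod_lintegral_pow_le (μ := fun _ : Fin d => (Measure.count : Measure ℤ))
    hp (f := Γ.indicator 1) (measurable_one.indicator hΓ.measurableSet)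
  rw [pi_count, lintegral_indicator_one hΓ.measurableSet, hc Γ hΓ] at key
  have h1 : (S.ncard : ℝ≥0∞) ≤ (Γ.ncard : ℝ≥0∞) ^ ((d : ℝ) / (d - 1)) := by
    refine le_trans ?_ key
    rw [← hc S hS, ← lintegral_indicator_one hS.measurableSet]
    refine lintegral_mono fun x => ?_
    by_cases hx : x ∈ S
    · rw [Set.indicator_of_mem hx]
      refine Finset.one_le_prod' fun i _ => ?_
      rw [Fintype.card_fin]
      refine ENNReal.one_le_rpow ?_ (by apply div_pos <;> linarith)
      obtain ⟨t, ht⟩ := h x hx i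
      rw [lintegral_count]
      refine le_trans ?_ (ENNReal.le_tsum t)
      rw [Set.indicator_of_mem ht, Pi.one_apply]
    · rw [Set.indicator_of_notMem hx]
      exact bot_le
  have h2 : (S.ncard : ℝ) ≤ (Γ.ncard : ℝ) ^ ((d : ℝ) / (d - 1)) := by
    have := ENNReal.toReal_mono (ENNReal.rpow_ne_top_of_nonneg
      (div_nonneg (by linarith) (by linarith)) (ENNReal.natCast_ne_top _)) h1
    rwa [← ENNReal.toReal_rpow, ENNReal.toReal_natCast, ENNReal.toReal_natCast] at this
  have hd1 : 0 ≤ 1 - 1 / (d : ℝ) := by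
    rw [sub_nonneg, div_le_one (by linarith)]
    linarith
  calc (S.ncard : ℝ) ^ (1 - 1 / (d : ℝ))
      ≤ ((Γ.ncard : ℝ) ^ ((d : ℝ) / (d - 1))) ^ (1 - 1 / (d : ℝ)) :=
        Real.rpow_le_rpow (by positivity) h2 hd1
    _ = (Γ.ncard : ℝ) := by
        rw [← Real.rpow_mul (by positivity)]
        have : (d : ℝ) / (d - 1) * (1 - 1 / (d : ℝ)) = 1 := by
          have : (d : ℝ) - 1 ≠ 0 := by linarith
          field_simp
        rw [this, Real.rpow_one]

/-- The blocks at scale `N` that meet `A`. -/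
def touched (N : ℤ) (A : Set (Zd d)) : Set (Zd d) := {z | (bx (blk N z) N ∩ A).Nonempty}

/-- A block is good if nearby crossings merge and its core has a crossing. -/
def goodBlock (N : ℤ) (O : Set (Sym2 (Zd d))) (z : Zd d) : Prop :=
  merge (blk N z) (2 * N) (4 * N) O ∧ ∃ y ∈ bx (blk N z) N, ∃ u ∈ sph (blk N z) (4 * N),
    con (O ∩ edgesIn (bx (blk N z) (4 * N))) y u

lemma ConnOpen.con {ω : Config d} {A : Set (Zd d)} (hA : ConnOpen ω A) {x y : Zd d} (hx : x ∈ A)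
    (hy : y ∈ A) : con (op ω ∩ edgesIn A) x y :=
  Relation.ReflTransGen.mono
    (fun _ _ h => ⟨h.1.1, h.1.2, mk_mem_edgesIn.2 ⟨h.2.1, h.2.2⟩⟩) _ _ (hA x hx y hy)

lemma div_mem_blk {N : ℤ} (hN : 0 < N) (x : Zd d) : x ∈ bx (blk N fun i => x i / N) N := by
  intro i
  simp only [blk]
  have := Int.emod_add_mul_ediv (x i) N
  have := Int.emod_nonneg (x i) hN.ne'
  have := Int.emod_lt_of_pos (x i) hN
  omega

lemma touched_connected {N : ℤ} (hN : 0 < N) {ω : Config d} {A : Set (Zd d)}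
    (hA : ConnOpen ω A) : ∀ z ∈ touched N A, ∀ z' ∈ touched N A,
      con (edgesIn (touched N A)) z z' := by
  have point : ∀ x ∈ A, ∀ z z' : Zd d, x ∈ bx (blk N z) N → x ∈ bx (blk N z') N →
      con (edgesIn (touched N A)) z z' := by
    intro x hx z z' hz hz'
    have hsub : Set.Icc (fun i => min (z i) (z' i)) (fun i => max (z i) (z' i)) ⊆
        touched N A := by
      intro w hw
      refine ⟨x, fun i => ?_, hx⟩
      have h1 := hz i
      have h2 := hz' i
      have h3 : min (z i) (z' i) ≤ w i := hw.1 i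
      have h4 : w i ≤ max (z i) (z' i) := hw.2 i
      simp only [blk] at h1 h2 ⊢
      constructor
      · rcases le_total (z i) (z' i) with h | h
        · rw [max_eq_right h] at h4; nlinarith
        · rw [max_eq_left h] at h4; nlinarith
      · rcases le_total (z i) (z' i) with h | h
        · rw [min_eq_left h] at h3; nlinarith
        · rw [min_eq_right h] at h3; nlinarith
    exact (Icc_con ⟨fun i => min_le_left _ _, fun i => le_max_left _ _⟩
      ⟨fun i => min_le_right _ _, fun i => le_max_right _ _⟩).mono (edgesIn_mono hsub)
  have adj : ∀ x y : Zd d, latAdj x y → ∃ z : Zd d, x ∈ bx (blk N z) N ∧ y ∈ bx (blk N z) N := by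
    intro x y hxy
    refine ⟨fun i => min (x i) (y i) / N, ?_, ?_⟩ <;> intro i <;> simp only [blk] <;>
    · have h1 := Int.emod_add_mul_ediv (min (x i) (y i)) N
      have h2 := Int.emod_nonneg (min (x i) (y i)) hN.ne'
      have h3 := Int.emod_lt_of_pos (min (x i) (y i)) hN
      have h4 := hxy.bound i
      rcases min_cases (x i) (y i) with h | h <;> omega
  have main : ∀ x ∈ A, ∀ y, con (op ω ∩ edgesIn A) x y → ∀ z z' : Zd d,
      x ∈ bx (blk N z) N → y ∈ bx (blk N z') N → con (edgesIn (touched N A)) z z' := by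
    intro x hx y hxy
    induction hxy with
    | refl => exact fun z z' => point x hx z z'
    | tail h0 h ih =>
      intro z z' hz hz'
      obtain ⟨w, hw, hw'⟩ := adj _ _ h.1
      exact (ih z w hz hw).trans (point _ (mk_mem_edgesIn.1 h.2.2).2 _ _ hw' hz')
  rintro z ⟨x, hx, hxA⟩ z' ⟨y, hy, hyA⟩
  exact main x hxA y (hA.con hxA hyA) z z' hx hy

lemma touched_subset {N n : ℤ} (hN : 0 < N) {A : Set (Zd d)} (hA : A ⊆ bx 0 n) :
    touched N A ⊆ bx 0 (n + 1) := by
  rintro z ⟨x, hx, hxA⟩ i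
  have h1 := hx i
  have h2 := hA hxA i
  simp only [blk, Pi.zero_apply] at h1 h2 ⊢
  have hn : 0 ≤ n := by omega
  constructor <;> nlinarith

lemma bx_ncard (b : Zd d) (N : ℕ) : (bx b N).ncard = (2 * N + 1) ^ d := by
  rw [bx_eq_Icc, ← Finset.coe_Icc, Set.ncard_coe_finset, Pi.card_Icc,
    Finset.prod_congr rfl fun i _ => show (Finset.Icc (b i - N) (b i + N)).card = 2 * N + 1 by
      rw [Int.card_Icc]; omega]
  simp

lemma ncard_le_touched {N : ℕ} (hN : 0 < N) {A : Set (Zd d)} (hT : (touched N A).Finite) :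
    A.ncard ≤ (touched N A).ncard * (2 * N + 1) ^ d := by
  have hN' : (0 : ℤ) < N := by exact_mod_cast hN
  rw [← bx_ncard 0 N, ← Set.ncard_prod]
  refine Set.ncard_le_ncard_of_injOn
    (fun x => ((fun i => x i / (N : ℤ)), fun i => x i % (N : ℤ))) ?_ ?_
    (hT.prod (bx_finite _ _))
  · intro x hx
    refine ⟨⟨x, div_mem_blk hN' x, hx⟩, fun i => ?_⟩
    have := Int.emod_nonneg (x i) hN'.ne'
    have := Int.emod_lt_of_pos (x i) hN'
    simp only [Pi.zero_apply]
    omega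
  · intro x _ y _ h
    ext i
    have h1 := congrFun (congrArg Prod.fst h) i
    have h2 := congrFun (congrArg Prod.snd h) i
    simp only at h1 h2
    rw [← Int.emod_add_mul_ediv (x i) N, ← Int.emod_add_mul_ediv (y i) N, h1, h2]

/-- A good block outside of, but adjacent to, the blocks met by `A` sees an open boundary edge
of `A`. -/
lemma exists_bdry_of_good {N : ℤ} (hN : 0 < N) {ω : Config d} {A : Set (Zd d)}
    (hA : ConnOpen ω A) {z z' : Zd d} (hz : z ∉ touched N A) (hz' : z' ∈ touched N A)
    (hzz : latAdj z z') (hg : goodBlock N (op ω) z) (hbig : ¬ A ⊆ bx (blk N z) (4 * N)) :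
    ∃ e ∈ bdry ω A, e.1 ∈ bx (blk N z) (4 * N) := by
  by_contra hno
  push Not at hno
  obtain ⟨x, hx, hxA⟩ := hz'
  obtain ⟨a, ha, ha'⟩ := Set.not_subset.1 hbig
  obtain ⟨hm, y, hy, u, hu, hyu⟩ := hg
  have hx2 : x ∈ bx (blk N z) (2 * N) := by
    intro i
    have h1 := hx i
    have h2 := hzz.bound i
    simp only [blk] at h1 ⊢
    constructor <;> nlinarith
  have hy2 : y ∈ bx (blk N z) (2 * N) := bx_mono _ (by omega) hy
  obtain ⟨v, hv, hxv⟩ := (hA.con hxA ha).hits_sph (bx_mono _ (by omega) hx2) ha'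
  have hxy := hm x hx2 y hy2
    ⟨v, hv, hxv.mono (Set.inter_subset_inter_left _ Set.inter_subset_left)⟩ ⟨u, hu, hyu⟩
  refine hz ⟨y, hy, hxy.closed ?_ hxA⟩
  intro p q hpq hpq' hp
  by_contra hq
  exact hno (p, q) ⟨⟨hpq, hpq'.1⟩, hp, hq⟩ (mk_mem_edgesIn.1 hpq'.2).1

lemma exists_coarse_boundary (hd : 2 ≤ d) {N n : ℕ} (hN : 0 < N) {ω : Config d}
    {A : Set (Zd d)} (hA : ConnOpen ω A) (hAn : A ⊆ bx 0 n) (hbd : (bdry ω A).Finite)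
    (hbig : (8 * N + 1) ^ d < A.ncard) :
    ∃ Γ : Set (Zd d), Γ ⊆ bx 0 (n + 2) ∧ (∀ a ∈ Γ, ∀ b ∈ Γ,
        Relation.ReflTransGen (fun u v => star u v ∧ u ∈ Γ ∧ v ∈ Γ) a b) ∧
      (A.ncard : ℝ) ^ (1 - 1 / (d : ℝ)) ≤ Γ.ncard * (2 * N + 1) ^ d ∧
      {z ∈ Γ | goodBlock N (op ω) z}.ncard ≤ (bdry ω A).ncard * 11 ^ d := by
  have hN' : (0 : ℤ) < N := by exact_mod_cast hN
  have hsub := touched_subset hN' hAn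
  have hTfin := (bx_finite _ _).subset hsub
  obtain ⟨Γ, hΓc, hΓ, hline⟩ := exists_outer_boundary hd hsub (touched_connected hN' hA)
  have hΓsub : Γ ⊆ bx 0 (n + 2) := by
    intro z hz i
    obtain ⟨_, y, hy, hzy⟩ := hΓ z hz
    have h1 := hsub hy i
    have h2 := hzy.bound i
    simp only [Pi.zero_apply] at h1 ⊢
    omega
  have hΓfin := (bx_finite _ _).subset hΓsub
  refine ⟨Γ, hΓsub, hΓc, ?_, ?_⟩
  · have h1 := ncard_rpow_le hd hTfin hΓfin hline
    have hd0 : (2 : ℝ) ≤ d := by exact_mod_cast hd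
    have he0 : 0 ≤ 1 - 1 / (d : ℝ) := by
      rw [sub_nonneg, div_le_one (by linarith)]; linarith
    have he1 : 1 - 1 / (d : ℝ) ≤ 1 := by
      have : 0 ≤ 1 / (d : ℝ) := by positivity
      linarith
    have h2 : (A.ncard : ℝ) ≤ (touched N A).ncard * (2 * N + 1) ^ d := by
      exact_mod_cast ncard_le_touched hN hTfin
    have h3 : (1 : ℝ) ≤ (2 * N + 1) ^ d := one_le_pow₀ (by
      have : (0 : ℝ) ≤ N := by positivity
      linarith)
    calc (A.ncard : ℝ) ^ (1 - 1 / (d : ℝ))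
        ≤ ((touched N A).ncard * (2 * N + 1) ^ d : ℝ) ^ (1 - 1 / (d : ℝ)) :=
          Real.rpow_le_rpow (by positivity) h2 he0
      _ = ((touched N A).ncard : ℝ) ^ (1 - 1 / (d : ℝ)) *
            ((2 * N + 1) ^ d : ℝ) ^ (1 - 1 / (d : ℝ)) :=
          Real.mul_rpow (by positivity) (by positivity)
      _ ≤ Γ.ncard * (2 * N + 1) ^ d := by
          refine mul_le_mul h1 ?_ (by positivity) (by positivity)
          calc ((2 * N + 1) ^ d : ℝ) ^ (1 - 1 / (d : ℝ)) ≤ ((2 * N + 1) ^ d : ℝ) ^ (1 : ℝ) :=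
                Real.rpow_le_rpow_of_exponent_le h3 he1
            _ = _ := Real.rpow_one _
  · have hbig' : ∀ z : Zd d, ¬ A ⊆ bx (blk N z) (4 * N) := by
      intro z hsub
      have h1 := Set.ncard_le_ncard hsub (bx_finite _ _)
      have h2 := bx_ncard (blk (N : ℤ) z) (4 * N)
      push_cast at h2
      rw [h2] at h1
      have : 2 * (4 * N) + 1 = 8 * N + 1 := by ring
      rw [this] at h1
      omega
    have hex : ∀ z ∈ {z ∈ Γ | goodBlock N (op ω) z}, ∃ e ∈ bdry ω A,
        e.1 ∈ bx (blk N z) (4 * N) := by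
      rintro z ⟨hz, hg⟩
      obtain ⟨h1, y, hy, hzy⟩ := hΓ z hz
      exact exists_bdry_of_good hN' hA h1 hy hzy hg (hbig' z)
    choose! e he he' using hex
    have h11 : (11 : ℕ) ^ d = (bx (0 : Zd d) (5 : ℕ)).ncard := by rw [bx_ncard]
    rw [h11, ← Set.ncard_prod]
    refine Set.ncard_le_ncard_of_injOn
      (fun z => (e z, fun i => z i - (e z).1 i / N)) ?_ ?_ (hbd.prod (bx_finite _ _))
    · intro z hz
      refine ⟨he z hz, fun i => ?_⟩
      have h1 := he' z hz i
      have h2 := Int.emod_add_mul_ediv ((e z).1 i) N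
      have h3 := Int.emod_nonneg ((e z).1 i) hN'.ne'
      have h4 := Int.emod_lt_of_pos ((e z).1 i) hN'
      simp only [blk, Pi.zero_apply] at h1 ⊢
      push_cast
      constructor <;> nlinarith
    · intro z _ z' _ h
      have h1 := congrArg Prod.fst h
      ext i
      have h2 := congrFun (congrArg Prod.snd h) i
      simp only at h1 h2
      rw [h1] at h2
      omega

lemma goodBlock_translate (N : ℤ) (O : Set (Sym2 (Zd d))) (z : Zd d) :
    goodBlock N (Sym2.map (tr (blk N z)) ⁻¹' O) 0 ↔ goodBlock N O z := by
  set b := blk N z with hb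
  have h0 : blk N (0 : Zd d) = 0 := by ext i; simp [blk]
  have hbx : ∀ r x, x ∈ bx (0 : Zd d) r ↔ tr b x ∈ bx b r := fun r x => by
    have := tr_preimage_bx b 0 r
    rw [zero_add] at this
    rw [← this]; rfl
  have hsph : ∀ r x, x ∈ sph (0 : Zd d) r ↔ tr b x ∈ sph b r := fun r x => by
    refine and_congr (hbx r x) (exists_congr fun i => ?_)
    simp only [Pi.zero_apply, tr_apply, Pi.add_apply]
    constructor <;> rintro (h | h) <;> first | (left; omega) | (right; omega)
  have hcon : ∀ r x y, con (Sym2.map (tr b) ⁻¹' O ∩ edgesIn (bx 0 r)) x y ↔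
      con (O ∩ edgesIn (bx b r)) (tr b x) (tr b y) := fun r x y => by
    rw [← con_preimage (tr_isAuto b), Set.preimage_inter, map_edgesIn]
    have : tr b ⁻¹' bx b r = bx 0 r := by ext x; exact (hbx r x).symm
    rw [this]
  unfold goodBlock merge
  rw [h0, ← hb]
  refine and_congr ?_ ?_
  · refine Equiv.forall_congr (tr b) fun x => imp_congr (hbx _ x) ?_
    refine Equiv.forall_congr (tr b) fun y => imp_congr (hbx _ y) ?_
    refine imp_congr ?_ (imp_congr ?_ (hcon _ _ _))
    · exact Equiv.exists_congr (tr b) fun u => and_congr (hsph _ u) (hcon _ _ _)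
    · exact Equiv.exists_congr (tr b) fun u => and_congr (hsph _ u) (hcon _ _ _)
  · refine Equiv.exists_congr (tr b) fun x => and_congr (hbx _ x) ?_
    exact Equiv.exists_congr (tr b) fun u => and_congr (hsph _ u) (hcon _ _ _)

lemma goodBlock_dep (N : ℤ) (z : Zd d) :
    Dep (edgesIn (bx (blk N z) (4 * N))) {ω : Config d | goodBlock N (op ω) z} :=
  (merge_dep _ _ _).inter (dep_op _ fun O => ∃ y ∈ bx (blk N z) N,
    ∃ u ∈ sph (blk N z) (4 * N), con O y u)

/-- At a suitable scale, all blocks are good with probability close to one. -/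
theorem exists_goodBlock (hd : 2 ≤ d) {p : unitInterval} (hp : pc d < p) {η : ℝ} (hη : 0 < η) :
    ∃ N : ℕ, 0 < N ∧ ∀ z, (bern fun _ : Sym2 (Zd d) => p).real
      {ω | ¬ goodBlock N (op ω) z} ≤ η := by
  set q : Sym2 (Zd d) → unitInterval := fun _ => p with hq
  obtain ⟨m, hm⟩ := exists_hit_nonempty q (bern_infinite_ne_zero hp) (half_pos hη)
  obtain ⟨N, hN, hN'⟩ := exists_merge hd hp (half_pos hη) (m + 1)
  have hmeas : ∀ z : Zd d, MeasurableSet {ω : Config d | ¬ goodBlock N (op ω) z} := fun z =>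
    (goodBlock_dep (N : ℤ) z).compl.measurableSet (edgesIn_finite (bx_finite _ _))
  refine ⟨N, by omega, fun z => ?_⟩
  have h1 : (bern q).real {ω | ¬ goodBlock N (op ω) z} =
      (bern q).real {ω | ¬ goodBlock N (op ω) 0} := by
    rw [← bern_auto (q := q) (r := p) (fun _ => rfl) (tr (blk N z)) (hmeas 0)]
    congr 1
    ext ω
    simp only [Set.mem_ofPred_eq, op_comp, goodBlock_translate]
  rw [h1]
  have h2 := hm (4 * N) (by omega)
  have hdep : Dep (edgesIn (bx (0 : Zd d) (4 * N)))
      {ω : Config d | (hit (op ω) m (4 * N : ℕ)).Nonempty} := by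
    have := dep_op (edgesIn (bx (0 : Zd d) (4 * N))) fun O =>
      {x | x ∈ sph 0 (4 * N) ∧ ∃ u ∈ bx 0 m, con O u x}.Nonempty
    simpa [hit] using this
  have h3 := probReal_compl_eq_one_sub (μ := bern q)
    (hdep.measurableSet (edgesIn_finite (bx_finite _ _)))
  have hsub : {ω : Config d | ¬ goodBlock N (op ω) 0} ⊆
      {ω | ¬ merge 0 (2 * N) (4 * N) (op ω)} ∪
        {ω : Config d | (hit (op ω) m (4 * N : ℕ)).Nonempty}ᶜ := by
    intro ω hω
    by_contra hc
    simp only [Set.mem_union, Set.mem_ofPred_eq, Set.mem_compl_iff, not_or, not_not] at hc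
    obtain ⟨hc1, x, hx, u, hu, hux⟩ := hc
    have h0 : blk (N : ℤ) (0 : Zd d) = 0 := by ext i; simp [blk]
    refine hω ⟨by rw [h0]; exact hc1, ?_⟩
    rw [h0]
    push_cast at hx hux
    exact ⟨u, bx_mono 0 (by omega) hu, x, hx, hux⟩
  calc (bern q).real {ω | ¬ goodBlock N (op ω) 0}
      ≤ _ := measureReal_mono hsub (measure_ne_top _ _)
    _ ≤ _ := measureReal_union_le _ _
    _ ≤ η := by rw [h3]; linarith

/-- Connectedness in the lattice with diagonals. -/
def StarConn (Γ : Set (Zd d)) : Prop :=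
  ∀ a ∈ Γ, ∀ b ∈ Γ, Relation.ReflTransGen (fun u v => star u v ∧ u ∈ Γ ∧ v ∈ Γ) a b

lemma starConn_sum_le (a : Zd d) (F : Finset (Finset (Zd d)))
    (hF : ∀ Γ ∈ F, a ∈ Γ ∧ StarConn (Γ : Set (Zd d))) :
    ∑ Γ ∈ F, ((1 : ℝ) / 2) ^ (3 ^ d * Γ.card) ≤ 1 := by
  classical
  let h : unitInterval := ⟨1 / 2, by norm_num, by norm_num⟩
  let nb : Finset (Zd d) → Finset (Zd d) := fun Γ =>
    Γ.biUnion fun z => Finset.Icc (fun i => z i - 1) fun i => z i + 1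
  have mem_nb : ∀ Γ : Finset (Zd d), ∀ u ∈ Γ, ∀ v, star u v → v ∈ nb Γ := by
    intro Γ u hu v huv
    refine Finset.mem_biUnion.2 ⟨u, hu, Finset.mem_Icc.2 ⟨fun i => ?_, fun i => ?_⟩⟩ <;>
    · have := abs_le.1 (huv i)
      simp only
      omega
  let E : Finset (Zd d) → Set (Zd d → Bool) := fun Γ => {ξ | ∀ z ∈ nb Γ, ξ z = decide (z ∈ Γ)}
  have hcard : ∀ Γ, (nb Γ).card ≤ 3 ^ d * Γ.card := by
    intro Γ
    rw [mul_comm]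
    refine Finset.card_biUnion_le_card_mul _ _ _ fun z _ => ?_
    rw [Pi.card_Icc, Finset.prod_congr rfl fun i _ => show
      (Finset.Icc (z i - 1) (z i + 1)).card = 3 by rw [Int.card_Icc]; omega]
    simp
  have hprob : ∀ Γ, ((1 : ℝ) / 2) ^ (3 ^ d * Γ.card) ≤
      (bern fun _ : Zd d => h).real (E Γ) := by
    intro Γ
    rw [bern_cyl_real, Finset.prod_congr rfl fun i _ => show
      (if decide (i ∈ Γ) = true then ((h : unitInterval) : ℝ) else 1 - h) = 1 / 2 by
        have : (h : ℝ) = 1 / 2 := rfl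
        rw [this]; split_ifs <;> norm_num, Finset.prod_const]
    exact pow_le_pow_of_le_one (by norm_num) (by norm_num) (hcard Γ)
  have hsub : ∀ Γ ∈ F, ∀ Γ' ∈ F, ∀ ξ, ξ ∈ E Γ → ξ ∈ E Γ' → Γ' ⊆ Γ := by
    intro Γ hΓ Γ' hΓ' ξ hξ hξ' b hb
    have hpath := (hF Γ' hΓ').2 a (hF Γ' hΓ').1 b hb
    induction hpath with
    | refl => exact (hF Γ hΓ).1
    | tail _ hst ih =>
      rename_i u v _
      have hv : v ∈ Γ' := hst.2.2
      have h1 := hξ v (mem_nb Γ u (ih hst.2.1) v hst.1)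
      have h2 := hξ' v (mem_nb Γ' v hv v fun i => by simp)
      rw [h1] at h2
      simpa [hv] using h2
  have hdisj : (F : Set (Finset (Zd d))).PairwiseDisjoint E := by
    intro Γ hΓ Γ' hΓ' hne
    refine Set.disjoint_left.2 fun ξ hξ hξ' => hne ?_
    exact Finset.Subset.antisymm (hsub Γ' hΓ' Γ hΓ ξ hξ' hξ) (hsub Γ hΓ Γ' hΓ' ξ hξ hξ')
  have hdep : ∀ Γ, Dep (nb Γ : Set (Zd d)) (E Γ) := fun Γ ω ω' hω hE z hz => by
    rw [← hω z hz]; exact hE z hz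
  calc ∑ Γ ∈ F, ((1 : ℝ) / 2) ^ (3 ^ d * Γ.card)
      ≤ ∑ Γ ∈ F, (bern fun _ : Zd d => h).real (E Γ) := Finset.sum_le_sum fun Γ _ => hprob Γ
    _ = (bern fun _ : Zd d => h).real (⋃ Γ ∈ F, E Γ) :=
        (measureReal_biUnion_finset hdisj fun Γ _ =>
          (hdep Γ).measurableSet (Finset.finite_toSet _)).symm
    _ ≤ 1 := measureReal_le_one

lemma bern_all_le {I J : Type*} (q : I → unitInterval) {S : J → Set I} {E : J → Set (I → Bool)}
    {η : ℝ} (V : Finset J) (hS : ∀ z ∈ V, (S z).Finite)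
    (hdisj : ∀ z ∈ V, ∀ z' ∈ V, z ≠ z' → Disjoint (S z) (S z'))
    (hE : ∀ z ∈ V, Dep (S z) (E z)) (hη : ∀ z ∈ V, (bern q).real (E z) ≤ η) :
    (bern q).real {ω | ∀ z ∈ V, ω ∈ E z} ≤ η ^ V.card := by
  classical
  induction V using Finset.induction_on with
  | empty => simp
  | insert z V hz ih =>
    simp only [Finset.mem_insert, forall_eq_or_imp] at hS hdisj hE hη
    have e : {ω | ∀ z' ∈ insert z V, ω ∈ E z'} = E z ∩ {ω | ∀ z' ∈ V, ω ∈ E z'} := by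
      ext ω; simp
    have hdep : Dep (⋃ z' ∈ V, S z') {ω | ∀ z' ∈ V, ω ∈ E z'} := by
      intro ω ω' hω h z' hz'
      exact hE.2 z' hz' ω ω' (fun i hi => hω i (Set.mem_biUnion hz' hi)) (h z' hz')
    rw [e, bern_indep q hS.1 (V.finite_toSet.biUnion hS.2) ?_ hE.1 hdep,
      Finset.card_insert_of_notMem hz, pow_succ']
    · exact mul_le_mul hη.1 (ih hS.2 (fun a ha b hb => (hdisj.2 a ha).2 b hb) hE.2 hη.2)
        measureReal_nonneg (measureReal_nonneg.trans hη.1)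
    · refine Set.disjoint_iUnion₂_right.2 fun z' hz' => hdisj.1.2 z' hz' ?_
      rintro rfl
      exact hz hz'

/-- Bad blocks are unlikely to be numerous. -/
lemma bern_half_bad_le {q : Sym2 (Zd d) → unitInterval} {N : ℤ} (hN : 0 < N) {θ : ℝ}
    (hθ : 0 ≤ θ) (hθ1 : θ ≤ 1)
    (hbad : ∀ z, (bern q).real {ω | ¬ goodBlock N (op ω) z} ≤ θ ^ (2 * 9 ^ d))
    (Γ : Finset (Zd d)) :
    (bern q).real {ω | 2 * {z ∈ (Γ : Set (Zd d)) | goodBlock N (op ω) z}.ncard < Γ.card} ≤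
      (2 * θ) ^ Γ.card := by
  classical
  have hU : ∀ U : Finset (Zd d), (bern q).real {ω | ∀ z ∈ U, ¬ goodBlock N (op ω) z} ≤
      θ ^ (2 * U.card) := by
    intro U
    have h9 : (0 : ℝ) < 9 ^ d := by positivity
    obtain ⟨c, -, hc⟩ := Finset.exists_le_card_fiber_of_nsmul_le_card_of_maps_to (s := U)
      (t := Finset.univ) (f := colour) (b := (U.card : ℝ) / 9 ^ d) (fun _ _ => Finset.mem_univ _)
      Finset.univ_nonempty (by
        rw [Finset.card_univ, Fintype.card_pi_const, ZMod.card, nsmul_eq_mul]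
        push_cast
        rw [mul_div_cancel₀ _ h9.ne'])
    set V := {x ∈ U | colour x = c} with hV
    rw [div_le_iff₀ h9] at hc
    have hc' : U.card ≤ V.card * 9 ^ d := by exact_mod_cast hc
    have hVU : ∀ z ∈ V, z ∈ U := fun z hz => (Finset.mem_filter.1 hz).1
    have h1 := bern_all_le q (η := θ ^ (2 * 9 ^ d)) (S := fun z => edgesIn (bx (blk N z) (4 * N)))
      (E := fun z => {ω | ¬ goodBlock N (op ω) z}) V
      (fun z _ => edgesIn_finite (bx_finite _ _))
      (fun z hz z' hz' hne => edgesIn_disjoint (blk_disjoint hN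
        ((Finset.mem_filter.1 hz).2.trans (Finset.mem_filter.1 hz').2.symm) hne))
      (fun z _ => (goodBlock_dep N z).compl) (fun z _ => hbad z)
    calc (bern q).real {ω | ∀ z ∈ U, ¬ goodBlock N (op ω) z}
        ≤ (bern q).real {ω | ∀ z ∈ V, ω ∈ {ω : Config d | ¬ goodBlock N (op ω) z}} :=
          measureReal_mono (fun ω hω z hz => hω z (hVU z hz)) (measure_ne_top _ _)
      _ ≤ (θ ^ (2 * 9 ^ d)) ^ V.card := h1
      _ ≤ θ ^ (2 * U.card) := by
          rw [← pow_mul]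
          refine pow_le_pow_of_le_one hθ hθ1 ?_
          nlinarith
  have hsub : {ω : Config d | 2 * {z ∈ (Γ : Set (Zd d)) | goodBlock N (op ω) z}.ncard < Γ.card} ⊆
      ⋃ U ∈ {U ∈ Γ.powerset | Γ.card ≤ 2 * U.card}, {ω | ∀ z ∈ U, ¬ goodBlock N (op ω) z} := by
    intro ω hω
    have e : {z ∈ (Γ : Set (Zd d)) | goodBlock N (op ω) z} =
        ({z ∈ Γ | goodBlock N (op ω) z} : Finset (Zd d)) := by ext; simp
    simp only [Set.mem_ofPred_eq, e, Set.ncard_coe_finset] at hω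
    have hadd := Finset.card_filter_add_card_filter_not (s := Γ) fun z => goodBlock N (op ω) z
    refine Set.mem_biUnion (x := {z ∈ Γ | ¬ goodBlock N (op ω) z}) ?_ fun z hz =>
      (Finset.mem_filter.1 hz).2
    simp only [Finset.coe_filter, Set.mem_ofPred_eq, Finset.mem_powerset]
    exact ⟨Finset.filter_subset _ _, by omega⟩
  calc _ ≤ _ := measureReal_mono hsub (measure_ne_top _ _)
    _ ≤ _ := measureReal_biUnion_finset_le _ _
    _ ≤ ∑ U ∈ {U ∈ Γ.powerset | Γ.card ≤ 2 * U.card}, θ ^ Γ.card := by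
        refine Finset.sum_le_sum fun U hUm => (hU U).trans ?_
        exact pow_le_pow_of_le_one hθ hθ1 (Finset.mem_filter.1 hUm).2
    _ ≤ (2 * θ) ^ Γ.card := by
        rw [Finset.sum_const, nsmul_eq_mul, mul_pow]
        refine mul_le_mul_of_nonneg_right ?_ (by positivity)
        have := Finset.card_filter_le Γ.powerset fun U => Γ.card ≤ 2 * U.card
        rw [Finset.card_powerset] at this
        exact_mod_cast this

/-- Almost surely, for large `n` at least half of the blocks of every large connected set of
blocks at distance `O(n)` are good. -/
theorem ae_half_good {q : Sym2 (Zd d) → unitInterval} {N : ℤ} (hN : 0 < N)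
    (hbad : ∀ z, (bern q).real {ω | ¬ goodBlock N (op ω) z} ≤
      ((1 / 2) ^ (3 ^ d + 2) : ℝ) ^ (2 * 9 ^ d)) :
    ∀ᵐ ω ∂(bern q), ∃ n₀ : ℕ, ∀ n ≥ n₀, ∀ Γ : Set (Zd d), Γ ⊆ bx 0 (n + 2) → StarConn Γ →
      (2 * n + 5) ^ (d + 2) ≤ 2 ^ Γ.ncard →
      Γ.ncard ≤ 2 * {z ∈ Γ | goodBlock N (op ω) z}.ncard := by
  classical
  set P := bern q
  set θ : ℝ := (1 / 2) ^ (3 ^ d + 2) with hθ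
  have hθ0 : 0 ≤ θ := by positivity
  have hθ1 : θ ≤ 1 := pow_le_one₀ (by norm_num) (by norm_num)
  let bad : Finset (Zd d) → Set (Config d) := fun Γ =>
    {ω | 2 * {z ∈ (Γ : Set (Zd d)) | goodBlock N (op ω) z}.ncard < Γ.card}
  let B : ℕ → Finset (Zd d) := fun n => (bx_finite (0 : Zd d) (n + 2)).toFinset
  let F : ℕ → Zd d → Finset (Finset (Zd d)) := fun n a =>
    {Γ ∈ (B n).powerset | (a ∈ Γ ∧ StarConn (Γ : Set (Zd d))) ∧
      (2 * n + 5) ^ (d + 2) ≤ 2 ^ Γ.card}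
  let E : ℕ → Set (Config d) := fun n => ⋃ a ∈ B n, ⋃ Γ ∈ F n a, bad Γ
  have hBcard : ∀ n, (B n).card = (2 * n + 5) ^ d := by
    intro n
    have := bx_ncard (0 : Zd d) (n + 2)
    push_cast at this
    show (bx_finite (0 : Zd d) (n + 2)).toFinset.card = _
    rw [← Set.ncard_eq_toFinset_card _ (bx_finite (0 : Zd d) (n + 2)), this]
    ring
  have hE : ∀ n : ℕ, P.real (E n) ≤ 1 / ((n : ℝ) + 1) ^ 2 := by
    intro n
    have h5 : (0 : ℝ) < 2 * n + 5 := by positivity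
    have hterm : ∀ a, ∀ Γ ∈ F n a, P.real (bad Γ) ≤
        (1 / 2) ^ (3 ^ d * Γ.card) * (1 / (2 * n + 5) ^ (d + 2)) := by
      intro a Γ hΓ
      have h2 := (Finset.mem_filter.1 hΓ).2.2
      have h2' : (2 * n + 5 : ℝ) ^ (d + 2) ≤ 2 ^ Γ.card := by exact_mod_cast h2
      calc P.real (bad Γ) ≤ (2 * θ) ^ Γ.card := bern_half_bad_le hN hθ0 hθ1 hbad Γ
        _ = (1 / 2) ^ (3 ^ d * Γ.card) * (1 / 2 ^ Γ.card) := by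
            rw [show 2 * θ = (1 / 2) ^ (3 ^ d) * (1 / 2) by rw [hθ, pow_add]; ring, mul_pow,
              ← pow_mul, one_div_pow]
            simp
        _ ≤ _ := by gcongr
    calc P.real (E n) ≤ ∑ a ∈ B n, ∑ Γ ∈ F n a, P.real (bad Γ) :=
          (measureReal_biUnion_finset_le _ _).trans
            (Finset.sum_le_sum fun a _ => measureReal_biUnion_finset_le _ _)
      _ ≤ ∑ a ∈ B n, ∑ Γ ∈ F n a,
            (1 / 2) ^ (3 ^ d * Γ.card) * (1 / (2 * n + 5 : ℝ) ^ (d + 2)) :=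
          Finset.sum_le_sum fun a _ => Finset.sum_le_sum fun Γ hΓ => hterm a Γ hΓ
      _ ≤ ∑ a ∈ B n, 1 / (2 * n + 5 : ℝ) ^ (d + 2) := by
          refine Finset.sum_le_sum fun a _ => ?_
          rw [← Finset.sum_mul]
          exact mul_le_of_le_one_left (by positivity)
            (starConn_sum_le a _ fun Γ hΓ => (Finset.mem_filter.1 hΓ).2.1)
      _ = 1 / (2 * n + 5 : ℝ) ^ 2 := by
          rw [Finset.sum_const, hBcard, nsmul_eq_mul]
          push_cast
          rw [pow_add]
          field_simp
      _ ≤ 1 / ((n : ℝ) + 1) ^ 2 := by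
          have : (0 : ℝ) ≤ n := by positivity
          exact one_div_le_one_div_of_le (by positivity)
            (pow_le_pow_left₀ (by positivity) (by linarith) 2)
  have hsum : ∑' n, P (E n) ≠ ∞ := by
    have hs : Summable fun n : ℕ => 1 / ((n : ℝ) + 1) ^ 2 := by
      have := (summable_nat_add_iff (f := fun n : ℕ => 1 / (n : ℝ) ^ 2) 1).2
        (Real.summable_one_div_nat_pow.2 (by norm_num))
      simpa using this
    refine ne_top_of_le_ne_top hs.tsum_ofReal_ne_top (ENNReal.tsum_le_tsum fun n => ?_)
    rw [← ofReal_measureReal (measure_ne_top _ _)]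
    exact ENNReal.ofReal_le_ofReal (hE n)
  filter_upwards [ae_eventually_notMem hsum] with ω hω
  obtain ⟨n₀, hn₀⟩ := Filter.eventually_atTop.1 hω
  refine ⟨n₀, fun n hn Γ hΓ hconn hcard => ?_⟩
  by_contra hlt
  push Not at hlt
  have hfin : Γ.Finite := (bx_finite _ _).subset hΓ
  lift Γ to Finset (Zd d) using hfin
  rw [Set.ncard_coe_finset] at hcard hlt
  obtain ⟨a, ha⟩ : Γ.Nonempty := Finset.card_pos.1 (by omega)
  have hB : ∀ z ∈ Γ, z ∈ B n := fun z hz => by simpa [B] using hΓ hz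
  refine hn₀ n hn (Set.mem_biUnion (hB a ha) (Set.mem_biUnion (x := Γ) ?_ hlt))
  exact Finset.mem_filter.2 ⟨Finset.mem_powerset.2 hB, ⟨ha, hconn⟩, hcard⟩

lemma clusterN_subset_bx (ω : Config d) (n : ℕ) : clusterN ω n ⊆ bx 0 n := by
  intro y hy
  have hy' : Relation.ReflTransGen
    (fun a b => openAdj ω a b ∧ a ∈ box d n ∧ b ∈ box d n) 0 y := hy
  rcases Relation.ReflTransGen.cases_tail hy' with h | ⟨z, -, -, -, h⟩
  · rw [h]; exact self_mem_bx _ (by positivity)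
  · intro i
    have := abs_le.1 (h i)
    simp only [Pi.zero_apply]
    omega

lemma clusterN_subset_cluster (ω : Config d) (n : ℕ) : clusterN ω n ⊆ cluster ω :=
  fun y hy => Relation.ReflTransGen.mono (fun _ _ h => h.1) 0 y hy

lemma bdry_finite (ω : Config d) {A : Set (Zd d)} {n : ℕ} (hA : A ⊆ bx 0 n) :
    (bdry ω A).Finite := by
  refine ((bx_finite (0 : Zd d) n).prod (bx_finite (0 : Zd d) (n + 1))).subset ?_
  rintro ⟨x, y⟩ ⟨h, hx, -⟩
  refine ⟨hA hx, fun i => ?_⟩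
  have h1 := h.1.bound i
  have h2 := hA hx i
  simp only at h1 h2 ⊢
  omega

lemma bdry_nonempty {ω : Config d} (hω : (cluster ω).Infinite) {A : Set (Zd d)}
    (hA : A ⊆ cluster ω) (hfin : A.Finite) (hne : A.Nonempty) : (bdry ω A).Nonempty := by
  obtain ⟨y, hy, hyA⟩ := hω.exists_notMem_finite hfin
  obtain ⟨x, hx⟩ := hne
  have hx0 : con (op ω) 0 x := hA hx
  have hy0 : con (op ω) 0 y := hy
  obtain ⟨u, hu, v, hv, h1, h2, -⟩ := (hx0.symm.trans hy0).first_exit hx hyA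
  exact ⟨(u, v), ⟨h1, h2⟩, hu, hv⟩

/-- A power of `n` eventually beats the logarithm of any polynomial in `n`. -/
lemma eventually_pow_le_two_pow (k : ℕ) {K s : ℝ} (hK : 0 < K) (hs : 0 < s) :
    ∀ᶠ n : ℕ in Filter.atTop, ∀ m : ℕ, K * (n : ℝ) ^ s ≤ m → (2 * n + 5) ^ k ≤ 2 ^ m := by
  have hl2 : 0 < Real.log 2 := Real.log_pos (by norm_num)
  set ε : ℝ := K * Real.log 2 / (2 * (k + 1)) with hε
  have hε0 : 0 < ε := by positivity
  have hlog : ∀ᶠ n : ℕ in Filter.atTop, ‖Real.log n‖ ≤ ε * ‖(n : ℝ) ^ s‖ :=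
    tendsto_natCast_atTop_atTop.eventually ((isLittleO_log_rpow_atTop hs).bound hε0)
  have hpow : ∀ᶠ n : ℕ in Filter.atTop, Real.log 7 / ε ≤ (n : ℝ) ^ s :=
    ((tendsto_rpow_atTop hs).comp tendsto_natCast_atTop_atTop).eventually_ge_atTop _
  filter_upwards [hlog, hpow, Filter.eventually_ge_atTop 1] with n h1 h2 hn m hm
  have hn' : (1 : ℝ) ≤ n := by exact_mod_cast hn
  have hns : 0 ≤ (n : ℝ) ^ s := by positivity
  rw [Real.norm_of_nonneg (Real.log_nonneg hn'), Real.norm_of_nonneg hns] at h1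
  rw [div_le_iff₀ hε0] at h2
  have h5 : Real.log (2 * n + 5) ≤ 2 * ε * (n : ℝ) ^ s := by
    calc Real.log (2 * n + 5) ≤ Real.log (7 * n) :=
          Real.log_le_log (by positivity) (by linarith)
      _ = Real.log 7 + Real.log n := Real.log_mul (by norm_num) (by positivity)
      _ ≤ 2 * ε * (n : ℝ) ^ s := by linarith
  have hkey : (k : ℝ) * Real.log (2 * n + 5) ≤ m * Real.log 2 := by
    calc (k : ℝ) * Real.log (2 * n + 5) ≤ (k + 1) * (2 * ε * (n : ℝ) ^ s) :=
          mul_le_mul (by linarith) h5 (Real.log_nonneg (by linarith)) (by positivity)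
      _ = K * (n : ℝ) ^ s * Real.log 2 := by rw [hε]; field_simp
      _ ≤ m * Real.log 2 := by gcongr
  have : ((2 * n + 5 : ℝ)) ^ k ≤ 2 ^ m := by
    rw [← Real.log_le_log_iff (by positivity) (by positivity), Real.log_pow, Real.log_pow]
    exact hkey
  exact_mod_cast this

end Isoperimetry

/-- isoperimetric inequality on the percolation cluster. -/
theorem stmt1 (d : ℕ) (hd : 2 ≤ d) (γ : ℝ) (hγ : 0 < γ)
    (p : ℝ) (hp : pc d < p) (hp1 : p ≤ 1) :
    ∃ β > (0 : ℝ), ∀ c > (0 : ℝ),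
      ∀ Q : Measure (Config d), IsBernoulli p Q →
        ∀ᵐ ω ∂Q, (cluster ω).Infinite →
          ∃ N : ℕ, ∀ n ≥ N, ∀ A : Set (Zd d),
            A ⊆ clusterN ω n → A.Nonempty → ConnOpen ω A →
              β ≤ ((bdry ω A).ncard : ℝ) / fcut d γ c n (A.ncard : ℝ) := by
  have hpc : 0 ≤ pc d := Real.sSup_nonneg fun x hx => hx.1
  lift p to unitInterval using ⟨hpc.trans hp.le, hp1⟩
  obtain ⟨N, hN, hbad⟩ := exists_goodBlock hd hp
    (η := (((1 / 2) ^ (3 ^ d + 2) : ℝ)) ^ (2 * 9 ^ d)) (by positivity)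
  refine ⟨1 / (2 * 11 ^ d * (2 * N + 1) ^ d), by positivity, fun c hc Q hQ => ?_⟩
  rw [hQ.eq_bern]
  have hd' : (2 : ℝ) ≤ d := by exact_mod_cast hd
  have hdd : 0 < 1 - 1 / (d : ℝ) := by
    rw [sub_pos, div_lt_one (by linarith)]; linarith
  filter_upwards [ae_half_good (by exact_mod_cast hN) hbad] with ω hω hinf
  obtain ⟨n₀, hn₀⟩ := hω
  set K : ℝ := c ^ (1 - 1 / (d : ℝ)) / (2 * N + 1) ^ d with hK
  have hK0 : 0 < K := by positivity
  have hbig : ∀ᶠ n : ℕ in Filter.atTop, ((8 * N + 1) ^ d : ℝ) / c < (n : ℝ) ^ γ :=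
    ((tendsto_rpow_atTop hγ).comp tendsto_natCast_atTop_atTop).eventually_gt_atTop _
  obtain ⟨n₁, hn₁⟩ := Filter.eventually_atTop.1
    (hbig.and (eventually_pow_le_two_pow (d + 2) hK0 (mul_pos hγ hdd)))
  refine ⟨max n₀ n₁, fun n hn A hAn hne hA => ?_⟩
  obtain ⟨h1, h2⟩ := hn₁ n (le_of_max_le_right hn)
  have hAbx := hAn.trans (clusterN_subset_bx ω n)
  have hAfin := (bx_finite _ _).subset hAbx
  have hbd := bdry_finite ω hAbx
  have hβ : (1 : ℝ) ≤ 2 * 11 ^ d * (2 * N + 1) ^ d := by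
    have e1 : (1 : ℝ) ≤ 11 ^ d := one_le_pow₀ (by norm_num)
    have e2 : (1 : ℝ) ≤ (2 * N + 1) ^ d := one_le_pow₀ (by linarith [N.cast_nonneg (α := ℝ)])
    nlinarith
  unfold fcut
  split_ifs with hcase
  · have hpos : 0 < (bdry ω A).ncard := (Set.ncard_pos hbd).2
      (bdry_nonempty hinf (hAn.trans (clusterN_subset_cluster ω n)) hAfin hne)
    have hpos' : (1 : ℝ) ≤ (bdry ω A).ncard := by exact_mod_cast hpos
    rw [div_one]
    exact (div_le_one_of_le₀ hβ (by positivity)).trans hpos'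
  · push Not at hcase
    rw [div_lt_iff₀ hc] at h1
    have hlarge : (8 * N + 1) ^ d < A.ncard := by
      have : ((8 * N + 1) ^ d : ℝ) < A.ncard := by linarith
      exact_mod_cast this
    obtain ⟨Γ, hΓ, hconn, hsize, hgood⟩ := exists_coarse_boundary hd hN hA hAbx hbd hlarge
    have hcount : (2 * n + 5) ^ (d + 2) ≤ 2 ^ Γ.ncard := by
      refine h2 _ ?_
      rw [hK, div_mul_eq_mul_div, div_le_iff₀ (by positivity)]
      calc c ^ (1 - 1 / (d : ℝ)) * (n : ℝ) ^ (γ * (1 - 1 / (d : ℝ)))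
          = (c * (n : ℝ) ^ γ) ^ (1 - 1 / (d : ℝ)) := by
            rw [Real.mul_rpow hc.le (by positivity), ← Real.rpow_mul (by positivity)]
        _ ≤ (A.ncard : ℝ) ^ (1 - 1 / (d : ℝ)) :=
            Real.rpow_le_rpow (by positivity) hcase hdd.le
        _ ≤ _ := hsize
    have hhalf := hn₀ n (le_of_max_le_left hn) Γ hΓ hconn hcount
    have hApos : (0 : ℝ) < A.ncard := by exact_mod_cast (Set.ncard_pos hAfin).2 hne
    have hΓle : (Γ.ncard : ℝ) ≤ 2 * ((bdry ω A).ncard * 11 ^ d) := by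
      exact_mod_cast hhalf.trans (Nat.mul_le_mul_left 2 hgood)
    rw [div_le_div_iff₀ (by positivity) (by positivity), one_mul]
    calc (A.ncard : ℝ) ^ (1 - 1 / (d : ℝ)) ≤ Γ.ncard * (2 * N + 1) ^ d := hsize
      _ ≤ 2 * ((bdry ω A).ncard * 11 ^ d) * (2 * N + 1) ^ d := by gcongr
      _ = _ := by ring

end Perco
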